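/- Let d > 1 be an odd positive squarefree integer and n ≥ 1 an integer. Then the class number of L_{n,d}^+ is odd if and only if d has one of the following forms: (1) d = q₁q₂ for primes q₁ ≡ q₂ ≡ 3 (mod 4) with q₁ ≡ 3 (mod 8) or q₂ ≡ 3 (mod 8); (2) d is a prime p ≡ 3 (mod 4); (3) d is a prime p ≡ 5 (mod 8); (4) d is a prime p ≡ 1 (mod 8) such that exactly one of the following holds: 2 is a fourth power residue modulo p, or p ≡ 1 (mod 16). -/

import Mathlib

open IntermediateField NumberField

/-- The quadratic field `ℚ(√m)` realized inside `ℂ` (for `m` of either sign). -/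
noncomputable def quadField (m : ℤ) : IntermediateField ℚ ℂ :=
  IntermediateField.adjoin ℚ {z : ℂ | z ^ 2 = (m : ℂ)}

/-- The 2-class group of a number field `K ⊆ ℂ`: the 2-primary component
(= 2-Sylow subgroup) of the ideal class group of its ring of integers. -/
noncomputable def twoClassGroup (K : IntermediateField ℚ ℂ) :
    Subgroup (ClassGroup (𝓞 K)) :=
  CommGroup.primaryComponent _ 2

/-- `h₂(m)`: the 2-class number of the quadratic field `ℚ(√m)`. -/
noncomputable def h2 (m : ℤ) : ℕ := Nat.card (twoClassGroup (quadField m))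

/-- `L_{n,d} = ℚ(ζ_{2^{n+2}}, √d)`, the `n`-th layer of the cyclotomic
`ℤ₂`-extension of `ℚ(√d, √-1)`. -/
noncomputable def Lfield (n : ℕ) (d : ℤ) : IntermediateField ℚ ℂ :=
  IntermediateField.adjoin ℚ
    ({z : ℂ | z ^ 2 ^ (n + 2) = 1} ∪ {z : ℂ | z ^ 2 = (d : ℂ)})

/-- `ℚ(ζ_{2^{n+2}} + ζ_{2^{n+2}}⁻¹, √d) = ℚ(2cos(2π/2^{n+2}), √d)`.
For `d > 0` this is the maximal real subfield `L_{n,d}⁺` of `L_{n,d}`;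
for `d < 0` it is the `n`-th layer `K_{n,|d|}` of the cyclotomic
`ℤ₂`-extension of the imaginary quadratic field `ℚ(√d)`. -/
noncomputable def LplusField (n : ℕ) (d : ℤ) : IntermediateField ℚ ℂ :=
  IntermediateField.adjoin ℚ
    ({((2 * Real.cos (2 * Real.pi / 2 ^ (n + 2)) : ℝ) : ℂ)} ∪ {z : ℂ | z ^ 2 = (d : ℂ)})

section Part1
open NumberField

/-- Abstract quadratic Galois extension of Dedekind domains. -/
structure QuadData (A B : Type) [CommRing A] [IsDedekindDomain A] [CommRing B] [IsDedekindDomain B]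
    [Algebra A B] [Module.Finite A B] [Module.IsTorsionFree A B] (s : B ≃+* B) : Prop where
  norm : ∀ x : B, algebraMap A B (Algebra.intNorm A B x) = x * s x
  fix : ∀ x : B, s x = x → ∃ y : A, algebraMap A B y = x
  base : ∀ y : A, s (algebraMap A B y) = algebraMap A B y
  invol : ∀ x : B, s (s x) = x
  rank : Module.finrank A B = 2
  anti : ∃ δ : B, δ ≠ 0 ∧ s δ = - δ

namespace QuadData

variable {A B : Type} [CommRing A] [IsDedekindDomain A] [CommRing B] [IsDedekindDomain B]
    [Algebra A B] [Module.Finite A B] [Module.IsTorsionFree A B] {s : B ≃+* B}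

lemma map_map (h : QuadData A B s) (I : Ideal B) : (I.map s).map s = I := by
  have : ((s : B →+* B).comp (s : B →+* B)) = RingHom.id B := by
    ext x; simp [h.invol]
  have e := Ideal.map_map (I := I) (s : B →+* B) (s : B →+* B)
  rw [this, Ideal.map_id] at e
  exact e

lemma mem_map (h : QuadData A B s) (I : Ideal B) (x : B) : x ∈ I.map s ↔ s x ∈ I := by
  constructor
  · intro hx
    have := Ideal.mem_map_of_mem s hx
    rwa [h.map_map] at this
  · intro hx
    have := Ideal.mem_map_of_mem s hx
    rwa [h.invol] at this

lemma map_base (h : QuadData A B s) (J : Ideal A) :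
    (J.map (algebraMap A B)).map s = J.map (algebraMap A B) := by
  have : ((s : B →+* B).comp (algebraMap A B)) = algebraMap A B := by
    ext x; simp [h.base]
  have e := Ideal.map_map (I := J) (algebraMap A B) (s : B →+* B)
  rw [this] at e
  exact e

lemma mul_map (h : QuadData A B s) (I : Ideal B) :
    (Ideal.relNorm A I).map (algebraMap A B) = I * I.map s := by
  by_cases hI : I = ⊥
  · subst hI; simp
  have hinj : Function.Injective (algebraMap A B) := FaithfulSMul.algebraMap_injective A B
  have hsI : I.map s ≠ ⊥ := by
    intro h0
    apply hI
    rw [← h.map_map I, h0, Ideal.map_bot]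
  have h1 : (Ideal.relNorm A I).map (algebraMap A B) ≤ I * I.map s := by
    rw [Ideal.relNorm_apply, Ideal.map_span, Ideal.span_le]
    rintro _ ⟨_, ⟨x, hx, rfl⟩, rfl⟩
    rw [h.norm]
    exact Ideal.mul_mem_mul hx (Ideal.mem_map_of_mem s hx)
  obtain ⟨C, hC⟩ := Ideal.dvd_iff_le.mpr h1
  have hs : Ideal.relNorm A (I.map s) = Ideal.relNorm A I := by
    rw [Ideal.relNorm_apply, Ideal.relNorm_apply]
    congr 1
    have key : ∀ x, Algebra.intNorm A B (s x) = Algebra.intNorm A B x := by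
      intro x
      apply hinj
      rw [h.norm, h.norm, h.invol, mul_comm]
    ext y
    constructor
    · rintro ⟨x, hx, rfl⟩
      exact ⟨s x, (h.mem_map I x).1 hx, key x⟩
    · rintro ⟨x, hx, rfl⟩
      exact ⟨s x, Ideal.mem_map_of_mem s hx, key x⟩
  have h2 := congrArg (Ideal.relNorm A) hC
  rw [Ideal.relNorm_algebraMap, h.rank, map_mul, map_mul, hs, ← pow_two] at h2
  have hNI : Ideal.relNorm A I ≠ ⊥ := by rwa [Ne, Ideal.relNorm_eq_bot_iff]
  have h3 : Ideal.relNorm A C = 1 := by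
    have : (Ideal.relNorm A I)^2 ≠ 0 := pow_ne_zero _ hNI
    exact (mul_left_cancel₀ this (by rw [mul_one]; exact h2)).symm
  have h4 : C = ⊤ := by
    have := Ideal.relNorm_le_comap (R := A) C
    rw [h3, Ideal.one_eq_top, top_le_iff, Ideal.comap_eq_top_iff] at this
    exact this
  rw [hC, h4, Ideal.mul_top]

/-- `S` contains every ramified prime. -/
def Covers (s : B ≃+* B) (S : Finset (Ideal B)) : Prop :=
  ∀ P : Ideal B, P.IsPrime → P ≠ ⊥ → (∀ x, x - s x ∈ P) → P ∈ S

lemma inv_of_ram (h : QuadData A B s) (P : Ideal B) (hP : ∀ x, x - s x ∈ P) : P.map s = P := by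
  ext x
  rw [h.mem_map]
  have := hP x
  constructor
  · intro hx; simpa using P.add_mem this hx
  · intro hx; simpa using P.sub_mem hx this

lemma prime_ext (h : QuadData A B s) (Q : Ideal B) (hQ : Q.IsPrime) (hQ0 : Q ≠ ⊥)
    (hinv : Q.map s = Q) (x : B) (hx : x - s x ∉ Q) :
    (Q.comap (algebraMap A B)).map (algebraMap A B) = Q := by
  set Q0 := Q.comap (algebraMap A B)
  have hle : Q0.map (algebraMap A B) ≤ Q := Ideal.map_comap_le
  have hN := h.mul_map Q
  rw [hinv] at hN
  have h1 : Q * Q ≤ Q0.map (algebraMap A B) := by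
    rw [← hN]
    exact Ideal.map_mono (Ideal.relNorm_le_comap (R := A) Q)
  obtain ⟨C, hC⟩ := Ideal.dvd_iff_le.mpr hle
  rw [hC] at h1
  have h2 : Q ≤ C := by
    rw [← Ideal.dvd_iff_le] at h1 ⊢
    exact (mul_dvd_mul_iff_left hQ0).1 h1
  have hmax : Q.IsMaximal := hQ.isMaximal hQ0
  by_cases hCt : C = ⊤
  · rw [hC, hCt, Ideal.mul_top]
  have hCQ : Q = C := hmax.eq_of_le hCt h2
  exfalso
  have h3 : ∀ y ∈ Q, (x - s x) * y ∈ Q * Q := by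
    intro y hy
    have hsy : s y ∈ Q := by rw [← h.mem_map, hinv]; exact hy
    have e : (x - s x) * y = (x * y + s (x * y)) - s x * (y + s y) := by
      rw [map_mul]; ring
    obtain ⟨a, ha⟩ := h.fix (x * y + s (x * y)) (by rw [map_add, h.invol, add_comm])
    obtain ⟨b, hb⟩ := h.fix (y + s y) (by rw [map_add, h.invol, add_comm])
    have hCQ' : Q0.map (algebraMap A B) = Q * Q := by rw [hC, ← hCQ]
    rw [← hCQ', e, ← ha, ← hb]
    apply Ideal.sub_mem
    · apply Ideal.mem_map_of_mem
      change algebraMap A B a ∈ Q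
      rw [ha, map_mul]
      exact Q.add_mem (Q.mul_mem_left _ hy) (Q.mul_mem_left _ hsy)
    · apply Ideal.mul_mem_left
      apply Ideal.mem_map_of_mem
      change algebraMap A B b ∈ Q
      rw [hb]
      exact Q.add_mem hy hsy
  have h4 : Ideal.span {x - s x} * Q ≤ Q * Q := by
    rw [Ideal.span_singleton_mul_le_iff]
    exact h3
  rw [← Ideal.dvd_iff_le] at h4
  have := (mul_dvd_mul_iff_right hQ0).1 h4
  rw [Ideal.dvd_span_singleton] at this
  exact hx this

lemma inv_struct (h : QuadData A B s) [DecidableEq (Ideal B)] (S : Finset (Ideal B)) (hS : Covers s S) (I : Ideal B)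
    (hI : I ≠ ⊥) (hinv : I.map s = I) :
    ∃ J : Ideal A, ∃ T ∈ S.powerset, J ≠ ⊥ ∧ I = J.map (algebraMap A B) * ∏ P ∈ T, P := by
  have hinj : Function.Injective (algebraMap A B) := FaithfulSMul.algebraMap_injective A B
  have hNne : ∀ Q : Ideal B, Q ≠ ⊥ → Ideal.relNorm A Q ≠ ⊥ := fun Q hQ => by
    rwa [Ne, Ideal.relNorm_eq_bot_iff]
  -- induct upward on I
  suffices H : ∀ I : Ideal B, I ≠ ⊥ → I.map s = I → (∃ J : Ideal A, ∃ T : Finset (Ideal B),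
      (∀ P ∈ T, ∀ x, x - s x ∈ P) ∧ T ⊆ S ∧ J ≠ ⊥ ∧ I = J.map (algebraMap A B) * ∏ P ∈ T, P) by
    obtain ⟨J, T, _, hT, hJ, e⟩ := H I hI hinv
    exact ⟨J, T, Finset.mem_powerset.2 hT, hJ, e⟩
  clear hI hinv I
  intro I
  induction I using IsNoetherian.induction with
  | hgt I ih =>
  intro hI hinv
  by_cases htop : I = ⊤
  · refine ⟨⊤, ∅, by simp, by simp, ?_, ?_⟩
    · intro ht
      have : Ideal.map (algebraMap A B) ⊤ = ⊥ := by rw [ht, Ideal.map_bot]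
      rw [Ideal.map_top, ← htop] at this
      exact hI this
    · simp [htop, Ideal.map_top]
  obtain ⟨Q, hQm, hIQ⟩ := Ideal.exists_le_maximal I htop
  have hQ := hQm.isPrime
  have hQ0 : Q ≠ ⊥ := fun h0 => hI (le_bot_iff.1 (h0 ▸ hIQ))
  have hgt : ∀ C I' : Ideal B, C ≠ ⊤ → I = C * I' → I < I' := by
    intro C I' hC e
    have hI'0 : I' ≠ ⊥ := by rintro rfl; exact hI (by rw [e, Ideal.mul_bot])
    refine lt_of_le_of_ne (e.le.trans Ideal.mul_le_right) ?_
    intro e2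
    apply hC
    rw [← e2] at e
    have : (1 : Ideal B) * I = C * I := by rw [one_mul, ← e]
    exact (mul_right_cancel₀ hI this).symm.trans Ideal.one_eq_top
  -- dividing by an invariant ideal
  have hdiv : ∀ C : Ideal B, C ≠ ⊤ → C.map s = C → C ∣ I → ∃ I' : Ideal B,
      I = C * I' ∧ (∃ J : Ideal A, ∃ T : Finset (Ideal B),
      (∀ P ∈ T, ∀ x, x - s x ∈ P) ∧ T ⊆ S ∧ J ≠ ⊥ ∧ I' = J.map (algebraMap A B) * ∏ P ∈ T, P) := by
    rintro C hC hCs ⟨I', e⟩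
    refine ⟨I', e, ih I' (hgt C I' hC e) ?_ ?_⟩
    · rintro rfl; exact hI (by rw [e, Ideal.mul_bot])
    · have hC0 : C ≠ ⊥ := by rintro rfl; exact hI (by rw [e, Ideal.bot_mul])
      have := hinv
      rw [e, Ideal.map_mul, hCs] at this
      exact mul_left_cancel₀ hC0 this
  by_cases hram : ∀ x, x - s x ∈ Q
  · have hQs := h.inv_of_ram Q hram
    obtain ⟨I', e, J, T, hT1, hT2, hJ, e'⟩ := hdiv Q hQ.ne_top hQs (Ideal.dvd_iff_le.2 hIQ)
    by_cases hQT : Q ∈ T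
    · refine ⟨J * Ideal.relNorm A Q, T.erase Q, fun P hP => hT1 P (Finset.mem_of_mem_erase hP),
        (Finset.erase_subset _ _).trans hT2, mul_ne_zero hJ (hNne Q hQ0), ?_⟩
      rw [e, e', Ideal.map_mul, h.mul_map, hQs, ← Finset.mul_prod_erase T (fun P => P) hQT]
      ring
    · refine ⟨J, insert Q T, ?_, ?_, hJ, ?_⟩
      · intro P hP
        rcases Finset.mem_insert.1 hP with rfl | hP
        · exact hram
        · exact hT1 P hP
      · exact Finset.insert_subset (hS Q hQ hQ0 hram) hT2
      · rw [e, e', Finset.prod_insert hQT]; ring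
  · push Not at hram
    obtain ⟨x, hx⟩ := hram
    -- find an extended ideal dividing I
    have hex : ∃ N : Ideal A, N ≠ ⊥ ∧ N.map (algebraMap A B) ≠ ⊤ ∧ N.map (algebraMap A B) ∣ I := by
      by_cases hQs : Q.map s = Q
      · have := h.prime_ext Q hQ hQ0 hQs x hx
        refine ⟨Q.comap (algebraMap A B), ?_, ?_, ?_⟩
        · intro h0; rw [h0, Ideal.map_bot] at this; exact hQ0 this.symm
        · rw [this]; exact hQ.ne_top
        · rw [this]; exact Ideal.dvd_iff_le.2 hIQ
      · refine ⟨Ideal.relNorm A Q, hNne Q hQ0, ?_, ?_⟩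
        · rw [h.mul_map]
          intro ht
          exact hQ.ne_top (top_le_iff.1 (ht.ge.trans Ideal.mul_le_left))
        · rw [h.mul_map]
          have hsQ : (Q.map s).IsPrime := Ideal.map_isPrime_of_equiv s
          have hcop : IsCoprime Q (Q.map s) := by
            rw [Ideal.isCoprime_iff_sup_eq]
            by_contra hne
            have h1 : Q = Q ⊔ Q.map s := hQm.eq_of_le hne le_sup_left
            have hle : Q.map s ≤ Q := le_sup_right.trans h1.ge
            have h2 : (Q.map s).map s ≤ Q.map s := Ideal.map_mono hle
            rw [h.map_map] at h2
            exact hQs (le_antisymm hle h2)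
          apply hcop.mul_dvd (Ideal.dvd_iff_le.2 hIQ)
          rw [Ideal.dvd_iff_le, ← hinv]
          exact Ideal.map_mono hIQ
    obtain ⟨N, hN0, hNt, hNI⟩ := hex
    obtain ⟨I', e, J, T, hT1, hT2, hJ, e'⟩ := hdiv _ hNt (h.map_base N) hNI
    refine ⟨N * J, T, hT1, hT2, mul_ne_zero hN0 hJ, ?_⟩
    rw [e, e', Ideal.map_mul]
    ring

end QuadData

end Part1

section Part2
section AddIndex

lemma two_index_finite (T : Type*) [AddCommGroup T] [Finite T] :
    (nsmulAddMonoidHom (α := T) 2).range.index = Nat.card (nsmulAddMonoidHom (α := T) 2).ker := by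
  have h1 := AddSubgroup.card_mul_index (nsmulAddMonoidHom (α := T) 2).range
  have h2 := AddSubgroup.card_mul_index (nsmulAddMonoidHom (α := T) 2).ker
  rw [AddSubgroup.index_ker] at h2
  have h3 : Nat.card (nsmulAddMonoidHom (α := T) 2).range ≠ 0 := Nat.card_pos.ne'
  have : Nat.card (nsmulAddMonoidHom (α := T) 2).range * (nsmulAddMonoidHom (α := T) 2).range.index
    = Nat.card (nsmulAddMonoidHom (α := T) 2).range * Nat.card (nsmulAddMonoidHom (α := T) 2).ker := by
    rw [h1, ← h2, mul_comm]
  exact Nat.eq_of_mul_eq_mul_left (Nat.pos_of_ne_zero h3) this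

lemma two_index_int : (nsmulAddMonoidHom (α := ℤ) 2).range.index = 2 := by
  rw [Int.range_nsmulAddMonoidHom]
  simp

lemma two_index_pi (n : ℕ) : (nsmulAddMonoidHom (α := Fin n → ℤ) 2).range.index = 2 ^ n := by
  have : (nsmulAddMonoidHom (α := Fin n → ℤ) 2).range =
      AddSubgroup.pi Set.univ (fun _ => (nsmulAddMonoidHom (α := ℤ) 2).range) := by
    ext x
    simp only [AddMonoidHom.mem_range, AddSubgroup.mem_pi, Set.mem_univ, forall_const]
    constructor
    · rintro ⟨y, rfl⟩ i
      exact ⟨y i, rfl⟩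
    · intro h
      choose y hy using h
      exact ⟨y, funext hy⟩
  rw [this, AddSubgroup.index_pi]
  simp [two_index_int]

lemma two_index_congr {M N : Type*} [AddCommGroup M] [AddCommGroup N] (e : M ≃+ N) :
    (nsmulAddMonoidHom (α := M) 2).range.index = (nsmulAddMonoidHom (α := N) 2).range.index := by
  have : (nsmulAddMonoidHom (α := M) 2).range = 
     (nsmulAddMonoidHom (α := N) 2).range.comap (e : M →+ N) := by
    ext x
    simp only [AddMonoidHom.mem_range, AddSubgroup.mem_comap]
    constructor
    · rintro ⟨y, rfl⟩
      exact ⟨e y, by simp⟩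
    · rintro ⟨y, hy⟩
      refine ⟨e.symm y, e.injective ?_⟩
      simpa using hy
  rw [this, AddSubgroup.index_comap_of_surjective _ e.surjective]

lemma finrank_zero_of_tors (M : Type*) [AddCommGroup M] [Module.Finite ℤ M] (k : ℤ) (hk : k ≠ 0)
    (h : ∀ x : M, k • x = 0) : Module.finrank ℤ M = 0 := by
  rw [Module.finrank_eq_zero_iff_isTorsion]
  intro x
  exact ⟨⟨k, mem_nonZeroDivisors_of_ne_zero hk⟩, h x⟩

lemma two_index_prod (n : ℕ) (T : Type*) [AddCommGroup T] [Finite T] :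
    (nsmulAddMonoidHom (α := (Fin n → ℤ) × T) 2).range.index = 2 ^ n * 
      Nat.card (nsmulAddMonoidHom (α := T) 2).ker := by
  have : (nsmulAddMonoidHom (α := (Fin n → ℤ) × T) 2).range =
      AddSubgroup.prod (nsmulAddMonoidHom (α := Fin n → ℤ) 2).range 
        (nsmulAddMonoidHom (α := T) 2).range := by
    ext ⟨x, y⟩
    simp only [AddMonoidHom.mem_range, AddSubgroup.mem_prod]
    constructor
    · rintro ⟨⟨a, b⟩, h⟩
      exact ⟨⟨a, congrArg Prod.fst h⟩, ⟨b, congrArg Prod.snd h⟩⟩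
    · rintro ⟨⟨a, ha⟩, ⟨b, hb⟩⟩
      exact ⟨⟨a, b⟩, Prod.ext ha hb⟩
  rw [this, AddSubgroup.index_prod, two_index_pi, two_index_finite]

lemma finrank_range_ker {M N : Type*} [AddCommGroup M] [Module.Finite ℤ M] [AddCommGroup N]
    (f : M →ₗ[ℤ] N) : Module.finrank ℤ (LinearMap.range f) + Module.finrank ℤ (LinearMap.ker f)
      = Module.finrank ℤ M := by
  rw [← f.quotKerEquivRange.finrank_eq]
  exact Submodule.finrank_quotient_add_finrank _

lemma finrank_prod_finite (n : ℕ) (T : Type*) [AddCommGroup T] [Finite T] :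
    Module.finrank ℤ ((Fin n → ℤ) × T) = n := by
  have h := finrank_range_ker (LinearMap.fst ℤ (Fin n → ℤ) T)
  rw [LinearMap.range_eq_top.2 LinearMap.fst_surjective, finrank_top] at h
  rw [← h, finrank_zero_of_tors (LinearMap.ker (LinearMap.fst ℤ (Fin n → ℤ) T)) (Nat.card T : ℤ) (by exact_mod_cast Nat.card_pos.ne')]
  · simp
  · rintro ⟨⟨x, y⟩, hx⟩
    have hx : x = 0 := hx
    subst hx
    ext1
    simp

lemma two_index (M : Type*) [AddCommGroup M] [Module.Finite ℤ M] (t : M) (ht : t ≠ 0)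
    (ht2 : t + t = 0) (htu : ∀ x : M, x + x = 0 → x = 0 ∨ x = t) :
    (nsmulAddMonoidHom (α := M) 2).range.index = 2 ^ (Module.finrank ℤ M + 1) := by
  have : AddGroup.FG M := Module.Finite.iff_addGroup_fg.1 ‹_›
  obtain ⟨n, ι, hι, p, hp, e, ⟨f⟩⟩ := AddCommGroup.equiv_free_prod_directSum_zmod M
  have : ∀ i, NeZero (p i ^ e i) := fun i => ⟨pow_ne_zero _ (hp i).ne_zero⟩
  have H : ∀ (T : Type) [AddCommGroup T] [Finite T] (g : M ≃+ (Fin n → ℤ) × T),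
      (nsmulAddMonoidHom (α := M) 2).range.index = 2 ^ (Module.finrank ℤ M + 1) := by
    intro T _ _ g
    have hz : ∀ z : Fin n → ℤ, z + z = 0 → z = 0 := by
      intro z hz
      funext i
      have := congrFun hz i
      simp only [Pi.add_apply, Pi.zero_apply] at this
      simp only [Pi.zero_apply]
      omega
    have e1 : Nat.card (nsmulAddMonoidHom (α := T) 2).ker = 2 := by
      have hgt : (g t).1 = 0 := hz _ (by rw [← Prod.fst_add, ← map_add, ht2]; simp)
      have key : (((nsmulAddMonoidHom (α := T) 2).ker : AddSubgroup T) : Set T) = {0, (g t).2} := by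
        ext y
        simp only [SetLike.mem_coe, AddMonoidHom.mem_ker, nsmulAddMonoidHom_apply, two_nsmul,
          Set.mem_insert_iff, Set.mem_singleton_iff]
        constructor
        · intro hy
          rcases htu (g.symm (0, y)) (by rw [← map_add]; simp [hy]) with h | h
          · left
            rw [map_eq_zero_iff _ g.symm.injective] at h
            exact congrArg Prod.snd h
          · right
            rw [← h]; simp
        · rintro (rfl | rfl)
          · simp
          · rw [← Prod.snd_add, ← map_add, ht2]; simp
      have : Nat.card (((nsmulAddMonoidHom (α := T) 2).ker : AddSubgroup T) : Set T) = 2 := by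
        rw [key, Nat.card_coe_set_eq, Set.ncard_pair]
        intro h0
        apply ht
        apply g.injective
        rw [map_zero]
        exact Prod.ext hgt h0.symm
      exact this
    rw [two_index_congr g, two_index_prod, e1, g.toIntLinearEquiv.finrank_eq, finrank_prod_finite,
      pow_succ]
  exact H (∀ i, ZMod (p i ^ e i)) 
    (f.trans (Finsupp.addEquivFunOnFinite.prodCongr (DirectSum.addEquivProd _)))

/-- The index identity behind everything. -/
theorem unit_index (G : Type*) [AddCommGroup G] [Module.Finite ℤ G] (s : G →+ G)
    (hs : ∀ x, s (s x) = x) (U V W N : AddSubgroup G) (hU : ∀ x, x ∈ U ↔ s x = x)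
    (hV : ∀ x, x ∈ V ↔ x + s x = 0) (hW : ∀ x, x ∈ W ↔ ∃ y, x = y - s y)
    (hN : ∀ x, x ∈ N ↔ ∃ y, x = y + s y) (t : G) (ht : t ≠ 0) (ht2 : t + t = 0) (hst : s t = t)
    (htu : ∀ x : G, x + x = 0 → x = 0 ∨ x = t) 
    (hrank : Module.finrank ℤ G = 2 * Module.finrank ℤ U + 1) :
    W.relIndex V = 2 * N.relIndex U ∧ N.relIndex U ≠ 0 := by
  have htU : t ∈ U := (hU t).2 hst
  have htV : t ∈ V := (hV t).2 (by rw [hst, ht2])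
  have hfU : Module.Finite ℤ U := inferInstanceAs (Module.Finite ℤ (AddSubgroup.toIntSubmodule U))
  have hfV : Module.Finite ℤ V := inferInstanceAs (Module.Finite ℤ (AddSubgroup.toIntSubmodule V))
  let U2 := U.map (nsmulAddMonoidHom (α := G) 2)
  let V2 := V.map (nsmulAddMonoidHom (α := G) 2)
  have ind : ∀ H : AddSubgroup G, t ∈ H → ∀ [Module.Finite ℤ H], 
      (H.map (nsmulAddMonoidHom (α := G) 2)).relIndex H = 2 ^ (Module.finrank ℤ H + 1) := by
    intro H htH _
    rw [← two_index H ⟨t, htH⟩ (by simpa using ht) (by ext1; simpa using ht2) ?_]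
    · rw [AddSubgroup.relIndex]
      congr 1
      exact AddSubgroup.addSubgroupOf_map_nsmulAddMonoidHom_eq_range H 2
    · rintro ⟨x, hx⟩ h
      have := htu x (by simpa using congrArg Subtype.val h)
      simpa using this
  let Nm : G →+ G := AddMonoidHom.id G + s
  let Dm : G →+ G := AddMonoidHom.id G - s
  have hNm : ∀ x, Nm x = x + s x := fun x => rfl
  have hDm : ∀ x, Dm x = x - s x := fun x => rfl
  have hkN : Nm.ker = V := by ext x; rw [AddMonoidHom.mem_ker, hNm, hV]
  have hkD : Dm.ker = U := by ext x; rw [AddMonoidHom.mem_ker, hDm, hU, sub_eq_zero, eq_comm]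
  have hrN : (⊤ : AddSubgroup G).map Nm = N := by
    ext x; rw [hN]; simp [hNm, eq_comm]
  have hrD : (⊤ : AddSubgroup G).map Dm = W := by
    ext x; rw [hW]; simp [hDm, eq_comm]
  have hUN : U.map Nm = U2 := by
    ext x
    simp only [U2, AddSubgroup.mem_map, nsmulAddMonoidHom_apply, two_nsmul]
    constructor
    · rintro ⟨y, hy, rfl⟩; exact ⟨y, hy, by rw [hNm, (hU y).1 hy]⟩
    · rintro ⟨y, hy, rfl⟩; exact ⟨y, hy, by rw [hNm, (hU y).1 hy]⟩
  have hVs : ∀ y ∈ V, s y = -y := fun y hy => by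
    have := (hV y).1 hy
    rw [add_comm] at this
    exact eq_neg_of_add_eq_zero_left this
  have hVD : V.map Dm = V2 := by
    ext x
    simp only [V2, AddSubgroup.mem_map, nsmulAddMonoidHom_apply, two_nsmul]
    constructor
    · rintro ⟨y, hy, rfl⟩; exact ⟨y, hy, by rw [hDm, hVs y hy, sub_neg_eq_add]⟩
    · rintro ⟨y, hy, rfl⟩; exact ⟨y, hy, by rw [hDm, hVs y hy, sub_neg_eq_add]⟩
  have e1 : U2.relIndex N = (U ⊔ V).relIndex ⊤ := by
    rw [← hUN, ← hrN, AddSubgroup.relIndex_map_map, hkN]; simp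
  have e2 : V2.relIndex W = (U ⊔ V).relIndex ⊤ := by
    rw [← hVD, ← hrD, AddSubgroup.relIndex_map_map, hkD, sup_comm]; simp
  have hU2N : U2 ≤ N := by rw [← hUN, ← hrN]; exact AddSubgroup.map_mono le_top
  have hV2W : V2 ≤ W := by rw [← hVD, ← hrD]; exact AddSubgroup.map_mono le_top
  have hNU : N ≤ U := by
    intro x hx
    obtain ⟨y, rfl⟩ := (hN x).1 hx
    rw [hU, map_add, hs, add_comm]
  have hWV : W ≤ V := by
    intro x hx
    obtain ⟨y, rfl⟩ := (hW x).1 hx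
    rw [hV, map_sub, hs]; abel
  have f1 := AddSubgroup.relIndex_mul_relIndex U2 N U hU2N hNU
  have f2 := AddSubgroup.relIndex_mul_relIndex V2 W V hV2W hWV
  rw [e1, ind U htU] at f1
  rw [e2, ind V htV] at f2
  have hrk : Module.finrank ℤ V = Module.finrank ℤ U + 1 := by
    have g1 := finrank_range_ker (Nm.toIntLinearMap)
    have g2 : Module.finrank ℤ (LinearMap.ker Nm.toIntLinearMap) = Module.finrank ℤ V := by
      rw [← hkN]; rfl
    have g3 : Module.finrank ℤ (LinearMap.range Nm.toIntLinearMap) = Module.finrank ℤ U := by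
      apply le_antisymm
      · have : LinearMap.range Nm.toIntLinearMap ≤ AddSubgroup.toIntSubmodule U := by
          rintro _ ⟨y, rfl⟩
          exact hNU (hrN ▸ ⟨y, trivial, rfl⟩)
        exact Submodule.finrank_mono this
      · have k1 := finrank_range_ker (Nm.toIntLinearMap.comp (AddSubgroup.toIntSubmodule U).subtype)
        have k2 : Module.finrank ℤ (LinearMap.ker 
          (Nm.toIntLinearMap.comp (AddSubgroup.toIntSubmodule U).subtype)) = 0 := by
          apply finrank_zero_of_tors _ 2 two_ne_zero
          rintro ⟨⟨x, hx⟩, hx2⟩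
          have hx2 : x + s x = 0 := hx2
          rw [(hU x).1 hx] at hx2
          ext1; ext1
          simpa [two_zsmul] using hx2
        rw [k2, add_zero] at k1
        change Module.finrank ℤ (AddSubgroup.toIntSubmodule U) ≤ _
        rw [← k1]
        apply Submodule.finrank_mono
        rw [LinearMap.range_comp]
        exact LinearMap.map_le_range
    omega
  rw [hrk, pow_succ, ← f1] at f2
  have hne : (U ⊔ V).relIndex ⊤ ≠ 0 ∧ N.relIndex U ≠ 0 := by
    rw [← mul_ne_zero_iff, f1]; positivity
  refine ⟨?_, hne.2⟩
  apply Nat.eq_of_mul_eq_mul_left (Nat.pos_of_ne_zero hne.1)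
  rw [f2]; ring

end AddIndex

end Part2

section Part3
open NumberField

section cl
variable {R : Type} [CommRing R] [IsDedekindDomain R]

open Classical in
/-- class of an ideal, junk `1` for the zero ideal -/
noncomputable def cl (I : Ideal R) : ClassGroup R :=
  if h : I ≠ ⊥ then ClassGroup.mk0 ⟨I, mem_nonZeroDivisors_of_ne_zero h⟩ else 1

lemma cl_mul {I J : Ideal R} (hI : I ≠ ⊥) (hJ : J ≠ ⊥) : cl (I * J) = cl I * cl J := by
  have hIJ : I * J ≠ ⊥ := mul_ne_zero hI hJ
  rw [cl, cl, cl, dif_pos hI, dif_pos hJ, dif_pos hIJ, ← map_mul]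
  rfl

lemma cl_eq_one {I : Ideal R} (hI : I ≠ ⊥) : cl I = 1 ↔ ∃ x : R, x ≠ 0 ∧ I = Ideal.span {x} := by
  rw [cl, dif_pos hI, ClassGroup.mk0_eq_one_iff]
  constructor
  · rintro ⟨x, hx⟩
    refine ⟨x, ?_, hx⟩
    rintro rfl
    apply hI
    simpa using hx
  · rintro ⟨x, -, hx⟩
    exact ⟨x, hx⟩

lemma cl_surj (c : ClassGroup R) : ∃ I : Ideal R, I ≠ ⊥ ∧ cl I = c := by
  obtain ⟨⟨I, hI⟩, rfl⟩ := ClassGroup.mk0_surjective c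
  have hI : I ≠ ⊥ := nonZeroDivisors.ne_zero hI
  exact ⟨I, hI, by rw [cl, dif_pos hI]⟩

lemma cl_span {x : R} (hx : x ≠ 0) : cl (Ideal.span {x}) = 1 :=
  (cl_eq_one (by simpa using hx)).2 ⟨x, hx, rfl⟩

lemma cl_pow {I : Ideal R} (hI : I ≠ ⊥) (n : ℕ) : cl (I ^ n) = cl I ^ n := by
  induction n with
  | zero => 
    rw [pow_zero, pow_zero]
    have := cl_span (R := R) one_ne_zero
    rwa [Ideal.span_singleton_one, ← Ideal.one_eq_top] at this
  | succ n ih => rw [pow_succ, pow_succ, cl_mul (pow_ne_zero n hI) hI, ih]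

lemma sq_one_odd {G : Type*} [Group G] (h : Odd (Nat.card G)) (x : G) (hx : x ^ 2 = 1) : x = 1 := by
  have h1 := orderOf_dvd_of_pow_eq_one hx
  have h2 := orderOf_dvd_natCard x
  have : orderOf x ∣ Nat.gcd 2 (Nat.card G) := Nat.dvd_gcd h1 h2
  rw [Nat.coprime_two_left.2 h] at this
  exact orderOf_eq_one_iff.1 (Nat.dvd_one.1 this)

lemma odd_of_sq_one {G : Type*} [Group G] [Finite G] (h : ∀ x : G, x ^ 2 = 1 → x = 1) :
    Odd (Nat.card G) := by
  by_contra hne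
  rw [Nat.not_odd_iff_even, even_iff_two_dvd] at hne
  have : Fact (Nat.Prime 2) := ⟨Nat.prime_two⟩
  obtain ⟨x, hx⟩ := exists_prime_orderOf_dvd_card' 2 hne
  have : x = 1 := h x (by rw [← hx]; exact pow_orderOf_eq_one x)
  rw [this, orderOf_one] at hx
  omega
end cl

namespace QuadData

variable {A B : Type} [CommRing A] [IsDedekindDomain A] [CommRing B] [IsDedekindDomain B]
    [Algebra A B] [Module.Finite A B] [Module.IsTorsionFree A B] {s : B ≃+* B}

lemma map_ne_bot (h : QuadData A B s) {I : Ideal B} (hI : I ≠ ⊥) : I.map s ≠ ⊥ := by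
  intro h0
  apply hI
  rw [← h.map_map I, h0, Ideal.map_bot]

lemma ext_ne_bot (_h : QuadData A B s) {J : Ideal A} (hJ : J ≠ ⊥) : 
    J.map (algebraMap A B) ≠ ⊥ := by
  rwa [Ne, Ideal.map_eq_bot_iff_of_injective (FaithfulSMul.algebraMap_injective A B)]

lemma map_span (s : B ≃+* B) (x : B) : (Ideal.span {x}).map s = Ideal.span {s x} := by
  rw [Ideal.map_span, Set.image_singleton]

lemma relNorm_ext (h : QuadData A B s) (J : Ideal A) : 
    Ideal.relNorm A (J.map (algebraMap A B)) = J ^ 2 := by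
  rw [Ideal.relNorm_algebraMap, h.rank]

lemma relNorm_span (_h : QuadData A B s) (x : B) :
    Ideal.relNorm A (Ideal.span {x}) = Ideal.span {Algebra.intNorm A B x} := by
  rw [Ideal.relNorm_singleton]

lemma intNorm_ne (h : QuadData A B s) {x : B} (hx : x ≠ 0) : Algebra.intNorm A B x ≠ 0 := by
  intro h0
  have := h.norm x
  rw [h0, map_zero, eq_comm, mul_eq_zero] at this
  rcases this with h1 | h1
  · exact hx h1
  · exact hx (by rwa [map_eq_zero_iff _ s.injective] at h1)

lemma hilbert90 (h : QuadData A B s) [DecidableEq (Ideal B)] (S : Finset (Ideal B)) 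
    (hS : Covers s S) (v : B) (hv : v * s v = 1) :
    ∃ β : B, ∃ J : Ideal A, ∃ T ∈ S.powerset, β ≠ 0 ∧ J ≠ ⊥ ∧ v * s β = β ∧ 
      Ideal.span {β} = J.map (algebraMap A B) * ∏ P ∈ T, P := by
  have h1 : ∃ β : B, β ≠ 0 ∧ v * s β = β := by
    by_cases h0 : 1 + v = 0
    · obtain ⟨δ, hδ, hsδ⟩ := h.anti
      refine ⟨δ, hδ, ?_⟩
      rw [hsδ, eq_neg_of_add_eq_zero_right h0]; ring
    · refine ⟨1 + v, h0, ?_⟩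
      rw [map_add, map_one, mul_add, hv, mul_one, add_comm]
  obtain ⟨β, hβ, e⟩ := h1
  have hvu : IsUnit v := IsUnit.of_mul_eq_one _ hv
  obtain ⟨J, T, hT, hJ, e'⟩ := h.inv_struct S hS (Ideal.span {β}) (by simpa using hβ) (by
    rw [map_span, Ideal.span_singleton_eq_span_singleton]
    exact ⟨hvu.unit, by rw [IsUnit.unit_spec, mul_comm, e]⟩)
  exact ⟨β, J, T, hT, hβ, hJ, e, e'⟩

lemma prod_ne {β : B} (hβ : β ≠ 0) {J : Ideal A}
    {T : Finset (Ideal B)} 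
    (e : Ideal.span {β} = J.map (algebraMap A B) * ∏ P ∈ T, P) : ∏ P ∈ T, P ≠ ⊥ := by
  intro h0
  rw [h0, Ideal.mul_bot] at e
  exact hβ (by simpa using e)

lemma same_T (h : QuadData A B s) (hA : Odd (Nat.card (ClassGroup A))) (v w : B) (β γ : B) 
    (J J' : Ideal A) (PP : Ideal B) (hPP : PP ≠ ⊥) (hβ : β ≠ 0) (hγ : γ ≠ 0) (hJ : J ≠ ⊥) (hJ' : J' ≠ ⊥)
    (e1 : v * s β = β) (e2 : w * s γ = γ) 
    (f1 : Ideal.span {β} = J.map (algebraMap A B) * PP)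
    (f2 : Ideal.span {γ} = J'.map (algebraMap A B) * PP) :
    ∃ η : Bˣ, v * s η = w * η := by
  have hinj : Function.Injective (algebraMap A B) := FaithfulSMul.algebraMap_injective A B
  have g : Ideal.span {β} * J'.map (algebraMap A B) = Ideal.span {γ} * J.map (algebraMap A B) := by
    rw [f1, f2]; ring
  have g2 := congrArg (Ideal.relNorm A) g
  rw [map_mul, map_mul, h.relNorm_ext, h.relNorm_ext, h.relNorm_span, h.relNorm_span] at g2
  have g3 := congrArg cl g2
  rw [cl_mul (by simpa using h.intNorm_ne hβ) (pow_ne_zero 2 hJ'),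
    cl_mul (by simpa using h.intNorm_ne hγ) (pow_ne_zero 2 hJ), cl_span (h.intNorm_ne hβ), 
    cl_span (h.intNorm_ne hγ), one_mul, one_mul, cl_pow hJ', cl_pow hJ] at g3
  have g4 : cl J' = cl J := by
    have := sq_one_odd hA (cl J' / cl J) (by rw [div_pow, g3, div_self'])
    exact div_eq_one.1 this
  rw [cl, cl, dif_pos hJ, dif_pos hJ', ClassGroup.mk0_eq_mk0_iff] at g4
  obtain ⟨x, y, hx, hy, g5⟩ := g4
  simp only at g5
  have g6 := congrArg (Ideal.map (algebraMap A B)) g5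
  rw [Ideal.map_mul, Ideal.map_mul, Ideal.map_span, Ideal.map_span, Set.image_singleton, 
    Set.image_singleton] at g6
  have hJe := h.ext_ne_bot hJ
  have g7 : Ideal.span {β * algebraMap A B y} = Ideal.span {γ * algebraMap A B x} := by
    apply mul_right_cancel₀ hJe
    rw [← Ideal.span_singleton_mul_span_singleton, ← Ideal.span_singleton_mul_span_singleton,
      mul_assoc, ← g6, mul_right_comm, ← g]
    ring
  rw [Ideal.span_singleton_eq_span_singleton] at g7
  obtain ⟨η, hη⟩ := g7
  -- β y η = γ x
  have hs := congrArg s hη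
  simp only [map_mul, h.base] at hs
  refine ⟨η⁻¹, ?_⟩
  have hsγ : s γ ≠ 0 := by rwa [Ne, map_eq_zero_iff _ s.injective]
  have hsη : s (η : B) * s ((η⁻¹ : Bˣ) : B) = 1 := by rw [← map_mul]; simp
  have hηη : (η : B) * ((η⁻¹ : Bˣ) : B) = 1 := by simp
  have hsβ : s β ≠ 0 := by rwa [Ne, map_eq_zero_iff _ s.injective]
  have hx' : algebraMap A B x ≠ 0 := by rwa [Ne, map_eq_zero_iff _ hinj]
  have hy' : algebraMap A B y ≠ 0 := by rwa [Ne, map_eq_zero_iff _ hinj]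
  apply mul_left_cancel₀ (mul_ne_zero hy' hsβ)
  -- y sβ v sη⁻¹ = y β sη⁻¹ ; y sβ w η⁻¹ = sγ x sη⁻¹ w η⁻¹ = γ x sη⁻¹ η⁻¹ = β y sη⁻¹ 
  have k1 : algebraMap A B y * s β = s γ * algebraMap A B x * s ((η⁻¹ : Bˣ) : B) := by
    rw [← hs]; linear_combination (-(s β * algebraMap A B y)) * hsη
  calc algebraMap A B y * s β * (v * s ((η⁻¹ : Bˣ) : B))
      = algebraMap A B y * (v * s β) * s ((η⁻¹ : Bˣ) : B) := by ring
    _ = β * algebraMap A B y * (η * ((η⁻¹ : Bˣ) : B)) * s ((η⁻¹ : Bˣ) : B) := by rw [e1, hηη]; ring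
    _ = (β * algebraMap A B y * η) * ((η⁻¹ : Bˣ) : B) * s ((η⁻¹ : Bˣ) : B) := by ring
    _ = (w * s γ) * algebraMap A B x * ((η⁻¹ : Bˣ) : B) * s ((η⁻¹ : Bˣ) : B) := by rw [hη, e2]
    _ = algebraMap A B y * s β * (w * ((η⁻¹ : Bˣ) : B)) := by rw [k1]; ring

lemma count (h : QuadData A B s) (hA : Odd (Nat.card (ClassGroup A))) [DecidableEq (Ideal B)] 
    (S : Finset (Ideal B)) (hS : Covers s S) (V W : Subgroup Bˣ)
    (hV : ∀ x : Bˣ, x ∈ V ↔ (x : B) * s x = 1) 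
    (hW : ∀ x : Bˣ, x ∈ W ↔ ∃ y : Bˣ, (x : B) * s y = y) :
    W.relIndex V ≤ 2 ^ S.card ∧ (W.relIndex V = 2 ^ S.card → ∀ T ∈ S.powerset, ∃ β : B, 
      ∃ J : Ideal A, β ≠ 0 ∧ J ≠ ⊥ ∧
      Ideal.span {β} = J.map (algebraMap A B) * ∏ P ∈ T, P) := by
  choose! β J T hT hβ hJ e f using (fun v => h.hilbert90 S hS v)
  let F : V ⧸ W.subgroupOf V → S.powerset := fun q => ⟨T ((q.out : Bˣ) : B), 
    hT _ ((hV _).1 q.out.2)⟩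
  have hF : Function.Injective F := by
    intro q q' hqq
    have hqq : T ((q.out : Bˣ) : B) = T ((q'.out : Bˣ) : B) := congrArg Subtype.val hqq
    have hv := (hV _).1 q.out.2
    have hw := (hV _).1 q'.out.2
    have f1 := f _ hv
    have f2 := f _ hw
    rw [← hqq] at f2
    obtain ⟨η, hη⟩ := h.same_T hA _ _ _ _ _ _ _ (prod_ne (hβ _ hv) f1) (hβ _ hv) (hβ _ hw)
      (hJ _ hv) (hJ _ hw) (e _ hv) (e _ hw) f1 f2
    rw [← Quotient.out_eq' q, ← Quotient.out_eq' q', eq_comm]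
    rw [QuotientGroup.eq, Subgroup.mem_subgroupOf, hW]
    refine ⟨η, ?_⟩
    simp only [Subgroup.coe_mul, Subgroup.coe_inv, Units.val_mul]
    rw [mul_assoc, hη, ← mul_assoc]
    simp
  have hcard : Fintype.card S.powerset = 2 ^ S.card := by
    rw [Fintype.card_coe, Finset.card_powerset]
  have hfin : Finite (V ⧸ W.subgroupOf V) := Finite.of_injective F hF
  have hrel : W.relIndex V = Nat.card (V ⧸ W.subgroupOf V) := rfl
  refine ⟨?_, ?_⟩
  · rw [hrel, ← hcard, ← Nat.card_eq_fintype_card]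
    exact Nat.card_le_card_of_injective F hF
  · intro heq T' hT'
    have hbij : Function.Bijective F := by
      rw [Nat.bijective_iff_injective_and_card]
      refine ⟨hF, ?_⟩
      rw [← hrel, heq, Nat.card_eq_fintype_card, hcard]
    obtain ⟨q, hq⟩ := hbij.2 ⟨T', hT'⟩
    have hq : T ((q.out : Bˣ) : B) = T' := congrArg Subtype.val hq
    have hv := (hV _).1 q.out.2
    exact ⟨β _, J _, hβ _ hv, hJ _ hv, hq ▸ f _ hv⟩

lemma cl_ext_pow (h : QuadData A B s) {J : Ideal A} (hJ : J ≠ ⊥) :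
    cl (J.map (algebraMap A B)) ^ (Nat.card (ClassGroup A)) = 1 := by
  have h1 : cl (J ^ (Nat.card (ClassGroup A))) = 1 := by
    rw [cl_pow hJ]; exact pow_card_eq_one'
  rw [cl_eq_one (pow_ne_zero _ hJ)] at h1
  obtain ⟨x, hx, e⟩ := h1
  rw [← cl_pow (h.ext_ne_bot hJ), ← Ideal.map_pow, e, Ideal.map_span, Set.image_singleton]
  apply cl_span
  rwa [Ne, map_eq_zero_iff _ (FaithfulSMul.algebraMap_injective A B)]

theorem odd_step (h : QuadData A B s) (hA : Odd (Nat.card (ClassGroup A))) [Finite (ClassGroup B)]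
    [DecidableEq (Ideal B)] 
    (S : Finset (Ideal B)) (hS : Covers s S) (U V W N M : Subgroup Bˣ)
    (hU : ∀ x : Bˣ, x ∈ U ↔ s (x : B) = x) 
    (hV : ∀ x : Bˣ, x ∈ V ↔ (x : B) * s x = 1) 
    (hW : ∀ x : Bˣ, x ∈ W ↔ ∃ y : Bˣ, (x : B) * s y = y)
    (hN : ∀ x : Bˣ, x ∈ N ↔ ∃ y : Bˣ, (x : B) = y * s y)
    (hM : ∀ x : Bˣ, x ∈ M ↔ ∃ y : B, ∃ b : A, b ≠ 0 ∧ y * s y = (x : B) * (algebraMap A B b) ^ 2)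
    (hind : W.relIndex V = 2 * N.relIndex U) (hind0 : N.relIndex U ≠ 0)
    (hSM : 2 ^ S.card ≤ 2 * M.relIndex U) : Odd (Nat.card (ClassGroup B)) := by
  have hinj : Function.Injective (algebraMap A B) := FaithfulSMul.algebraMap_injective A B
  obtain ⟨c1, c2⟩ := h.count hA S hS V W hV hW
  have hNM : N ≤ M := by
    intro x hx
    obtain ⟨y, hy⟩ := (hN x).1 hx
    exact (hM x).2 ⟨y, 1, one_ne_zero, by rw [hy]; simp⟩
  have hMU : M ≤ U := by
    intro x hx
    obtain ⟨y, b, hb, e⟩ := (hM x).1 hx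
    rw [hU]
    have e2 := congrArg s e
    simp only [map_mul, map_pow, h.base, h.invol] at e2
    have hb' : algebraMap A B b ^ 2 ≠ 0 := pow_ne_zero 2 (by rwa [Ne, map_eq_zero_iff _ hinj])
    apply mul_right_cancel₀ hb'
    rw [← e, ← e2, mul_comm]
  have e3 := Subgroup.relIndex_mul_relIndex N M U hNM hMU
  have hMU0 : M.relIndex U ≠ 0 := fun h0 => hind0 (by rw [← e3, h0, mul_zero])
  have hNM0 : N.relIndex M ≠ 0 := fun h0 => hind0 (by rw [← e3, h0, zero_mul])
  have hNM1 : N.relIndex M = 1 := by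
    have : 2 * (N.relIndex M * M.relIndex U) ≤ 2 * M.relIndex U := by
      rw [e3, ← hind]; exact c1.trans hSM
    have h1 : N.relIndex M * M.relIndex U ≤ 1 * M.relIndex U := by omega
    have := Nat.le_of_mul_le_mul_right h1 (Nat.pos_of_ne_zero hMU0)
    omega
  have hMN : M ≤ N := Subgroup.relIndex_eq_one.1 hNM1
  have c3 := c2 (le_antisymm c1 (by rw [hind, ← e3, hNM1, one_mul]; exact hSM))
  apply odd_of_sq_one
  intro c hc
  obtain ⟨I, hI, rfl⟩ := cl_surj c
  rw [← cl_pow hI, cl_eq_one (pow_ne_zero 2 hI)] at hc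
  obtain ⟨a, ha, ea⟩ := hc
  have hNI : Ideal.relNorm A I ≠ ⊥ := by rwa [Ne, Ideal.relNorm_eq_bot_iff]
  have g1 : cl (Ideal.relNorm A I) = 1 := by
    apply sq_one_odd hA
    rw [← cl_pow hNI, ← map_pow, ea, h.relNorm_span, cl_span (h.intNorm_ne ha)]
  rw [cl_eq_one hNI] at g1
  obtain ⟨b, hb, eb⟩ := g1
  have hb' : algebraMap A B b ≠ 0 := by rwa [Ne, map_eq_zero_iff _ hinj]
  have g2 := h.mul_map I
  rw [eb, Ideal.map_span, Set.image_singleton] at g2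
  have g3 : Ideal.span {algebraMap A B b ^ 2} = Ideal.span {a * s a} := by
    rw [← Ideal.span_singleton_pow, g2, mul_pow, ← Ideal.map_pow, ea, map_span, 
      Ideal.span_singleton_mul_span_singleton]
  rw [Ideal.span_singleton_eq_span_singleton] at g3
  obtain ⟨e, he⟩ := g3
  have heN := hMN ((hM e).2 ⟨a, b, hb, by rw [← he, mul_comm]⟩)
  obtain ⟨η, hη⟩ := (hN e).1 heN
  set a' := a * ((η⁻¹ : Bˣ) : B) with ha'
  have hηη : (η : B) * ((η⁻¹ : Bˣ) : B) = 1 := by simp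
  have hsη : s (η : B) * s ((η⁻¹ : Bˣ) : B) = 1 := by rw [← map_mul]; simp
  have k1 : a' * s a' = algebraMap A B b ^ 2 := by
    rw [ha', map_mul]
    calc a * ((η⁻¹ : Bˣ) : B) * (s a * s ((η⁻¹ : Bˣ) : B)) 
        = (a * s a) * ((η⁻¹ : Bˣ) : B) * s ((η⁻¹ : Bˣ) : B) := by ring
      _ = algebraMap A B b ^ 2 * (η * ((η⁻¹ : Bˣ) : B)) * (s (η : B) * s ((η⁻¹ : Bˣ) : B)) := by
          rw [← he, hη]; ring
      _ = _ := by rw [hηη, hsη]; ring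
  have ea' : I ^ 2 = Ideal.span {a'} := by
    rw [ea, Ideal.span_singleton_eq_span_singleton]
    exact ⟨η⁻¹, rfl⟩
  have hβ : ∃ β : B, β ≠ 0 ∧ a' * s β = algebraMap A B b * β := by
    by_cases h0 : algebraMap A B b + a' = 0
    · obtain ⟨δ, hδ, hsδ⟩ := h.anti
      refine ⟨δ, hδ, ?_⟩
      rw [hsδ, eq_neg_of_add_eq_zero_right h0]; ring
    · refine ⟨algebraMap A B b + a', h0, ?_⟩
      rw [map_add, h.base, mul_add, k1]; ring
  obtain ⟨β, hβ0, eβ⟩ := hβ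
  have hsβ : s β ≠ 0 := by rwa [Ne, map_eq_zero_iff _ s.injective]
  have hspan : Ideal.span {s β} ≠ ⊥ := by simpa using hsβ
  have hinv : (I * Ideal.span {s β}).map s = I * Ideal.span {s β} := by
    apply mul_left_cancel₀ hI
    rw [Ideal.map_mul, map_span, h.invol, ← mul_assoc, ← g2, ← mul_assoc, ← pow_two, ea',
      Ideal.span_singleton_mul_span_singleton, Ideal.span_singleton_mul_span_singleton, eβ]
  obtain ⟨J, T, hT, hJ, eJ⟩ := h.inv_struct S hS _ (mul_ne_zero hI hspan) hinv
  obtain ⟨β2, J2, hβ2, hJ2, e2⟩ := c3 T hT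
  have k2 : I * Ideal.span {s β} * J2.map (algebraMap A B) = 
      Ideal.span {β2} * J.map (algebraMap A B) := by
    rw [eJ, e2]; ring
  have k3 := congrArg cl k2
  rw [cl_mul (mul_ne_zero hI hspan) (h.ext_ne_bot hJ2), cl_mul hI hspan, cl_span hsβ, 
    cl_mul (by simpa using hβ2) (h.ext_ne_bot hJ), cl_span hβ2, mul_one, one_mul] at k3
  have k4 := congrArg (fun z => z ^ (Nat.card (ClassGroup A))) k3
  simp only [mul_pow, h.cl_ext_pow hJ, h.cl_ext_pow hJ2, mul_one] at k4
  have k5 : cl I ^ 2 = 1 := by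
    rw [← cl_pow hI, ea, cl_span ha]
  obtain ⟨k, hk⟩ := hA
  rw [hk, pow_succ, pow_mul, k5, one_pow, one_mul] at k4
  exact k4

theorem even_step (h : QuadData A B s) (hS : Covers s ∅) 
    (U V W N : Subgroup Bˣ)
    (hV : ∀ x : Bˣ, x ∈ V ↔ (x : B) * s x = 1) 
    (hW : ∀ x : Bˣ, x ∈ W ↔ ∃ y : Bˣ, (x : B) * s y = y)
    (hind : W.relIndex V = 2 * N.relIndex U) (hind0 : N.relIndex U ≠ 0) : 
    ¬ Odd (Nat.card (ClassGroup A)) := by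
  intro hA
  classical
  obtain ⟨c1, _⟩ := h.count hA ∅ hS V W hV hW
  simp only [Finset.card_empty, pow_zero] at c1
  omega

end QuadData

end Part3

section Part4
open NumberField

section NF

/-- the induced automorphism on integers -/
noncomputable def sInt {F K : Type} [Field F] [Field K] [Algebra F K] (σ : K ≃ₐ[F] K) : 
    𝓞 K ≃+* 𝓞 K := RingOfIntegers.mapRingEquiv σ.toRingEquiv

lemma sInt_coe {F K : Type} [Field F] [Field K] [Algebra F K] (σ : K ≃ₐ[F] K) (x : 𝓞 K) : 
    ((sInt σ x : 𝓞 K) : K) = σ x := rfl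

lemma quad_all {F K : Type} [Field F] [Field K] [Algebra F K] [NumberField F] [NumberField K]
    (hr : Module.finrank F K = 2) (σ : K ≃ₐ[F] K) (hσ : σ ≠ 1) :
    (∀ g : K ≃ₐ[F] K, g = 1 ∨ g = σ) ∧ (∀ x, σ (σ x) = x) ∧ 
    (∀ x, σ x = x → ∃ y : F, algebraMap F K y = x) ∧
    ∀ x, algebraMap F K (Algebra.norm F x) = x * σ x := by
  have : Algebra.IsQuadraticExtension F K := ⟨hr⟩
  have hgal : IsGalois F K := inferInstance
  have hcard : Nat.card (K ≃ₐ[F] K) = 2 := by rw [IsGalois.card_aut_eq_finrank, hr]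
  obtain ⟨τ, h1, h2⟩ := (Nat.card_eq_two_iff' (1 : K ≃ₐ[F] K)).1 hcard
  have hστ : σ = τ := h2 σ hσ
  have hall : ∀ g : K ≃ₐ[F] K, g = 1 ∨ g = σ := by
    intro g
    by_cases hg : g = 1
    · exact Or.inl hg
    · exact Or.inr ((h2 g hg).trans hστ.symm)
  refine ⟨hall, ?_, ?_, ?_⟩
  · have : σ * σ = 1 := by
      rcases hall (σ * σ) with h | h
      · exact h
      · exact absurd (mul_eq_left.1 h) hσ
    intro x
    exact DFunLike.congr_fun this x
  · intro x hx
    apply (IsGalois.mem_range_algebraMap_iff_fixed x).2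
    intro g
    rcases hall g with rfl | rfl
    · rfl
    · exact hx
  · classical
    intro x
    rw [Algebra.norm_eq_prod_automorphisms]
    have : (Finset.univ : Finset (K ≃ₐ[F] K)) = {1, σ} := by
      ext g; simpa using hall g
    rw [this, Finset.prod_pair (Ne.symm hσ)]
    rfl

theorem nf_quadData (F K : Type) [Field F] [Field K] [NumberField F] [NumberField K] [Algebra F K]
    (hr : Module.finrank F K = 2) (σ : K ≃ₐ[F] K) (hσ : σ ≠ 1) :
    QuadData (𝓞 F) (𝓞 K) (sInt σ) := by
  obtain ⟨hall, hinv, hfix, hnorm⟩ := quad_all hr σ hσ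
  refine ⟨?_, ?_, ?_, ?_, ?_, ?_⟩
  · intro x
    apply RingOfIntegers.ext
    have h1 := Algebra.algebraMap_intNorm (A := 𝓞 F) (K := F) (L := K) (B := 𝓞 K) x
    have h2 := hnorm (x : K)
    change algebraMap F K (algebraMap (𝓞 F) F (Algebra.intNorm (𝓞 F) (𝓞 K) x)) = (x : K) * σ x
    rw [h1]
    exact h2
  · intro x hx
    obtain ⟨y, hy⟩ := hfix x (by rw [← sInt_coe, hx])
    have hyInt : IsIntegral ℤ y := by
      rw [← isIntegral_algebraMap_iff (FaithfulSMul.algebraMap_injective F K) (R := ℤ), hy]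
      exact x.2
    refine ⟨⟨y, hyInt⟩, ?_⟩
    apply RingOfIntegers.ext
    exact hy
  · intro y
    apply RingOfIntegers.ext
    rw [sInt_coe]
    exact σ.commutes _
  · intro x
    apply RingOfIntegers.ext
    rw [sInt_coe, sInt_coe, hinv]
  · rw [← hr]
    exact (IsFractionRing.finrank_eq (𝓞 F) F (𝓞 K) K).symm
  · by_contra hne
    push Not at hne
    apply hσ
    have h1 : ∀ y : 𝓞 K, σ (y : K) = y := by
      intro y
      by_contra hy
      have : y - sInt σ y ≠ 0 := by
        intro h0
        apply hy
        rw [sub_eq_zero] at h0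
        conv_rhs => rw [h0]
        rfl
      apply hne _ this
      apply RingOfIntegers.ext
      rw [sInt_coe]
      simp only [map_sub, map_neg, sInt_coe]
      rw [hinv]
      ring
    ext x
    obtain ⟨a, b, hb, rfl⟩ := IsFractionRing.div_surjective (A := 𝓞 K) x
    rw [map_div₀, h1, h1]
    rfl

lemma totReal_rank (K : Type) [Field K] [NumberField K] [IsTotallyReal K] :
    Module.finrank ℤ (Additive (𝓞 K)ˣ) + 1 = Module.finrank ℚ K := by
  rw [NumberField.Units.finrank_eq, NumberField.Units.rank, 
    InfinitePlace.card_eq_nrRealPlaces_add_nrComplexPlaces, IsTotallyReal.nrComplexPlaces_eq_zero,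
    ← IsTotallyReal.finrank]
  have : 0 < Module.finrank ℚ K := Module.finrank_pos
  omega

/-- fixed units -/
def gU {B : Type} [CommRing B] (s : B ≃+* B) : Subgroup Bˣ where
  carrier := {x | s (x : B) = x}
  mul_mem' := by
    intro a b ha hb
    simp only [Set.mem_ofPred_eq] at *
    rw [Units.val_mul, map_mul, ha, hb]
  one_mem' := by simp
  inv_mem' := by
    intro a ha
    simp only [Set.mem_ofPred_eq] at *
    have h1 : (a : B) * s ((a⁻¹ : Bˣ) : B) = 1 := by
      rw [← ha, ← map_mul]; simp
    calc s ((a⁻¹ : Bˣ) : B) = ((a⁻¹ : Bˣ) : B) * ((a : B) * s ((a⁻¹ : Bˣ) : B)) := by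
          rw [← mul_assoc]; simp
      _ = _ := by rw [h1, mul_one]

/-- action on units -/
def sU {B : Type} [CommRing B] (s : B ≃+* B) : Bˣ →* Bˣ := Units.map (s : B →* B)

lemma sU_coe {B : Type} [CommRing B] (s : B ≃+* B) (x : Bˣ) : ((sU s x : Bˣ) : B) = s x := rfl

/-- norm one units -/
def gV {B : Type} [CommRing B] (s : B ≃+* B) : Subgroup Bˣ := (MonoidHom.id Bˣ * sU s).ker
/-- units of the form y / s y -/
def gW {B : Type} [CommRing B] (s : B ≃+* B) : Subgroup Bˣ := (MonoidHom.id Bˣ / sU s).range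
/-- norms of units -/
def gN {B : Type} [CommRing B] (s : B ≃+* B) : Subgroup Bˣ := (MonoidHom.id Bˣ * sU s).range

lemma mem_gU {B : Type} [CommRing B] (s : B ≃+* B) (x : Bˣ) : x ∈ gU s ↔ s (x : B) = x := Iff.rfl
lemma mem_gV' {B : Type} [CommRing B] (s : B ≃+* B) (x : Bˣ) : x ∈ gV s ↔ x * sU s x = 1 := Iff.rfl
lemma mem_gV {B : Type} [CommRing B] (s : B ≃+* B) (x : Bˣ) : x ∈ gV s ↔ (x : B) * s x = 1 := by
  rw [mem_gV', Units.ext_iff]; rfl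
lemma mem_gN' {B : Type} [CommRing B] (s : B ≃+* B) (x : Bˣ) : 
    x ∈ gN s ↔ ∃ y : Bˣ, x = y * sU s y := by
  simp [gN, MonoidHom.mem_range, eq_comm]
lemma mem_gN {B : Type} [CommRing B] (s : B ≃+* B) (x : Bˣ) : 
    x ∈ gN s ↔ ∃ y : Bˣ, (x : B) = y * s y := by
  rw [mem_gN']
  simp only [Units.ext_iff]
  rfl
lemma mem_gW' {B : Type} [CommRing B] (s : B ≃+* B) (x : Bˣ) : 
    x ∈ gW s ↔ ∃ y : Bˣ, x = y / sU s y := by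
  simp [gW, MonoidHom.mem_range, eq_comm]
lemma mem_gW {B : Type} [CommRing B] (s : B ≃+* B) (x : Bˣ) : 
    x ∈ gW s ↔ ∃ y : Bˣ, (x : B) * s y = y := by
  rw [mem_gW']
  simp only [eq_div_iff_mul_eq', Units.ext_iff]
  rfl

lemma units_two_torsion {B : Type} [CommRing B] [IsDomain B] (x : Bˣ) (hx : x * x = 1) :
    x = 1 ∨ x = -1 := by
  have h := congrArg Units.val hx
  rw [Units.val_mul, Units.val_one] at h
  rcases mul_self_eq_one_iff.1 h with h | h
  · left; exact Units.ext h
  · right; exact Units.ext h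

theorem nf_index (F K : Type) [Field F] [Field K] [NumberField F] [NumberField K] [Algebra F K]
    [IsTotallyReal F] [IsTotallyReal K]
    (hr : Module.finrank F K = 2) (σ : K ≃ₐ[F] K) (hσ : σ ≠ 1) :
    (gW (sInt σ)).relIndex (gV (sInt σ)) = 2 * (gN (sInt σ)).relIndex (gU (sInt σ)) ∧
      (gN (sInt σ)).relIndex (gU (sInt σ)) ≠ 0 := by
  have Q := nf_quadData F K hr σ hσ
  set s := sInt σ
  have e : (𝓞 F)ˣ ≃* gU s := by
    let f : (𝓞 F)ˣ →* gU s := 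
      (Units.map (algebraMap (𝓞 F) (𝓞 K) : 𝓞 F →* 𝓞 K)).codRestrict (gU s) (fun x => Q.base x)
    have hf : Function.Bijective f := by
      constructor
      · intro x y hxy
        have := congrArg (fun z : gU s => ((z : (𝓞 K)ˣ) : 𝓞 K)) hxy
        exact Units.ext (FaithfulSMul.algebraMap_injective (𝓞 F) (𝓞 K) this)
      · rintro ⟨x, hx⟩
        obtain ⟨y, hy⟩ := Q.fix x hx
        have hx' : s ((x⁻¹ : (𝓞 K)ˣ) : 𝓞 K) = ((x⁻¹ : (𝓞 K)ˣ) : 𝓞 K) := (gU s).inv_mem hx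
        obtain ⟨z, hz⟩ := Q.fix _ hx'
        have hyz : y * z = 1 := by
          apply FaithfulSMul.algebraMap_injective (𝓞 F) (𝓞 K)
          rw [map_mul, hy, hz]; simp
        refine ⟨⟨y, z, hyz, by rw [mul_comm, hyz]⟩, ?_⟩
        ext1; ext1
        exact hy
    exact MulEquiv.ofBijective f hf
  have hrk : Module.finrank ℤ (Additive (𝓞 K)ˣ) 
      = 2 * Module.finrank ℤ (Subgroup.toAddSubgroup (gU s)) + 1 := by
    have e1 : Module.finrank ℤ (Additive (𝓞 F)ˣ) = 
        Module.finrank ℤ (Subgroup.toAddSubgroup (gU s)) :=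
      LinearEquiv.finrank_eq (AddEquiv.toIntLinearEquiv (MulEquiv.toAdditive e))
    have h1 := totReal_rank K
    have h2 := totReal_rank F
    have h3 := Module.finrank_mul_finrank ℚ F K
    rw [hr] at h3
    omega
  have key := unit_index (Additive (𝓞 K)ˣ) (MonoidHom.toAdditive (sU s)) 
    (fun x => by
      change Additive.ofMul (sU s (sU s x.toMul)) = Additive.ofMul x.toMul
      congr 1
      ext1
      exact Q.invol _) 
    (Subgroup.toAddSubgroup (gU s)) (Subgroup.toAddSubgroup (gV s)) (Subgroup.toAddSubgroup (gW s)) 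
    (Subgroup.toAddSubgroup (gN s)) 
    (fun x => by
      change x.toMul ∈ gU s ↔ Additive.ofMul (sU s x.toMul) = Additive.ofMul x.toMul
      rw [mem_gU, Additive.ofMul.apply_eq_iff_eq, Units.ext_iff]; rfl) 
    (fun x => mem_gV' s x.toMul) 
    (fun x => mem_gW' s x.toMul) 
    (fun x => mem_gN' s x.toMul) 
    (Additive.ofMul (-1)) 
    (by
      intro h
      have h2 : (-1 : (𝓞 K)ˣ) = 1 := Additive.ofMul.injective h
      have h2 : (-1 : 𝓞 K) = 1 := congrArg Units.val h2
      have h3 : (-1 : K) = 1 := by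
        have := congrArg (algebraMap (𝓞 K) K) h2
        simpa using this
      norm_num at h3) 
    (by change Additive.ofMul ((-1 : (𝓞 K)ˣ) * -1) = Additive.ofMul 1; simp) 
    (by
      change Additive.ofMul (sU s (-1 : (𝓞 K)ˣ)) = Additive.ofMul (-1 : (𝓞 K)ˣ)
      congr 1
      ext1
      rw [sU_coe]; simp) 
    (fun x hx => by
      have := units_two_torsion x.toMul hx
      exact this) hrk
  rw [Subgroup.relIndex_toAddSubgroup, Subgroup.relIndex_toAddSubgroup] at key
  exact key

end NF

end Part4

section Part5
open NumberField

/-- ramified prime -/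
def Ram {B : Type} [CommRing B] (s : B ≃+* B) (P : Ideal B) : Prop :=
  P.IsPrime ∧ P ≠ ⊥ ∧ ∀ x, x - s x ∈ P

theorem nf_even (F K : Type) [Field F] [Field K] [NumberField F] [NumberField K] [Algebra F K]
    [IsTotallyReal F] [IsTotallyReal K]
    (hr : Module.finrank F K = 2) (σ : K ≃ₐ[F] K) (hσ : σ ≠ 1)
    (hD : ∀ P : Ideal (𝓞 K), ¬ Ram (sInt σ) P) : ¬ Odd (Nat.card (ClassGroup (𝓞 F))) := by
  obtain ⟨h1, h2⟩ := nf_index F K hr σ hσ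
  refine (nf_quadData F K hr σ hσ).even_step ?_ (gU _) (gV _) (gW _) (gN _) (mem_gV _) (mem_gW _) 
    h1 h2
  intro P hP hP0 hx
  exact absurd ⟨hP, hP0, hx⟩ (hD P)

/-- units which are norms from the field -/
noncomputable def gM {F K : Type} [Field F] [Field K] [Algebra F K] (σ : K ≃ₐ[F] K) : 
    Subgroup (𝓞 K)ˣ :=
  ((MonoidHom.id Kˣ * Units.map (σ : K →* K)).range).comap 
    (Units.map (algebraMap (𝓞 K) K : 𝓞 K →* K))

lemma mem_gM {F K : Type} [Field F] [Field K] [Algebra F K] (σ : K ≃ₐ[F] K) (x : (𝓞 K)ˣ) :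
    x ∈ gM σ ↔ ∃ y : K, y * σ y = (x : 𝓞 K) := by
  rw [gM, Subgroup.mem_comap, MonoidHom.mem_range]
  constructor
  · rintro ⟨y, hy⟩
    exact ⟨y, congrArg Units.val hy⟩
  · rintro ⟨y, hy⟩
    have hx0 : ((x : 𝓞 K) : K) ≠ 0 := by
      rw [Ne, RingOfIntegers.coe_eq_zero_iff]
      exact x.ne_zero
    have hy0 : y ≠ 0 := by
      rintro rfl
      exact hx0 (by rw [← hy, zero_mul])
    refine ⟨Units.mk0 y hy0, ?_⟩
    ext1
    exact hy

lemma mem_gM2 {F K : Type} [Field F] [Field K] [NumberField F] [NumberField K] [Algebra F K]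
    (hr : Module.finrank F K = 2) (σ : K ≃ₐ[F] K) (hσ : σ ≠ 1) (x : (𝓞 K)ˣ) :
    x ∈ gM σ ↔ ∃ y : 𝓞 K, ∃ b : 𝓞 F, b ≠ 0 ∧ 
      y * sInt σ y = (x : 𝓞 K) * (algebraMap (𝓞 F) (𝓞 K) b) ^ 2 := by
  have Q := nf_quadData F K hr σ hσ
  rw [mem_gM]
  constructor
  · rintro ⟨y, hy⟩
    obtain ⟨a, b, hb, rfl⟩ := IsFractionRing.div_surjective (A := 𝓞 K) y
    have hb0 : b ≠ 0 := nonZeroDivisors.ne_zero hb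
    refine ⟨a * sInt σ b, Algebra.intNorm (𝓞 F) (𝓞 K) b, Q.intNorm_ne hb0, ?_⟩
    rw [Q.norm]
    apply RingOfIntegers.ext
    have hb1 : (b : K) ≠ 0 := by rwa [Ne, RingOfIntegers.coe_eq_zero_iff]
    have hb2 : σ (b : K) ≠ 0 := by rwa [Ne, map_eq_zero_iff _ σ.injective]
    change (a : K) * σ (b : K) * σ ((a : K) * σ (b : K)) = (x : 𝓞 K) * ((b : K) * σ (b : K)) ^ 2
    have hy : (a : K) / (b : K) * σ ((a : K) / (b : K)) = (x : 𝓞 K) := hy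
    rw [← hy, map_div₀, map_mul, (quad_all hr σ hσ).2.1]
    field_simp
  · rintro ⟨y, b, hb, h⟩
    have hb1 : (algebraMap F K (b : F)) ≠ 0 := by
      rw [Ne, map_eq_zero_iff _ (FaithfulSMul.algebraMap_injective F K)]
      rwa [RingOfIntegers.coe_eq_zero_iff]
    refine ⟨(y : K) / algebraMap F K (b : F), ?_⟩
    have h2 := congrArg (algebraMap (𝓞 K) K) h
    have h2 : (y : K) * σ (y : K) = (x : 𝓞 K) * (algebraMap F K (b : F)) ^ 2 := h2
    rw [map_div₀, AlgEquiv.commutes]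
    field_simp
    rw [h2, mul_comm]

theorem nf_odd (F K : Type) [Field F] [Field K] [NumberField F] [NumberField K] [Algebra F K]
    [IsTotallyReal F] [IsTotallyReal K]
    (hr : Module.finrank F K = 2) (σ : K ≃ₐ[F] K) (hσ : σ ≠ 1) 
    (hF : Odd (Nat.card (ClassGroup (𝓞 F)))) (S : Finset (Ideal (𝓞 K)))
    (hS : ∀ P, Ram (sInt σ) P → P ∈ S)
    (hSc : S.card ≤ 1 ∨ (S.card ≤ 2 ∧ ∃ ε : (𝓞 F)ˣ, ∀ x : K, 
      x * σ x ≠ algebraMap F K ((ε : 𝓞 F) : F))) :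
    Odd (Nat.card (ClassGroup (𝓞 K))) := by
  classical
  have Q := nf_quadData F K hr σ hσ
  obtain ⟨h1, h2⟩ := nf_index F K hr σ hσ
  have hNM : gN (sInt σ) ≤ gM σ := by
    intro x hx
    obtain ⟨y, hy⟩ := (mem_gN _ x).1 hx
    rw [mem_gM]
    exact ⟨((y : 𝓞 K) : K), by rw [hy]; simp [sInt_coe]⟩
  have hMU : gM σ ≤ gU (sInt σ) := by
    intro x hx
    obtain ⟨y, hy⟩ := (mem_gM _ x).1 hx
    rw [mem_gU]
    apply RingOfIntegers.ext
    rw [sInt_coe, ← hy, map_mul, (quad_all hr σ hσ).2.1, mul_comm]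
  have hM0 : (gM σ).relIndex (gU (sInt σ)) ≠ 0 := by
    have := Subgroup.relIndex_mul_relIndex _ _ _ hNM hMU
    intro h0
    rw [h0, mul_zero] at this
    exact h2 this.symm
  refine Q.odd_step hF S (fun P a b c => hS P ⟨a, b, c⟩) 
    (gU _) (gV _) (gW _) (gN _) (gM σ) (mem_gU _) (mem_gV _) (mem_gW _) (mem_gN _) 
    (mem_gM2 hr σ hσ) h1 h2 ?_
  rcases hSc with hc | ⟨hc, ε, hε⟩
  · have : 2 ^ S.card ≤ 2 ^ 1 := Nat.pow_le_pow_right (by norm_num) hc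
    omega
  · have h4 : 2 ^ S.card ≤ 2 ^ 2 := Nat.pow_le_pow_right (by norm_num) hc
    have : (gM σ).relIndex (gU (sInt σ)) ≠ 1 := by
      intro h1
      have hle := Subgroup.relIndex_eq_one.1 h1
      have hm : Units.map (algebraMap (𝓞 F) (𝓞 K) : 𝓞 F →* 𝓞 K) ε ∈ gU (sInt σ) := Q.base ε
      obtain ⟨y, hy⟩ := (mem_gM _ _).1 (hle hm)
      exact hε y hy
    omega

theorem nf_odd1 (F K : Type) [Field F] [Field K] [NumberField F] [NumberField K] [Algebra F K]
    [IsTotallyReal F] [IsTotallyReal K]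
    (hr : Module.finrank F K = 2) (σ : K ≃ₐ[F] K) (hσ : σ ≠ 1) 
    (hF : Odd (Nat.card (ClassGroup (𝓞 F))))
    (hS : ∀ P Q, Ram (sInt σ) P → Ram (sInt σ) Q → P = Q) :
    Odd (Nat.card (ClassGroup (𝓞 K))) := by
  by_cases h : ∃ P, Ram (sInt σ) P
  · obtain ⟨P, hP⟩ := h
    exact nf_odd F K hr σ hσ hF {P} (fun Q hQ => by simpa using hS Q P hQ hP) (Or.inl (by simp))
  · push Not at h
    exact nf_odd F K hr σ hσ hF ∅ (fun Q hQ => absurd hQ (h Q)) (Or.inl (by simp))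

theorem nf_odd2 (F K : Type) [Field F] [Field K] [NumberField F] [NumberField K] [Algebra F K]
    [IsTotallyReal F] [IsTotallyReal K]
    (hr : Module.finrank F K = 2) (σ : K ≃ₐ[F] K) (hσ : σ ≠ 1) 
    (hF : Odd (Nat.card (ClassGroup (𝓞 F))))
    (hS : ∀ P Q R, Ram (sInt σ) P → Ram (sInt σ) Q → Ram (sInt σ) R → P = Q ∨ P = R ∨ Q = R) 
    (hε : ∃ ε : (𝓞 F)ˣ, ∀ x : K, x * σ x ≠ algebraMap F K ((ε : 𝓞 F) : F)) :
    Odd (Nat.card (ClassGroup (𝓞 K))) := by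
  classical
  by_cases h : ∀ P Q, Ram (sInt σ) P → Ram (sInt σ) Q → P = Q
  · exact nf_odd1 F K hr σ hσ hF h
  · push Not at h
    obtain ⟨P, Q, hP, hQ, hPQ⟩ := h
    refine nf_odd F K hr σ hσ hF {P, Q} (fun R hR => ?_) (Or.inr ⟨Finset.card_le_two, hε⟩)
    rcases hS P Q R hP hQ hR with h | h | h
    · exact absurd h hPQ
    · simp [h]
    · simp [h]

end Part5

section Part6
open NumberField IntermediateField

/-- `K = F(γ)` is quadratic over `F` inside `ℂ`. -/
structure QE (F K : IntermediateField ℚ ℂ) (γ : ℂ) : Prop where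
  le : F ≤ K
  mem : γ ∈ K
  sq : γ ^ 2 ∈ F
  nmem : γ ∉ F
  span : ∀ x ∈ K, ∃ u ∈ F, ∃ v ∈ F, x = u + v * γ

namespace QE
variable {F K : IntermediateField ℚ ℂ} {γ : ℂ}

lemma uniq (h : QE F K γ) {u v u' v' : ℂ} (hu : u ∈ F) (hv : v ∈ F) (hu' : u' ∈ F) (hv' : v' ∈ F)
    (e : u + v * γ = u' + v' * γ) : u = u' ∧ v = v' := by
  have hvv : v = v' := by
    by_contra hne
    apply h.nmem
    have h1 : v - v' ≠ 0 := sub_ne_zero.2 hne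
    have : γ = (u' - u) / (v - v') := by
      rw [eq_div_iff h1]; linear_combination e
    rw [this]
    exact F.div_mem (F.sub_mem hu' hu) (F.sub_mem hv hv')
  subst hvv
  exact ⟨by linear_combination e, rfl⟩

/-- the algebra structure -/
@[reducible] noncomputable def alg (h : QE F K γ) : Algebra F K := (inclusion h.le).toRingHom.toAlgebra

lemma alg_coe (h : QE F K γ) (x : F) : 
    ((@algebraMap F K _ _ h.alg x : K) : ℂ) = x := rfl

lemma tower (h : QE F K γ) : 
    letI := h.alg
    IsScalarTower ℚ F K := by
  letI := h.alg
  exact IsScalarTower.of_algebraMap_eq (fun x => by ext1; rfl)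

lemma finite (h : QE F K γ) : 
    letI := h.alg
    Module.Finite F K := by
  letI := h.alg
  classical
  refine ⟨⟨{1, ⟨γ, h.mem⟩}, ?_⟩⟩
  rw [eq_top_iff]
  rintro ⟨x, hx⟩ -
  obtain ⟨u, hu, v, hv, e⟩ := h.span x hx
  have : (⟨x, hx⟩ : K) = (⟨u, hu⟩ : F) • (1 : K) + (⟨v, hv⟩ : F) • (⟨γ, h.mem⟩ : K) := by
    ext1
    rw [Algebra.smul_def, Algebra.smul_def]
    change x = u * 1 + v * γ
    rw [e]; ring
  rw [this]
  apply Submodule.add_mem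
  · exact Submodule.smul_mem _ _ (Submodule.subset_span (by simp))
  · exact Submodule.smul_mem _ _ (Submodule.subset_span (by simp))

lemma finiteDim (h : QE F K γ) [FiniteDimensional ℚ F] : FiniteDimensional ℚ K := by
  letI := h.alg
  have := h.tower
  have := h.finite
  exact Module.Finite.trans F K

lemma rank (h : QE F K γ) : 
    letI := h.alg
    Module.finrank F K = 2 := by
  letI := h.alg
  have hfin := h.finite
  have hli : LinearIndependent F ![(1 : K), ⟨γ, h.mem⟩] := by
    rw [LinearIndependent.pair_iff]
    intro a b hab
    have := congrArg (Subtype.val : K → ℂ) hab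
    rw [Algebra.smul_def, Algebra.smul_def] at this
    have this : (a : ℂ) * 1 + b * γ = 0 := this
    have := h.uniq a.2 b.2 F.zero_mem F.zero_mem (by linear_combination this)
    exact ⟨Subtype.ext this.1, Subtype.ext this.2⟩
  have hsp : ⊤ ≤ Submodule.span F (Set.range ![(1 : K), ⟨γ, h.mem⟩]) := by
    rintro ⟨x, hx⟩ -
    obtain ⟨u, hu, v, hv, e⟩ := h.span x hx
    have : (⟨x, hx⟩ : K) = (⟨u, hu⟩ : F) • (1 : K) + (⟨v, hv⟩ : F) • (⟨γ, h.mem⟩ : K) := by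
      ext1
      rw [Algebra.smul_def, Algebra.smul_def]
      change x = u * 1 + v * γ
      rw [e]; ring
    rw [this]
    apply Submodule.add_mem
    · exact Submodule.smul_mem _ _ (Submodule.subset_span ⟨0, rfl⟩)
    · exact Submodule.smul_mem _ _ (Submodule.subset_span ⟨1, rfl⟩)
  have := Module.finrank_eq_card_basis (Module.Basis.mk hli hsp)
  simpa using this

lemma exists_conj (h : QE F K γ) : 
    letI := h.alg
    ∃ σ : K ≃ₐ[F] K, σ ≠ 1 ∧ (σ ⟨γ, h.mem⟩ : ℂ) = - γ ∧ 
      ∀ u v : ℂ, ∀ (hu : u ∈ F) (hv : v ∈ F) (x : K), (x : ℂ) = u + v * γ → (σ x : ℂ) = u - v * γ := by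
  letI := h.alg
  have hfin := h.finite
  have : Algebra.IsQuadraticExtension F K := ⟨h.rank⟩
  have hcard : Nat.card (K ≃ₐ[F] K) = 2 := by rw [IsGalois.card_aut_eq_finrank, h.rank]
  obtain ⟨σ, h1, h2⟩ := (Nat.card_eq_two_iff' (1 : K ≃ₐ[F] K)).1 hcard
  have key : ∀ u v : ℂ, ∀ (hu : u ∈ F) (hv : v ∈ F) (x : K), (x : ℂ) = u + v * γ → 
      (σ x : ℂ) = u + v * (σ ⟨γ, h.mem⟩ : ℂ) := by
    intro u v hu hv x hx
    have hx' : x = algebraMap F K ⟨u, hu⟩ + algebraMap F K ⟨v, hv⟩ * ⟨γ, h.mem⟩ := Subtype.ext hx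
    rw [hx', map_add, map_mul, AlgEquiv.commutes, AlgEquiv.commutes]
    rfl
  have hg : (σ ⟨γ, h.mem⟩ : ℂ) = - γ := by
    have h3 : (σ ⟨γ, h.mem⟩ : ℂ) ^ 2 = γ ^ 2 := by
      have e1 : (⟨γ, h.mem⟩ : K) ^ 2 = algebraMap F K ⟨γ ^ 2, h.sq⟩ := Subtype.ext rfl
      have e2 := congrArg σ e1
      rw [AlgEquiv.commutes, map_pow] at e2
      exact congrArg (Subtype.val : K → ℂ) e2
    rcases sq_eq_sq_iff_eq_or_eq_neg.1 h3 with h4 | h4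
    · exfalso
      apply h1
      ext1 x
      obtain ⟨u, hu, v, hv, e⟩ := h.span x x.2
      have := key u v hu hv x e
      rw [h4, ← e] at this
      exact Subtype.ext this
    · exact h4
  refine ⟨σ, h1, hg, fun u v hu hv x hx => ?_⟩
  rw [key u v hu hv x hx, hg]; ring

/-- conjugation as a plain function on `ℂ`. -/
lemma conj_fun (h : QE F K γ) : ∃ σ : ℂ → ℂ, (∀ x ∈ K, σ x ∈ K) ∧ 
    (∀ x ∈ K, ∀ y ∈ K, σ (x + y) = σ x + σ y) ∧ (∀ x ∈ K, ∀ y ∈ K, σ (x * y) = σ x * σ y) ∧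
    (∀ x ∈ F, σ x = x) ∧ σ γ = - γ ∧ (∀ x ∈ K, x * σ x ∈ F) ∧ (∀ x ∈ K, x + σ x ∈ F) := by
  letI := h.alg
  obtain ⟨σ, h1, h2, h3⟩ := h.exists_conj
  classical
  let f : ℂ → ℂ := fun x => if hx : x ∈ K then (σ ⟨x, hx⟩ : ℂ) else 0
  have hf : ∀ x (hx : x ∈ K), f x = (σ ⟨x, hx⟩ : ℂ) := fun x hx => dif_pos hx
  refine ⟨f, ?_, ?_, ?_, ?_, ?_, ?_, ?_⟩
  · intro x hx; rw [hf x hx]; exact Subtype.property _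
  · intro x hx y hy
    rw [hf x hx, hf y hy, hf _ (K.add_mem hx hy)]
    exact congrArg (Subtype.val : K → ℂ) (map_add σ ⟨x, hx⟩ ⟨y, hy⟩)
  · intro x hx y hy
    rw [hf x hx, hf y hy, hf _ (K.mul_mem hx hy)]
    exact congrArg (Subtype.val : K → ℂ) (map_mul σ ⟨x, hx⟩ ⟨y, hy⟩)
  · intro x hx
    rw [hf x (h.le hx), h3 x 0 hx F.zero_mem _ (by simp)]; simp
  · rw [hf γ h.mem, h2]
  · intro x hx
    obtain ⟨u, hu, v, hv, e⟩ := h.span x hx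
    rw [hf x hx, h3 u v hu hv _ e, e]
    have : (u + v * γ) * (u - v * γ) = u ^ 2 - v ^ 2 * γ ^ 2 := by ring
    rw [this]
    exact F.sub_mem (F.pow_mem hu 2) (F.mul_mem (F.pow_mem hv 2) h.sq)
  · intro x hx
    obtain ⟨u, hu, v, hv, e⟩ := h.span x hx
    rw [hf x hx, h3 u v hu hv _ e, e]
    have : (u + v * γ) + (u - v * γ) = u + u := by ring
    rw [this]
    exact F.add_mem hu hu

end QE

/-- `P` satisfies the necessary condition for being ramified in `F(γ)/F`. -/
def RamE (F K : IntermediateField ℚ ℂ) (γ : ℂ) (P : Ideal (𝓞 K)) : Prop :=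
  P.IsPrime ∧ P ≠ ⊥ ∧ ∀ x y : 𝓞 K, 
    (∃ u ∈ F, ∃ v ∈ F, ((x : K) : ℂ) = u + v * γ ∧ ((y : K) : ℂ) = 2 * (v * γ)) → y ∈ P

/-- totally real and finite -/
structure TR (F : IntermediateField ℚ ℂ) : Prop where
  fin : FiniteDimensional ℚ F
  real : ∀ φ : F →+* ℂ, ∀ x, ∃ r : ℝ, φ x = r

lemma TR.nf {F : IntermediateField ℚ ℂ} (h : TR F) : NumberField F := by
  have := h.fin
  exact ⟨⟩

lemma TR.tr {F : IntermediateField ℚ ℂ} (h : TR F) : IsTotallyReal F := by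
  have := h.nf
  constructor
  intro v
  rw [← InfinitePlace.mk_embedding v, InfinitePlace.isReal_mk_iff]
  rw [ComplexEmbedding.isReal_iff]
  ext x
  obtain ⟨r, hr⟩ := h.real v.embedding x
  rw [ComplexEmbedding.conjugate_coe_eq, hr, Complex.conj_ofReal]

lemma ramE_of_ram {F K : IntermediateField ℚ ℂ} {γ : ℂ} (h : QE F K γ) : 
    letI := h.alg
    ∀ σ : K ≃ₐ[F] K, (∀ u v : ℂ, ∀ (_ : u ∈ F) (_ : v ∈ F) (x : K), 
      (x : ℂ) = u + v * γ → (σ x : ℂ) = u - v * γ) → 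
    ∀ P, Ram (sInt σ) P → RamE F K γ P := by
  letI := h.alg
  intro σ hσ P hP
  refine ⟨hP.1, hP.2.1, ?_⟩
  rintro x y ⟨u, hu, v, hv, e1, e2⟩
  have := hP.2.2 x
  have hy : y = x - sInt σ x := by
    apply RingOfIntegers.ext
    apply Subtype.ext
    change ((y : K) : ℂ) = ((x : K) : ℂ) - (σ (x : K) : ℂ)
    rw [hσ u v hu hv x e1, e1, e2]; ring
  rwa [hy]

theorem qe_even {F K : IntermediateField ℚ ℂ} {γ : ℂ} (h : QE F K γ) (hF : TR F) (hK : TR K)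
    (hD : ∀ P : Ideal (𝓞 K), ¬ RamE F K γ P) : ¬ Odd (Nat.card (ClassGroup (𝓞 F))) := by
  letI := h.alg
  have := hF.nf
  have := hK.nf
  have := hF.tr
  have := hK.tr
  obtain ⟨σ, h1, h2, h3⟩ := h.exists_conj
  exact nf_even F K h.rank σ h1 (fun P hP => hD P (ramE_of_ram h σ h3 P hP))

theorem qe_odd1 {F K : IntermediateField ℚ ℂ} {γ : ℂ} (h : QE F K γ) (hF : TR F) (hK : TR K)
    (ho : Odd (Nat.card (ClassGroup (𝓞 F)))) 
    (hD : ∀ P Q : Ideal (𝓞 K), RamE F K γ P → RamE F K γ Q → P = Q) : 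
    Odd (Nat.card (ClassGroup (𝓞 K))) := by
  letI := h.alg
  have := hF.nf
  have := hK.nf
  have := hF.tr
  have := hK.tr
  obtain ⟨σ, h1, h2, h3⟩ := h.exists_conj
  exact nf_odd1 F K h.rank σ h1 ho (fun P Q hP hQ => 
    hD P Q (ramE_of_ram h σ h3 P hP) (ramE_of_ram h σ h3 Q hQ))

theorem qe_odd2 {F K : IntermediateField ℚ ℂ} {γ : ℂ} (h : QE F K γ) (hF : TR F) (hK : TR K)
    (ho : Odd (Nat.card (ClassGroup (𝓞 F)))) 
    (hD : ∀ P Q R : Ideal (𝓞 K), RamE F K γ P → RamE F K γ Q → RamE F K γ R → 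
      P = Q ∨ P = R ∨ Q = R) 
    (e e' : ℂ) (he : e ∈ F) (he' : e' ∈ F) (hei : IsIntegral ℤ e) (hei' : IsIntegral ℤ e') 
    (hee : e * e' = 1) (hnn : ∀ u ∈ F, ∀ v ∈ F, u ^ 2 - γ ^ 2 * v ^ 2 ≠ e) : 
    Odd (Nat.card (ClassGroup (𝓞 K))) := by
  letI := h.alg
  have := hF.nf
  have := hK.nf
  have := hF.tr
  have := hK.tr
  obtain ⟨σ, h1, h2, h3⟩ := h.exists_conj
  refine nf_odd2 F K h.rank σ h1 ho (fun P Q R hP hQ hR => 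
    hD P Q R (ramE_of_ram h σ h3 P hP) (ramE_of_ram h σ h3 Q hQ) (ramE_of_ram h σ h3 R hR)) ?_
  have i1 : IsIntegral ℤ (⟨e, he⟩ : F) := 
    (isIntegral_algebraMap_iff (R := ℤ) (A := F) (B := ℂ) Subtype.val_injective).1 hei
  have i2 : IsIntegral ℤ (⟨e', he'⟩ : F) := 
    (isIntegral_algebraMap_iff (R := ℤ) (A := F) (B := ℂ) Subtype.val_injective).1 hei'
  have hm : (⟨⟨e, he⟩, i1⟩ : 𝓞 F) * ⟨⟨e', he'⟩, i2⟩ = 1 := by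
    apply RingOfIntegers.ext
    apply Subtype.ext
    exact hee
  refine ⟨⟨⟨⟨e, he⟩, i1⟩, ⟨⟨e', he'⟩, i2⟩, hm, (mul_comm _ _).trans hm⟩, ?_⟩
  intro x hx
  obtain ⟨u, hu, v, hv, ex⟩ := h.span x x.2
  have e1 := congrArg (Subtype.val : K → ℂ) hx
  have e1 : (x : ℂ) * (σ x : ℂ) = e := e1
  rw [h3 u v hu hv x ex, ex] at e1
  exact hnn u hu v hv (by rw [← e1]; ring)

/-- Totally positive (nonneg) at all embeddings. -/
def TP (F : IntermediateField ℚ ℂ) (a : ℂ) : Prop :=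
  ∀ φ : F →+* ℂ, ∀ x : F, (x : ℂ) = a → ∃ r : ℝ, 0 ≤ r ∧ φ x = r

lemma QE.tr {F K : IntermediateField ℚ ℂ} {γ : ℂ} (h : QE F K γ) (hF : TR F) (hp : TP F (γ ^ 2)) :
    TR K := by
  have := hF.fin
  refine ⟨h.finiteDim, ?_⟩
  intro φ x
  let ψ : F →+* ℂ := φ.comp (inclusion h.le).toRingHom
  obtain ⟨r, hr0, hr⟩ := hp ψ ⟨γ ^ 2, h.sq⟩ rfl
  have hg : ∃ t : ℝ, φ ⟨γ, h.mem⟩ = t := by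
    have e : φ ⟨γ, h.mem⟩ ^ 2 = ((Real.sqrt r : ℝ) : ℂ) ^ 2 := by
      rw [← Complex.ofReal_pow, Real.sq_sqrt hr0, ← hr, ← map_pow]
      rfl
    rcases sq_eq_sq_iff_eq_or_eq_neg.1 e with h1 | h1
    · exact ⟨_, h1⟩
    · exact ⟨- Real.sqrt r, by rw [h1]; simp⟩
  obtain ⟨t, ht⟩ := hg
  obtain ⟨u, hu, v, hv, e⟩ := h.span x x.2
  obtain ⟨a, ha⟩ := hF.real ψ ⟨u, hu⟩
  obtain ⟨b, hb⟩ := hF.real ψ ⟨v, hv⟩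
  refine ⟨a + b * t, ?_⟩
  have hx : x = (inclusion h.le ⟨u, hu⟩) + (inclusion h.le ⟨v, hv⟩) * ⟨γ, h.mem⟩ := Subtype.ext e
  rw [hx, map_add, map_mul, ht]
  have ha : φ (inclusion h.le ⟨u, hu⟩) = a := ha
  have hb : φ (inclusion h.le ⟨v, hv⟩) = b := hb
  rw [ha, hb]
  push_cast
  rfl

/-- the field `F(γ)` for `γ² ∈ F` -/
def qext (F : IntermediateField ℚ ℂ) (γ : ℂ) (h : γ ^ 2 ∈ F) : IntermediateField ℚ ℂ where
  carrier := {x | ∃ u ∈ F, ∃ v ∈ F, x = u + v * γ}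
  mul_mem' := by
    rintro _ _ ⟨u, hu, v, hv, rfl⟩ ⟨u', hu', v', hv', rfl⟩
    exact ⟨u * u' + v * v' * γ ^ 2, F.add_mem (F.mul_mem hu hu') (F.mul_mem (F.mul_mem hv hv') h),
      u * v' + v * u', F.add_mem (F.mul_mem hu hv') (F.mul_mem hv hu'), by ring⟩
  add_mem' := by
    rintro _ _ ⟨u, hu, v, hv, rfl⟩ ⟨u', hu', v', hv', rfl⟩
    exact ⟨u + u', F.add_mem hu hu', v + v', F.add_mem hv hv', by ring⟩
  algebraMap_mem' := by
    intro q
    exact ⟨algebraMap ℚ ℂ q, F.algebraMap_mem q, 0, F.zero_mem, by simp⟩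
  inv_mem' := by
    rintro _ ⟨u, hu, v, hv, rfl⟩
    by_cases h0 : u ^ 2 - v ^ 2 * γ ^ 2 = 0
    · by_cases h1 : u + v * γ = 0
      · exact ⟨0, F.zero_mem, 0, F.zero_mem, by rw [h1]; simp⟩
      · have h2 : u - v * γ = 0 := by
          have : (u + v * γ) * (u - v * γ) = 0 := by rw [← h0]; ring
          exact (mul_eq_zero.1 this).resolve_left h1
        refine ⟨(u + u)⁻¹, F.inv_mem (F.add_mem hu hu), 0, F.zero_mem, ?_⟩
        rw [← sub_eq_zero.1 h2]; ring
    · have hm : u ^ 2 - v ^ 2 * γ ^ 2 ∈ F := 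
        F.sub_mem (F.pow_mem hu 2) (F.mul_mem (F.pow_mem hv 2) h)
      refine ⟨u / (u ^ 2 - v ^ 2 * γ ^ 2), F.div_mem hu hm, 
        -v / (u ^ 2 - v ^ 2 * γ ^ 2), F.div_mem (F.neg_mem hv) hm, ?_⟩
      have h1 : u + v * γ ≠ 0 := by
        intro h1
        apply h0
        have : (u + v * γ) * (u - v * γ) = u ^ 2 - v ^ 2 * γ ^ 2 := by ring
        rw [← this, h1, zero_mul]
      rw [inv_eq_iff_eq_inv, ← one_div, eq_div_iff]
      · field_simp
        ring
      · intro h2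
        have h3 : (u + v * γ) * (u / (u ^ 2 - v ^ 2 * γ ^ 2) + -v / (u ^ 2 - v ^ 2 * γ ^ 2) * γ) = 1 := by
          field_simp
          ring
        rw [h2, mul_zero] at h3
        exact zero_ne_one h3

lemma mem_qext {F : IntermediateField ℚ ℂ} {γ : ℂ} (h : γ ^ 2 ∈ F) (x : ℂ) :
    x ∈ qext F γ h ↔ ∃ u ∈ F, ∃ v ∈ F, x = u + v * γ := Iff.rfl

lemma qext_qe {F : IntermediateField ℚ ℂ} {γ : ℂ} (h : γ ^ 2 ∈ F) (hn : γ ∉ F) :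
    QE F (qext F γ h) γ := by
  refine ⟨?_, ?_, h, hn, fun x hx => hx⟩
  · intro x hx
    exact ⟨x, hx, 0, F.zero_mem, by ring⟩
  · exact ⟨0, F.zero_mem, 1, F.one_mem, by ring⟩

/-- build an algebraic integer -/
noncomputable def mkO (K : IntermediateField ℚ ℂ) (z : ℂ) (hz : z ∈ K) (hi : IsIntegral ℤ z) : 𝓞 K :=
  ⟨⟨z, hz⟩, (isIntegral_algebraMap_iff (R := ℤ) (A := K) (B := ℂ) Subtype.val_injective).1 hi⟩

lemma mkO_coe (K : IntermediateField ℚ ℂ) (z : ℂ) (hz : z ∈ K) (hi : IsIntegral ℤ z) : 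
    ((mkO K z hz hi : K) : ℂ) = z := rfl

lemma O_ext {K : IntermediateField ℚ ℂ} {x y : 𝓞 K} (h : ((x : K) : ℂ) = ((y : K) : ℂ)) : x = y :=
  RingOfIntegers.ext (Subtype.ext h)

end Part6

section Part7
open NumberField IntermediateField

/-- The real field `LplusField m d` for natural `d`. -/
noncomputable abbrev LL (m d : ℕ) : IntermediateField ℚ ℂ := LplusField m (d : ℤ)

/-- `2 cos (2π/2^(m+2))` -/
noncomputable def cc (m : ℕ) : ℂ := ((2 * Real.cos (2 * Real.pi / 2 ^ (m + 2)) : ℝ) : ℂ)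

/-- real square root as a complex number -/
noncomputable def rd (d : ℕ) : ℂ := ((Real.sqrt d : ℝ) : ℂ)

lemma rd_sq (d : ℕ) : rd d ^ 2 = (d : ℂ) := by
  unfold rd
  rw [← Complex.ofReal_pow, Real.sq_sqrt (Nat.cast_nonneg d)]; simp

lemma cc_zero : cc 0 = 0 := by
  unfold cc
  have : (2 * Real.pi / 2 ^ (0 + 2)) = Real.pi / 2 := by ring
  rw [this, Real.cos_pi_div_two]; simp

lemma cc_sq (m : ℕ) : cc (m + 1) ^ 2 = 2 + cc m := by
  unfold cc
  have : (2 * Real.pi / 2 ^ (m + 2)) = 2 * (2 * Real.pi / 2 ^ (m + 1 + 2)) := by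
    rw [show m + 1 + 2 = m + 2 + 1 by ring, pow_succ (2:ℝ) (m + 2)]; field_simp
  rw [this, Real.cos_two_mul, show m + 1 + 2 = m + 2 + 1 by ring]
  push_cast
  ring

lemma cc_mem (m d : ℕ) : cc m ∈ LL m d := subset_adjoin _ _ (Or.inl rfl)

lemma rd_mem (m d : ℕ) : rd d ∈ LL m d := by
  apply subset_adjoin
  right
  have := rd_sq d
  simpa using this

lemma LL_le {m d : ℕ} {K : IntermediateField ℚ ℂ} (h1 : cc m ∈ K) (h2 : rd d ∈ K) : LL m d ≤ K := by
  apply adjoin_le_iff.2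
  rintro z (hz | hz)
  · have hz : z = cc m := hz
    rw [hz]; exact h1
  · have hz : z ^ 2 = ((d : ℤ) : ℂ) := hz
    have : z ^ 2 = rd d ^ 2 := by rw [hz, rd_sq]; simp
    rcases sq_eq_sq_iff_eq_or_eq_neg.1 this with h | h
    · rw [h]; exact h2
    · rw [h]; exact K.neg_mem h2

lemma LL_succ (m d : ℕ) : LL m d ≤ LL (m + 1) d := by
  apply LL_le _ (rd_mem _ _)
  have : cc m = cc (m + 1) ^ 2 - 2 := by rw [cc_sq]; ring
  rw [this]
  exact sub_mem (pow_mem (cc_mem _ _) 2) (ofNat_mem _ 2)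

lemma LL_mono {m k : ℕ} (h : m ≤ k) (d : ℕ) : LL m d ≤ LL k d := by
  induction k, h using Nat.le_induction with
  | base => exact le_rfl
  | succ k _ ih => exact ih.trans (LL_succ k d)

lemma rd_one : rd 1 = 1 := by simp [rd]

lemma LL_one_le (m d : ℕ) : LL m 1 ≤ LL m d := 
  LL_le (cc_mem _ _) (by rw [rd_one]; exact one_mem _)

lemma LL_zero_one : LL 0 1 = ⊥ := by
  apply le_antisymm _ bot_le
  apply LL_le
  · rw [cc_zero]; exact zero_mem _
  · rw [rd_one]; exact one_mem _

/-- nonsquare in a field -/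
def NS (F : IntermediateField ℚ ℂ) (a : ℂ) : Prop := ∀ x ∈ F, x ^ 2 ≠ a

lemma qe_of {F K : IntermediateField ℚ ℂ} {γ : ℂ} (h1 : F ≤ K) (h2 : γ ∈ K) (h3 : γ ^ 2 ∈ F) 
    (h4 : NS F (γ ^ 2)) (h5 : K ≤ qext F γ h3) : QE F K γ := 
  ⟨h1, h2, h3, fun h => h4 γ h rfl, fun x hx => (mem_qext h3 x).1 (h5 hx)⟩

lemma qe_step {m d : ℕ} (h : NS (LL m d) (2 + cc m)) : QE (LL m d) (LL (m + 1) d) (cc (m + 1)) := by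
  rw [← cc_sq] at h
  have h3 : cc (m + 1) ^ 2 ∈ LL m d := by 
    rw [cc_sq]; exact add_mem (ofNat_mem _ 2) (cc_mem _ _)
  refine qe_of (LL_succ m d) (cc_mem _ _) h3 h ?_
  apply LL_le
  · exact ⟨0, zero_mem _, 1, one_mem _, by ring⟩
  · exact ⟨rd d, rd_mem _ _, 0, zero_mem _, by ring⟩

lemma qe_rd {m d : ℕ} (h : NS (LL m 1) d) : QE (LL m 1) (LL m d) (rd d) := by
  have h3 : rd d ^ 2 ∈ LL m 1 := by 
    rw [rd_sq]; exact _root_.natCast_mem _ _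
  refine qe_of (LL_one_le m d) (rd_mem _ _) h3 (by rwa [rd_sq]) ?_
  apply LL_le
  · exact ⟨cc m, cc_mem _ _, 0, zero_mem _, by ring⟩
  · exact ⟨0, zero_mem _, 1, one_mem _, by ring⟩

lemma QE.nrm {F K : IntermediateField ℚ ℂ} {γ : ℂ} (h : QE F K γ) : 
    ∃ N : ℂ → ℂ, (∀ x ∈ K, N x ∈ F) ∧ (∀ x ∈ K, ∀ y ∈ K, N (x * y) = N x * N y) ∧
      (∀ u ∈ F, ∀ v ∈ F, N (u + v * γ) = u ^ 2 - v ^ 2 * γ ^ 2) := by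
  obtain ⟨σ, h1, h2, h3, h4, h5, h6, h7⟩ := h.conj_fun
  refine ⟨fun x => x * σ x, h6, ?_, ?_⟩
  · intro x hx y hy
    simp only [h3 x hx y hy]; ring
  · intro u hu v hv
    simp only
    rw [h2 u (h.le hu) _ (K.mul_mem (h.le hv) h.mem), h3 v (h.le hv) _ h.mem, h4 u hu, h4 v hv, h5]
    ring

/-- squares descend -/
lemma QE.desc {F K : IntermediateField ℚ ℂ} {γ : ℂ} (h : QE F K γ) {a : ℂ} (ha : a ∈ F) 
    (h1 : NS F a) (h2 : ∀ v ∈ F, v ^ 2 * γ ^ 2 ≠ a) : NS K a := by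
  intro x hx e
  obtain ⟨u, hu, v, hv, rfl⟩ := h.span x hx
  have m1 : u ^ 2 + v ^ 2 * γ ^ 2 ∈ F := F.add_mem (F.pow_mem hu 2) (F.mul_mem (F.pow_mem hv 2) h.sq)
  have m2 : u * v + u * v ∈ F := F.add_mem (F.mul_mem hu hv) (F.mul_mem hu hv)
  have h3 := h.uniq m1 m2 ha F.zero_mem (by linear_combination e)
  have h4 : u * v = 0 := by linear_combination h3.2 / 2
  rcases mul_eq_zero.1 h4 with h5 | h5
  · exact h2 v hv (by have := h3.1; rw [h5] at this; linear_combination this)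
  · exact h1 u hu (by have := h3.1; rw [h5] at this; linear_combination this)


lemma ns_step {d : ℕ} (h2 : NS (LL 0 d) 2) (m : ℕ) : NS (LL m d) (2 + cc m) ∧ NS (LL m d) (2 - cc m) := by
  induction m with
  | zero => rw [cc_zero]; simpa using h2
  | succ m ih =>
    have q := qe_step ih.1
    obtain ⟨N, n1, n2, n3⟩ := q.nrm
    have h2m : (2 : ℂ) ∈ LL m d := ofNat_mem _ 2
    constructor
    · intro x hx e
      apply ih.2 (N x) (n1 x hx)
      have := n3 2 h2m 1 (one_mem _)
      rw [one_mul, ← e, pow_two x, n2 x hx x hx, cc_sq] at this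
      linear_combination this
    · intro x hx e
      apply ih.2 (N x) (n1 x hx)
      have := n3 2 h2m (-1) (neg_mem (one_mem _))
      rw [show 2 + -1 * cc (m + 1) = 2 - cc (m + 1) by ring, ← e, pow_two x, n2 x hx x hx, cc_sq] at this
      linear_combination this

lemma qe_tower {d : ℕ} (h2 : NS (LL 0 d) 2) (m : ℕ) : QE (LL m d) (LL (m + 1) d) (cc (m + 1)) := qe_step (ns_step h2 m).1

/-- auxiliary: `a` can't be `(2+c_m) v²`. -/
lemma ns_aux {d : ℕ} (h2 : NS (LL 0 d) 2) (m : ℕ) {a b : ℂ} (hb : b ∈ LL m d) (ha : a ∈ LL (m + 1) d) (h0 : b ≠ 0) (N : ℂ → ℂ) 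
    (n1 : ∀ x ∈ LL (m + 1) d, N x ∈ LL m d) 
    (n2 : ∀ x ∈ LL (m + 1) d, ∀ y ∈ LL (m + 1) d, N (x * y) = N x * N y)
    (n3 : ∀ u ∈ LL m d, ∀ v ∈ LL m d, N (u + v * cc (m + 1)) = u ^ 2 - v ^ 2 * cc (m + 1) ^ 2) 
    (hN : N a = b ^ 2) :
    ∀ v ∈ LL (m + 1) d, v ^ 2 * (2 + cc (m + 1)) ≠ a := by
  intro v hv e
  have h2m : (2 : ℂ) ∈ LL m d := ofNat_mem _ 2
  have h1 := n3 2 h2m 1 (one_mem _)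
  rw [one_mul, cc_sq] at h1
  have hm : 2 + cc (m + 1) ∈ LL (m + 1) d := add_mem (ofNat_mem _ 2) (cc_mem _ _)
  have h3 : N a = N v ^ 2 * (2 - cc m) := by
    rw [← e, n2 _ (pow_mem hv 2) _ hm, pow_two v, n2 v hv v hv, h1]; ring
  rw [hN] at h3
  have h4 : N v ≠ 0 := by
    intro h; rw [h] at h3; apply h0; simpa using h3
  apply (ns_step h2 m).2 (b / N v) (div_mem hb (n1 v hv))
  rw [div_pow, h3]; field_simp

lemma ns_lift {d : ℕ} (h2 : NS (LL 0 d) 2) {k : ℕ} {a : ℂ} (ha : a ∈ LL k d) (h0 : a ≠ 0) (h1 : NS (LL k d) a) 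
    (h3 : ∀ v ∈ LL k d, v ^ 2 * (2 + cc k) ≠ a) (m : ℕ) (hm : k ≤ m) : NS (LL m d) a := by
  suffices NS (LL m d) a ∧ ∀ v ∈ LL m d, v ^ 2 * (2 + cc m) ≠ a from this.1
  induction m, hm using Nat.le_induction with
  | base => exact ⟨h1, h3⟩
  | succ m hm ih =>
    have q := qe_tower h2 m
    have ham := LL_mono hm d ha
    refine ⟨q.desc ham ih.1 (by rw [cc_sq]; exact ih.2), ?_⟩
    obtain ⟨N, n1, n2, n3⟩ := q.nrm
    refine ns_aux h2 m (b := a) ham (q.le ham) h0 N n1 n2 n3 ?_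
    have := n3 a ham 0 (zero_mem _)
    simpa using this

lemma ns_lift0 {d : ℕ} (h2 : NS (LL 0 d) 2) {a : ℂ} (ha : a ∈ LL 0 d) (h0 : a ≠ 0) (h1 : NS (LL 0 d) a) 
    (h3 : NS (LL 0 d) (2 * a)) (m : ℕ) : NS (LL m d) a := by
  refine ns_lift h2 ha h0 h1 ?_ m (Nat.zero_le _)
  intro v hv e
  rw [cc_zero] at e
  exact h3 (2 * v) (mul_mem (ofNat_mem _ 2) hv) (by rw [← e]; ring)

lemma ns_bot {a : ℕ} (h : ¬ IsSquare a) : NS ⊥ (a : ℂ) := by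
  rintro x hx e
  obtain ⟨q, rfl⟩ := mem_bot.1 hx
  apply h
  rw [← Rat.isSquare_natCast_iff]
  refine ⟨q, ?_⟩
  have : ((q : ℚ) : ℂ) ^ 2 = ((a : ℚ) : ℂ) := by simpa using e
  have : q ^ 2 = a := by exact_mod_cast this
  rw [← this]; ring

lemma ns_L0 {a d : ℕ} (hd : ¬ IsSquare d) (h : ¬ IsSquare a) (h' : ¬ IsSquare (a * d)) : 
    NS (LL 0 d) (a : ℂ) := by
  have hq : QE (LL 0 1) (LL 0 d) (rd d) := qe_rd (by rw [LL_zero_one]; exact ns_bot hd)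
  refine hq.desc (_root_.natCast_mem _ _) (by rw [LL_zero_one]; exact ns_bot h) ?_
  rw [LL_zero_one]
  intro v hv e
  rw [rd_sq] at e
  apply ns_bot h' (v * d) (mul_mem hv (_root_.natCast_mem _ _))
  push_cast; rw [← e]; ring

lemma nsq_mod4 {a : ℕ} (h : a % 4 = 2) : ¬ IsSquare a := by
  rintro ⟨b, rfl⟩
  have : b % 4 = 0 ∨ b % 4 = 1 ∨ b % 4 = 2 ∨ b % 4 = 3 := by omega
  rcases this with h1 | h1 | h1 | h1 <;> simp [Nat.mul_mod, h1] at h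

lemma nsq_two_mul {a : ℕ} (h : Odd a) : ¬ IsSquare (2 * a) := 
  nsq_mod4 (by obtain ⟨b, rfl⟩ := h; omega)

lemma nsq_sf {a : ℕ} (h : Squarefree a) (h1 : 1 < a) : ¬ IsSquare a := by
  rintro ⟨b, rfl⟩
  have := Nat.isUnit_iff.1 (h b dvd_rfl)
  subst this; omega

lemma ns_two {d : ℕ} (hd : ¬ IsSquare d) (ho : Odd d) : NS (LL 0 d) 2 := by
  have := ns_L0 (a := 2) hd (nsq_mod4 rfl) (nsq_two_mul ho)
  simpa using this

lemma ns_two_one : NS (LL 0 1) 2 := by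
  rw [LL_zero_one]; exact_mod_cast ns_bot (a := 2) (nsq_mod4 rfl)

lemma qe_rd' (m : ℕ) {d : ℕ} (hd : ¬ IsSquare d) (ho : Odd d) : QE (LL m 1) (LL m d) (rd d) := by
  apply qe_rd
  refine ns_lift0 ns_two_one (_root_.natCast_mem _ _) ?_ ?_ ?_ m
  · rintro h
    have : d = 0 := by exact_mod_cast h
    subst this; exact hd ⟨0, rfl⟩
  · rw [LL_zero_one]; exact ns_bot hd
  · rw [LL_zero_one]
    exact_mod_cast ns_bot (nsq_two_mul ho)

lemma ns_nat (m : ℕ) {a d : ℕ} (hd : ¬ IsSquare d) (ho : Odd d) (hoa : Odd a) (h : ¬ IsSquare a) 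
    (h' : ¬ IsSquare (a * d)) : NS (LL m d) (a : ℂ) := by
  refine ns_lift0 (ns_two hd ho) (_root_.natCast_mem _ _) ?_ (ns_L0 hd h h') ?_ m
  · rintro h1
    have : a = 0 := by exact_mod_cast h1
    subst this; exact h ⟨0, rfl⟩
  · have := ns_L0 hd (nsq_two_mul hoa) (by rw [mul_assoc]; exact nsq_two_mul (hoa.mul ho))
    exact_mod_cast this

/-- `A + B√2` with norm `d` is not a square. -/
lemma ns_alpha (m : ℕ) (hm : 1 ≤ m) {d : ℕ} (hd : ¬ IsSquare d) (ho : Odd d) (A B : ℤ) 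
    (hAB : A ^ 2 - 2 * B ^ 2 = d) : NS (LL m d) (A + B * cc 1) := by
  have hd0 : (d : ℂ) ≠ 0 := by
    rintro h
    have : d = 0 := by exact_mod_cast h
    subst this; exact hd ⟨0, rfl⟩
  have hAB' : (A : ℂ) ^ 2 - 2 * (B : ℂ) ^ 2 = d := by exact_mod_cast hAB
  have c1 : cc 1 ^ 2 = 2 := by rw [cc_sq, cc_zero]; ring
  have ha0 : (A + B * cc 1 : ℂ) ≠ 0 := by
    intro h
    apply hd0
    rw [← hAB', ← c1]
    linear_combination (A - B * cc 1) * h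
  have mem : ∀ e, (A + B * cc 1 : ℂ) ∈ LL 1 e := fun e => 
    add_mem (intCast_mem _ _) (mul_mem (intCast_mem _ _) (cc_mem _ _))
  refine ns_lift (ns_two hd ho) (mem d) ha0 ?_ ?_ m hm
  · -- in L_1 = B_1(√d)
    have q := qe_tower ns_two_one 0
    obtain ⟨N, n1, n2, n3⟩ := q.nrm
    have hN := n3 A (intCast_mem _ _) B (intCast_mem _ _)
    have hNd := n3 d (_root_.natCast_mem _ _) 0 (zero_mem _)
    simp only [zero_add, c1] at hN hNd
    rw [show (A : ℂ) ^ 2 - B ^ 2 * 2 = d by rw [← hAB']; ring] at hN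
    rw [show (d : ℂ) + 0 * cc 1 = d by ring] at hNd
    have hnd : NS (LL 0 1) d := by rw [LL_zero_one]; exact ns_bot hd
    refine (qe_rd' 1 hd ho).desc (mem 1) ?_ ?_
    · intro x hx e
      apply hnd (N x) (n1 x hx)
      rw [← hN, ← e, pow_two, pow_two, n2 x hx x hx]
    · intro x hx e
      rw [rd_sq] at e
      have e2 : (d : ℂ) = N x ^ 2 * d ^ 2 := by
        have := hN
        rw [← e, n2 _ (pow_mem hx 2) _ (_root_.natCast_mem _ _), hNd, pow_two x, n2 x hx x hx] at this
        linear_combination -this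
      apply hnd (N x * d) (mul_mem (n1 x hx) (_root_.natCast_mem _ _))
      rw [mul_pow]; exact e2.symm
  · have q := qe_tower (ns_two hd ho) 0
    obtain ⟨N, n1, n2, n3⟩ := q.nrm
    refine ns_aux (ns_two hd ho) 0 (b := rd d) (rd_mem _ _) (mem d) ?_ N n1 n2 n3 ?_
    · intro h; apply hd0; rw [← rd_sq, h]; ring
    · have hN := n3 A (intCast_mem _ _) B (intCast_mem _ _)
      simp only [zero_add, c1] at hN
      rw [hN, rd_sq, ← hAB']; ring

/-! total reality -/

lemma cc_real (m : ℕ) : ∀ (K : IntermediateField ℚ ℂ) (φ : K →+* ℂ) (x : K), (x : ℂ) = cc m → 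
    ∃ r : ℝ, -2 ≤ r ∧ r ≤ 2 ∧ φ x = r := by
  induction m with
  | zero => 
    intro K φ x hx
    rw [cc_zero] at hx
    have : x = 0 := Subtype.ext hx
    exact ⟨0, by norm_num, by norm_num, by rw [this]; simp⟩
  | succ m ih =>
    intro K φ x hx
    have h1 : ((x ^ 2 - 2 : K) : ℂ) = cc m := by
      change (x : ℂ) ^ 2 - 2 = _
      rw [hx, cc_sq]; ring
    obtain ⟨r, hr1, hr2, hr⟩ := ih K φ (x ^ 2 - 2) h1
    have h2 : φ x ^ 2 = ((Real.sqrt (2 + r) : ℝ) : ℂ) ^ 2 := by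
      rw [← Complex.ofReal_pow, Real.sq_sqrt (by linarith)]
      push_cast
      rw [← hr, map_sub, map_pow, show φ 2 = 2 from map_ofNat φ 2]; ring
    have hs : Real.sqrt (2 + r) ≤ 2 := by
      rw [Real.sqrt_le_left (by norm_num)]; linarith
    have hs0 := Real.sqrt_nonneg (2 + r)
    rcases sq_eq_sq_iff_eq_or_eq_neg.1 h2 with h3 | h3
    · exact ⟨_, by linarith, hs, h3⟩
    · exact ⟨- Real.sqrt (2 + r), by linarith, by linarith, by rw [h3]; simp⟩

lemma TP_nat (F : IntermediateField ℚ ℂ) (a : ℕ) : TP F a := by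
  intro φ x hx
  have : x = (a : F) := Subtype.ext (by rw [hx]; simp)
  exact ⟨a, Nat.cast_nonneg _, by rw [this]; simp⟩

lemma TR_bot : TR ⊥ := by
  refine ⟨inferInstance, ?_⟩
  rintro φ ⟨x, hx⟩
  obtain ⟨q, rfl⟩ := mem_bot.1 hx
  refine ⟨q, ?_⟩
  have : (⟨algebraMap ℚ ℂ q, hx⟩ : (⊥ : IntermediateField ℚ ℂ)) = (q : (⊥ : IntermediateField ℚ ℂ)) := 
    Subtype.ext (by simp)
  rw [this]; simp

lemma qe_base {d : ℕ} (hd : ¬ IsSquare d) : QE ⊥ (LL 0 d) (rd d) := by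
  rw [← LL_zero_one]
  exact qe_rd (by rw [LL_zero_one]; exact ns_bot hd)

lemma TR_L {d : ℕ} (hd : ¬ IsSquare d) (ho : Odd d) (m : ℕ) : TR (LL m d) := by
  induction m with
  | zero => exact (qe_base hd).tr TR_bot (by rw [rd_sq]; exact TP_nat _ _)
  | succ m ih => 
    refine (qe_tower (ns_two hd ho) m).tr ih ?_
    intro φ x hx
    rw [cc_sq] at hx
    obtain ⟨r, h1, h2, h3⟩ := cc_real m _ φ (x - 2) (by 
      change (x : ℂ) - 2 = _
      rw [hx]; ring)
    refine ⟨r + 2, by linarith, ?_⟩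
    rw [map_sub] at h3
    push_cast
    rw [← h3, show φ 2 = 2 from map_ofNat φ 2]; ring

lemma TP_alpha {F : IntermediateField ℚ ℂ} (A B : ℤ) (hA : 0 < A) (h : 0 ≤ A ^ 2 - 2 * B ^ 2) 
    (hm : cc 1 ∈ F) : TP F (A + B * cc 1) := by
  intro φ x hx
  obtain ⟨r, h1, h2, h3⟩ := cc_real 1 F φ ⟨cc 1, hm⟩ rfl
  have c1 : cc 1 ^ 2 = 2 := by rw [cc_sq, cc_zero]; ring
  have hr : r ^ 2 = 2 := by
    have : (⟨cc 1, hm⟩ : F) ^ 2 = 2 := Subtype.ext c1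
    have := congrArg φ this
    rw [map_pow, h3] at this
    have : (r : ℂ) ^ 2 = 2 := by rw [this]; exact map_ofNat φ 2
    exact_mod_cast this
  have e : x = (A : F) + (B : F) * ⟨cc 1, hm⟩ := Subtype.ext hx
  refine ⟨A + B * r, ?_, ?_⟩
  · have h' : (0 : ℝ) ≤ (A : ℝ) ^ 2 - 2 * (B : ℝ) ^ 2 := by exact_mod_cast h
    have hA' : (0 : ℝ) < A := by exact_mod_cast hA
    have : (B * r) ^ 2 ≤ (A : ℝ) ^ 2 := by rw [mul_pow, hr]; linarith
    have := abs_le_of_sq_le_sq' this hA'.le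
    linarith [this.1]
  · rw [e, map_add, map_mul, h3]; simp

lemma odd_bot : Odd (Nat.card (ClassGroup (𝓞 (⊥ : IntermediateField ℚ ℂ)))) := by
  let e : 𝓞 (⊥ : IntermediateField ℚ ℂ) ≃+* ℤ := 
    (RingOfIntegers.mapRingEquiv (botEquiv ℚ ℂ).toRingEquiv).trans Rat.ringOfIntegersEquiv
  have hp : IsPrincipalIdealRing (𝓞 (⊥ : IntermediateField ℚ ℂ)) := 
    IsPrincipalIdealRing.of_surjective e.symm.toRingHom e.symm.surjective
  have := TR_bot.nf
  have h := (classNumber_eq_one_iff (K := (⊥ : IntermediateField ℚ ℂ))).2 hp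
  unfold classNumber at h
  rw [Nat.card_eq_fintype_card]
  rw [h]; exact odd_one

end Part7

section Part8
open NumberField IntermediateField

lemma isInt_quad {θ s t : ℂ} (hs : IsIntegral ℤ s) (ht : IsIntegral ℤ t) (h : θ ^ 2 = s * θ + t) : 
    IsIntegral ℤ θ := by
  let S := integralClosure ℤ ℂ
  have : IsIntegral S θ := by
    refine ⟨Polynomial.X ^ 2 - (Polynomial.C (⟨s, hs⟩ : S) * Polynomial.X + Polynomial.C (⟨t, ht⟩ : S)), ?_, ?_⟩
    · monicity!
    · simp only [Polynomial.eval₂_sub, Polynomial.eval₂_add, Polynomial.eval₂_mul, Polynomial.eval₂_pow,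
        Polynomial.eval₂_X, Polynomial.eval₂_C]
      change θ ^ 2 - (s * θ + t) = 0
      rw [h]; ring
  exact isIntegral_trans θ this

lemma isInt_int (a : ℤ) : IsIntegral ℤ (a : ℂ) := isIntegral_algebraMap (R := ℤ) (A := ℂ) (x := a)
lemma isInt_nat (a : ℕ) : IsIntegral ℤ (a : ℂ) := by exact_mod_cast isInt_int a

lemma isInt_cc (m : ℕ) : IsIntegral ℤ (cc m) := by
  induction m with
  | zero => rw [cc_zero]; exact isIntegral_zero
  | succ m ih => 
    refine IsIntegral.of_pow (n := 2) (by norm_num) ?_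
    rw [cc_sq]
    exact IsIntegral.add (isInt_nat 2) ih

lemma isInt_rd (d : ℕ) : IsIntegral ℤ (rd d) :=
  IsIntegral.of_pow (n := 2) (by norm_num) (by rw [rd_sq]; exact isInt_nat d)

/-- complex number lying in the ideal `P` -/
def InP {K : IntermediateField ℚ ℂ} (P : Ideal (𝓞 K)) (z : ℂ) : Prop := 
  ∃ y : 𝓞 K, ((y : K) : ℂ) = z ∧ y ∈ P

namespace InP
variable {K : IntermediateField ℚ ℂ} {P : Ideal (𝓞 K)} {z w : ℂ}

lemma add (h : InP P z) (h' : InP P w) : InP P (z + w) := by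
  obtain ⟨y, rfl, hy⟩ := h
  obtain ⟨y', rfl, hy'⟩ := h'
  exact ⟨y + y', rfl, P.add_mem hy hy'⟩

lemma mul (h : InP P z) (hw : w ∈ K) (hi : IsIntegral ℤ w) : InP P (w * z) := by
  obtain ⟨y, rfl, hy⟩ := h
  exact ⟨mkO K w hw hi * y, rfl, P.mul_mem_left _ hy⟩

lemma int_mul (h : InP P z) (a : ℤ) : InP P (a * z) := h.mul (intCast_mem _ _) (isInt_int a)

lemma sub (h : InP P z) (h' : InP P w) : InP P (z - w) := by
  have := h.add (h'.int_mul (-1))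
  rwa [show z + ((-1 : ℤ) : ℂ) * w = z - w by push_cast; ring] at this

lemma one (hP : P.IsPrime) : ¬ InP P 1 := by
  rintro ⟨y, hy, h⟩
  have : y = 1 := O_ext hy
  rw [this] at h
  exact hP.ne_top ((Ideal.eq_top_iff_one _).2 h)

lemma cop (hP : P.IsPrime) {a b : ℤ} (h : IsCoprime a b) (ha : InP P a) (hb : InP P b) : False := by
  obtain ⟨u, v, e⟩ := h
  apply one hP
  have := (ha.int_mul u).add (hb.int_mul v)
  have e' : (u : ℂ) * a + v * b = 1 := by exact_mod_cast e
  rwa [e'] at this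

lemma or (hP : P.IsPrime) (h : InP P (z * w)) (hz : z ∈ K) (hzi : IsIntegral ℤ z) (hw : w ∈ K) 
    (hwi : IsIntegral ℤ w) : InP P z ∨ InP P w := by
  obtain ⟨y, e, hy⟩ := h
  have : y = mkO K z hz hzi * mkO K w hw hwi := O_ext e
  rw [this] at hy
  rcases hP.mem_or_mem hy with h | h
  · exact Or.inl ⟨_, rfl, h⟩
  · exact Or.inr ⟨_, rfl, h⟩

lemma of_sq (hP : P.IsPrime) (h : InP P (z ^ 2)) (hz : z ∈ K) (hzi : IsIntegral ℤ z) : InP P z := by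
  rw [pow_two] at h
  rcases h.or hP hz hzi hz hzi with h | h <;> exact h

lemma sq (h : InP P z) : InP P (z ^ 2) := by
  obtain ⟨y, rfl, hy⟩ := h
  exact ⟨y ^ 2, rfl, P.pow_mem_of_mem hy 2 (by norm_num)⟩

lemma mkO_mem (hz : z ∈ K) (hi : IsIntegral ℤ z) : mkO K z hz hi ∈ P ↔ InP P z := by
  constructor
  · intro h; exact ⟨_, rfl, h⟩
  · rintro ⟨y, e, hy⟩
    have : y = mkO K z hz hi := O_ext e
    rwa [← this]

end InP

lemma RamE.inP {F K : IntermediateField ℚ ℂ} {γ : ℂ} {P : Ideal (𝓞 K)} (hq : QE F K γ) (h : RamE F K γ P) 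
    {x u v : ℂ} (hx : IsIntegral ℤ x) (hy : IsIntegral ℤ (2 * (v * γ))) (hu : u ∈ F) (hv : v ∈ F) 
    (e : x = u + v * γ) : InP P (2 * (v * γ)) := by
  have hvK : v * γ ∈ K := K.mul_mem (hq.le hv) hq.mem
  have hxK : x ∈ K := by rw [e]; exact K.add_mem (hq.le hu) hvK
  have hyK : 2 * (v * γ) ∈ K := by rw [two_mul]; exact K.add_mem hvK hvK
  exact ⟨mkO K _ hyK hy, rfl, h.2.2 (mkO K x hxK hx) _ ⟨u, hu, v, hv, e, rfl⟩⟩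

lemma rd_mul (a b : ℕ) : rd (a * b) = rd a * rd b := by
  unfold rd
  rw [← Complex.ofReal_mul, ← Real.sqrt_mul (Nat.cast_nonneg a)]; simp

lemma rd_ne {a : ℕ} (h : 0 < a) : rd a ≠ 0 := by
  intro h0
  have := rd_sq a
  rw [h0] at this
  have : (a : ℂ) = 0 := by rw [← this]; ring
  have : a = 0 := by exact_mod_cast this
  omega

theorem even_i (n : ℕ) {d a b : ℕ} (hsf : Squarefree d) (ho : Odd d) (hd : d = a * b) (ha4 : a % 4 = 1)
    (ha : 1 < a) (hb : 1 < b) : ¬ Odd (Nat.card (ClassGroup (𝓞 (LL n d)))) := by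
  have hd1 : 1 < d := by rw [hd]; nlinarith
  have hdn : ¬ IsSquare d := nsq_sf hsf hd1
  have hasf : Squarefree a := hsf.squarefree_of_dvd ⟨b, hd⟩
  have hbsf : Squarefree b := hsf.squarefree_of_dvd ⟨a, by rw [hd, mul_comm]⟩
  have hao : Odd a := Nat.odd_iff.2 (by omega)
  have hcop : Nat.Coprime a b := Nat.coprime_of_squarefree_mul (hd ▸ hsf)
  have hns : NS (LL n d) (rd a ^ 2) := by
    rw [rd_sq]
    refine ns_nat n hdn ho hao (nsq_sf hasf ha) ?_
    rintro ⟨c, hc⟩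
    rw [hd, ← mul_assoc] at hc
    have : a ∣ c := by
      rw [← Nat.pow_dvd_pow_iff (n := 2) (by norm_num)]
      exact ⟨b, by rw [pow_two, pow_two, hc]⟩
    obtain ⟨e, rfl⟩ := this
    apply nsq_sf hbsf hb
    refine ⟨e, ?_⟩
    have : (a * a) * b = (a * a) * (e * e) := by rw [hc]; ring
    exact Nat.eq_of_mul_eq_mul_left (by positivity) this
  have hsq : rd a ^ 2 ∈ LL n d := by rw [rd_sq]; exact _root_.natCast_mem _ _
  have hq := qext_qe hsq (fun h => hns _ h rfl)
  have hF := TR_L hdn ho n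
  have hK := hq.tr hF (by rw [rd_sq]; exact TP_nat _ _)
  refine qe_even hq hF hK ?_
  intro P hP
  have hp := hP.1
  have half : (1 / 2 : ℂ) ∈ LL n d := div_mem (one_mem _) (ofNat_mem _ 2)
  have hraK : rd a ∈ qext (LL n d) (rd a) hsq := hq.mem
  have ha0 : (a : ℂ) ≠ 0 := by exact_mod_cast (by omega : a ≠ 0)
  have i1 : InP P (2 * (1 / 2 * rd a)) := by
    refine hP.inP hq (x := 1 / 2 + 1 / 2 * rd a) ?_ ?_ half half rfl
    · obtain ⟨k, hk⟩ : ∃ k, a = 4 * k + 1 := ⟨a / 4, by omega⟩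
      refine isInt_quad (isInt_nat 1) (isInt_nat k) ?_
      have h1 := rd_sq a
      have h2 : (a : ℂ) = 4 * k + 1 := by exact_mod_cast hk
      rw [h2] at h1
      push_cast
      linear_combination h1 / 4
    · rw [show 2 * (1 / 2 * rd a) = rd a by ring]; exact isInt_rd a
  rw [show 2 * (1 / 2 * rd a) = rd a by ring] at i1
  have i1 := i1.sq
  rw [rd_sq] at i1
  have e2 : rd d / a * rd a = rd b := by
    rw [hd, rd_mul]
    field_simp
    linear_combination (rd b) * rd_sq a
  have i2 : InP P (2 * (rd d / a * rd a)) := by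
    refine hP.inP hq (x := 0 + rd d / a * rd a) ?_ ?_ (zero_mem _) 
      (div_mem (rd_mem _ _) (_root_.natCast_mem _ _)) rfl
    · rw [e2, zero_add]; exact isInt_rd b
    · rw [e2]; exact (isInt_nat 2).mul (isInt_rd b)
  rw [e2] at i2
  have i2 := i2.sq
  rw [mul_pow, rd_sq] at i2
  refine InP.cop hp (a := a) (b := 2 ^ 2 * b) ?_ (by exact_mod_cast i1) (by convert i2 using 1; push_cast; ring)
  have : Nat.Coprime a (2 ^ 2 * b) := by
    apply Nat.Coprime.mul_right _ hcop
    exact Nat.Coprime.pow_right _ (Nat.coprime_two_right.2 hao)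
  exact_mod_cast Nat.isCoprime_iff_coprime.2 this

theorem even_ii (n : ℕ) (hn : 1 ≤ n) {d : ℕ} (hsf : Squarefree d) (ho : Odd d) (hd1 : 1 < d) (A B : ℤ) 
    (hA : 0 < A) (hAB : A ^ 2 - 2 * B ^ 2 = d) 
    (h4 : (A % 4 = 1 ∧ B % 4 = 0) ∨ (A % 4 = 3 ∧ B % 4 = 2)) : 
    ¬ Odd (Nat.card (ClassGroup (𝓞 (LL n d)))) := by
  have hdn : ¬ IsSquare d := nsq_sf hsf hd1
  obtain ⟨g, hg⟩ := IsAlgClosed.exists_pow_nat_eq (A + B * cc 1 : ℂ) (n := 2) (by norm_num)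
  have hc1 : ∀ e, cc 1 ∈ LL n e := fun e => LL_mono hn _ (cc_mem 1 e)
  have c1 : cc 1 ^ 2 = 2 := by rw [cc_sq, cc_zero]; ring
  have hmem : (A + B * cc 1 : ℂ) ∈ LL n d := 
    add_mem (intCast_mem _ _) (mul_mem (intCast_mem _ _) (hc1 d))
  have hns : NS (LL n d) (g ^ 2) := by
    rw [hg]; exact ns_alpha n hn hdn ho A B hAB
  have hsq : g ^ 2 ∈ LL n d := by rw [hg]; exact hmem
  have hq := qext_qe hsq (fun h => hns _ h rfl)
  have hF := TR_L hdn ho n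
  have hK := hq.tr hF (by rw [hg]; exact TP_alpha A B hA (by rw [hAB]; positivity) (hc1 d))
  refine qe_even hq hF hK ?_
  intro P hP
  have hp := hP.1
  have hgi : IsIntegral ℤ g := IsIntegral.of_pow (n := 2) (by norm_num) (by
    rw [hg]; exact (isInt_int A).add ((isInt_int B).mul (isInt_cc 1)))
  have i1 : InP P g := by
    obtain ⟨s, hs, hsi, t, ht, e⟩ : ∃ s ∈ LL n d, IsIntegral ℤ s ∧ ∃ t : ℂ, IsIntegral ℤ t ∧ 
        s ^ 2 - (A + B * cc 1) = - 4 * t := by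
      rcases h4 with ⟨h1, h2⟩ | ⟨h1, h2⟩
      · obtain ⟨k, hk⟩ : ∃ k, A = 4 * k + 1 := ⟨A / 4, by omega⟩
        obtain ⟨l, hl⟩ : ∃ l, B = 4 * l := ⟨B / 4, by omega⟩
        refine ⟨1, one_mem _, isIntegral_one, k + l * cc 1, 
          (isInt_int k).add ((isInt_int l).mul (isInt_cc 1)), ?_⟩
        rw [hk, hl]; push_cast; ring
      · obtain ⟨k, hk⟩ : ∃ k, A = 4 * k + 3 := ⟨A / 4, by omega⟩
        obtain ⟨l, hl⟩ : ∃ l, B = 4 * l + 2 := ⟨B / 4, by omega⟩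
        refine ⟨1 + cc 1, add_mem (one_mem _) (hc1 _), isIntegral_one.add (isInt_cc 1), k + l * cc 1, 
          (isInt_int k).add ((isInt_int l).mul (isInt_cc 1)), ?_⟩
        rw [hk, hl]; push_cast; linear_combination c1
    have half : (1 / 2 : ℂ) ∈ LL n d := div_mem (one_mem _) (ofNat_mem _ 2)
    have i1 : InP P (2 * (1 / 2 * g)) := by
      refine hP.inP hq (x := 1 / 2 * s + 1 / 2 * g) ?_ ?_ (mul_mem half hs) half rfl
      · refine isInt_quad hsi ht ?_
        linear_combination hg / 4 - e / 4
      · rw [show 2 * (1 / 2 * g) = g by ring]; exact hgi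
    rwa [show 2 * (1 / 2 * g) = g by ring] at i1
  have hAB' : (A : ℂ) ^ 2 - 2 * (B : ℂ) ^ 2 = d := by exact_mod_cast hAB
  have hd0 : (d : ℂ) ≠ 0 := by exact_mod_cast (by omega : d ≠ 0)
  have hprod : (A + B * cc 1 : ℂ) * (A - B * cc 1) = d := by
    rw [← hAB', ← c1]; ring
  have ha0 : (A + B * cc 1 : ℂ) ≠ 0 := by
    intro h; rw [h, zero_mul] at hprod; exact hd0 hprod.symm
  have e2 : (rd d / (A + B * cc 1) * g) ^ 2 = A - B * cc 1 := by
    rw [mul_pow, div_pow, rd_sq, hg, ← hprod]; field_simp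
  have e2i : IsIntegral ℤ (rd d / (A + B * cc 1) * g) := 
    IsIntegral.of_pow (n := 2) (by norm_num) (by
      rw [e2]; exact (isInt_int A).sub ((isInt_int B).mul (isInt_cc 1)))
  have i2 : InP P (2 * (rd d / (A + B * cc 1) * g)) := by
    refine hP.inP hq (x := 0 + rd d / (A + B * cc 1) * g) ?_ ?_ (zero_mem _) 
      (div_mem (rd_mem _ _) hmem) rfl
    · rw [zero_add]; exact e2i
    · exact (isInt_nat 2).mul e2i
  have i2 := i2.sq
  rw [mul_pow, e2] at i2
  have i1 := i1.sq
  rw [hg] at i1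
  have i3 := (i1.int_mul 4).add i2
  rw [show ((4 : ℤ) : ℂ) * (A + B * cc 1) + 2 ^ 2 * (A - B * cc 1) = ((8 * A : ℤ) : ℂ) by push_cast; ring] at i3
  have i4 := i1.mul (w := A - B * cc 1) 
    (sub_mem (intCast_mem _ _) (mul_mem (intCast_mem _ _) (hq.le (hc1 _))))
    ((isInt_int A).sub ((isInt_int B).mul (isInt_cc 1)))
  rw [mul_comm, hprod] at i4
  refine InP.cop hp (a := 8 * A) (b := d) ?_ i3 (by exact_mod_cast i4)
  have hodd : IsCoprime (2 : ℤ) d := by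
    exact_mod_cast Nat.isCoprime_iff_coprime.2 (Nat.coprime_two_left.2 ho)
  apply IsCoprime.mul_left
  · have := hodd.pow_left (m := 3); norm_num at this; exact this
  · rw [Int.isCoprime_iff_gcd_eq_one]
    by_contra hne
    obtain ⟨p, hp, hpd⟩ := Nat.exists_prime_and_dvd hne
    have h1 : (p : ℤ) ∣ A := (Int.natCast_dvd_natCast.2 hpd).trans (Int.gcd_dvd_left ..)
    have h2 : (p : ℤ) ∣ d := (Int.natCast_dvd_natCast.2 hpd).trans (Int.gcd_dvd_right ..)
    have hp' : Prime (p : ℤ) := Nat.prime_iff_prime_int.1 hp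
    have h3 : (p : ℤ) ∣ 2 * B ^ 2 := by
      have : 2 * B ^ 2 = A ^ 2 - d := by rw [← hAB]; ring
      rw [this]; exact dvd_sub (dvd_pow h1 (by norm_num)) h2
    have h4 : (p : ℤ) ∣ B := by
      rcases hp'.dvd_or_dvd h3 with h | h
      · exfalso
        exact hp'.not_isUnit (hodd.isUnit_of_dvd' h h2)
      · exact hp'.dvd_of_dvd_pow h
    have h5 : (p : ℤ) * p ∣ d := by
      rw [← hAB, ← pow_two]
      exact dvd_sub (pow_dvd_pow_of_dvd h1 2) ((pow_dvd_pow_of_dvd h4 2).mul_left _)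
    have h6 : p * p ∣ d := by exact_mod_cast h5
    exact hp.one_lt.ne' (Nat.isUnit_iff.1 (hsf p h6))

end Part8

section Part9
open NumberField IntermediateField
open scoped NumberTheorySymbols

lemma thue2 {p : ℕ} (hp : p.Prime) (s : ZMod p) (hs : s ^ 2 = 2) : ∃ x y : ℕ, x ^ 2 = p + 2 * y ^ 2 := by
  have : Fact p.Prime := ⟨hp⟩
  set k := Nat.sqrt p with hk
  have hk1 : p < (k + 1) * (k + 1) := Nat.lt_succ_sqrt p
  have hk2 : k * k < p := by
    refine lt_of_le_of_ne (Nat.sqrt_le p) ?_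
    intro h
    exact nsq_sf hp.squarefree hp.one_lt ⟨k, h.symm⟩
  obtain ⟨⟨x1, y1⟩, h1, ⟨x2, y2⟩, h2, hne, heq⟩ := Finset.exists_ne_map_eq_of_card_lt_of_maps_to 
    (s := Finset.range (k + 1) ×ˢ Finset.range (k + 1)) (t := (Finset.univ : Finset (ZMod p))) 
    (f := fun z => (z.1 : ZMod p) - s * z.2) 
    (by simpa [ZMod.card] using hk1) (fun _ _ => by simp)
  simp only [Finset.mem_product, Finset.mem_range] at h1 h2
  have hX : |(x1 : ℤ) - x2| ≤ k := by rw [abs_le]; omega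
  have hY : |(y1 : ℤ) - y2| ≤ k := by rw [abs_le]; omega
  set X : ℤ := x1 - x2 with hXd
  set Y : ℤ := y1 - y2 with hYd
  have hdvd : (p : ℤ) ∣ X ^ 2 - 2 * Y ^ 2 := by
    rw [← ZMod.intCast_zmod_eq_zero_iff_dvd]
    have e : (X : ZMod p) = s * Y := by
      rw [hXd, hYd]; push_cast
      linear_combination heq
    push_cast
    rw [e]; linear_combination (Y : ZMod p) ^ 2 * hs
  have hX2 : X ^ 2 ≤ (k : ℤ) ^ 2 := sq_le_sq' (abs_le.1 hX).1 (abs_le.1 hX).2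
  have hY2 : Y ^ 2 ≤ (k : ℤ) ^ 2 := sq_le_sq' (abs_le.1 hY).1 (abs_le.1 hY).2
  have hk2' : (k : ℤ) ^ 2 < p := by rw [pow_two]; exact_mod_cast hk2
  obtain ⟨m, hm⟩ := hdvd
  have hp0 : (0 : ℤ) < p := by exact_mod_cast hp.pos
  have m1 : m < 1 := by
    by_contra h; push Not at h
    nlinarith [sq_nonneg Y]
  have m2 : -2 < m := by
    by_contra h; push Not at h
    nlinarith [sq_nonneg X]
  have : m = 0 ∨ m = -1 := by omega
  rcases this with rfl | rfl
  · exfalso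
    rw [mul_zero] at hm
    have hY0 : Y = 0 := by
      by_contra hY0
      have : IsSquare ((2 : ℕ) : ℚ) := by
        refine ⟨X / Y, ?_⟩
        have h3 : (X : ℚ) ^ 2 - 2 * Y ^ 2 = 0 := by exact_mod_cast hm
        have : (Y : ℚ) ≠ 0 := by exact_mod_cast hY0
        field_simp
        push_cast
        linarith
      rw [Rat.isSquare_natCast_iff] at this
      exact nsq_mod4 rfl this
    have hX0 : X = 0 := by
      rw [hY0] at hm; simpa using hm
    apply hne
    rw [Prod.mk.injEq]
    constructor <;> omega
  · refine ⟨X.natAbs + 2 * Y.natAbs, X.natAbs + Y.natAbs, ?_⟩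
    zify
    have a1 := sq_abs X
    have a2 := sq_abs Y
    linear_combination a1 - 2 * a2 - hm - 2 * a1 + 4 * a2

lemma fourth_iff {p : ℕ} [Fact p.Prime] (h4 : p % 4 = 1) {c : ZMod p} (hc : c ^ 2 = 2) : 
    (∃ x : ZMod p, x ^ 4 = 2) ↔ IsSquare c := by
  constructor
  · rintro ⟨x, hx⟩
    have : (x ^ 2) ^ 2 = c ^ 2 := by rw [hc, ← hx]; ring
    rcases sq_eq_sq_iff_eq_or_eq_neg.1 this with h | h
    · exact ⟨x, by rw [← h]; ring⟩
    · have h1 : IsSquare (-1 : ZMod p) := ZMod.exists_sq_eq_neg_one_iff.2 (by omega)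
      have h2 : c = (-1) * x ^ 2 := by rw [h]; ring
      rw [h2]
      exact h1.mul (IsSquare.sq x)
  · rintro ⟨y, rfl⟩
    exact ⟨y, by rw [← hc]; ring⟩

lemma cop_of_norm {p A B : ℕ} (hp : p.Prime) (h : A ^ 2 = p + 2 * B ^ 2) : Nat.Coprime A B := by
  rw [Nat.coprime_iff_gcd_eq_one]
  by_contra hne
  obtain ⟨r, hr, hrd⟩ := Nat.exists_prime_and_dvd hne
  obtain ⟨a, rfl⟩ := hrd.trans (Nat.gcd_dvd_left A B)
  obtain ⟨b, rfl⟩ := hrd.trans (Nat.gcd_dvd_right _ B)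
  have : r * r ∣ p := by
    have h1 : r * r ∣ 2 * (r * b) ^ 2 := ⟨2 * b ^ 2, by ring⟩
    rw [← Nat.dvd_add_left h1, ← h]
    exact ⟨a ^ 2, by ring⟩
  exact hr.one_lt.ne' (Nat.isUnit_iff.1 (hp.squarefree r this))

lemma jac_B {p A B : ℕ} (hp : p.Prime) (h8 : p % 8 = 1) (h : A ^ 2 = p + 2 * B ^ 2) : J(B | p) = 1 := by
  have hpo : Odd p := Nat.odd_iff.2 (by omega)
  have hB : B ≠ 0 := by
    rintro rfl
    exact nsq_sf hp.squarefree hp.one_lt ⟨A, by rw [← pow_two, h]; ring⟩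
  obtain ⟨k, b, hb, e⟩ := Nat.exists_eq_two_pow_mul_odd hB
  have h2 : J(2 | p) = 1 := by
    rw [jacobiSym.at_two hpo, ZMod.χ₈_nat_eq_if_mod_eight]
    simp [h8]; omega
  have hcop : Nat.Coprime A b := (cop_of_norm hp h).coprime_dvd_right ⟨2 ^ k, by rw [e]; ring⟩
  have e3 : J(b | p) = 1 := by
    rw [← jacobiSym.quadratic_reciprocity_one_mod_four (a := p) (by omega) hb]
    have : J((p : ℤ) | b) = J((A : ℤ) ^ 2 | b) := by
      apply jacobiSym.mod_left'
      have : (A : ℤ) ^ 2 = p + b * (2 ^ k * 2 * B) := by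
        have : ((A ^ 2 : ℕ) : ℤ) = ((p + 2 * B ^ 2 : ℕ) : ℤ) := by rw [h]
        push_cast at this
        rw [this]
        have eB : (B : ℤ) = 2 ^ k * b := by exact_mod_cast e
        linear_combination 2 * (B : ℤ) * eB
      rw [this, Int.add_mul_emod_self_left]
    rw [this]
    apply jacobiSym.sq_one'
    exact_mod_cast hcop
  rw [e]
  push_cast
  rw [jacobiSym.mul_left, jacobiSym.pow_left, h2, e3]; simp

lemma jac_A {p A B : ℕ} (hp : p.Prime) (h8 : p % 8 = 1) (h : A ^ 2 = p + 2 * B ^ 2) (hA : Odd A) : 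
    J(A | p) = ZMod.χ₈' A := by
  rw [← jacobiSym.quadratic_reciprocity_one_mod_four (a := p) (by omega) hA, ← jacobiSym.at_neg_two hA]
  have : J((p : ℤ) | A) = J(-2 * (B : ℤ) ^ 2 | A) := by
    apply jacobiSym.mod_left'
    have : (p : ℤ) = -2 * B ^ 2 + A * A := by
      have : ((A ^ 2 : ℕ) : ℤ) = ((p + 2 * B ^ 2 : ℕ) : ℤ) := by rw [h]
      push_cast at this
      linarith
    rw [this, Int.add_mul_emod_self_left]
  rw [this, jacobiSym.mul_left, jacobiSym.sq_one', mul_one]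
  exact_mod_cast (cop_of_norm hp h).symm

lemma sq_mod {a : ℕ} (h : Odd a) : a ^ 2 % 8 = 1 := by
  have := Nat.odd_iff.1 h
  have h : a % 8 = 1 ∨ a % 8 = 3 ∨ a % 8 = 5 ∨ a % 8 = 7 := by omega
  rcases h with h | h | h | h <;> simp [Nat.pow_mod, h]

lemma sq_mod16 {a : ℕ} (h : Odd a) : a ^ 2 % 16 = 1 ↔ (a % 8 = 1 ∨ a % 8 = 7) := by
  have := Nat.odd_iff.1 h
  have h : a % 16 = 1 ∨ a % 16 = 3 ∨ a % 16 = 5 ∨ a % 16 = 7 ∨ a % 16 = 9 ∨ a % 16 = 11 ∨ a % 16 = 13 ∨ 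
    a % 16 = 15 := by omega
  have e : a % 8 = a % 16 % 8 := by omega
  rw [e]
  rcases h with h | h | h | h | h | h | h | h <;> simp [Nat.pow_mod, h]

lemma norm_mod {p A B : ℕ} (ho : Odd p) (h : A ^ 2 = p + 2 * B ^ 2) : Odd A := by
  by_contra hA
  rw [Nat.not_odd_iff_even] at hA
  obtain ⟨a, rfl⟩ := hA
  obtain ⟨c, rfl⟩ := ho
  have : (a + a) ^ 2 = 2 * (2 * a ^ 2) := by ring
  omega

lemma exists_norm_one {p : ℕ} (hp : p.Prime) (h8 : p % 8 = 1) : 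
    ∃ A B : ℕ, A ^ 2 = p + 2 * B ^ 2 ∧ B % 4 = 0 ∧ Odd A := by
  have : Fact p.Prime := ⟨hp⟩
  have hpo : Odd p := Nat.odd_iff.2 (by omega)
  obtain ⟨s, hs⟩ := (ZMod.exists_sq_eq_two_iff (p := p) (by rintro rfl; omega)).2 (Or.inl h8)
  obtain ⟨A, B, h⟩ := thue2 hp s (by rw [hs]; ring)
  have hA := norm_mod hpo h
  have hA8 := sq_mod hA
  have hB : B % 2 = 0 := by
    by_contra hB
    have : B ^ 2 % 8 = 1 := sq_mod (Nat.odd_iff.2 (by omega))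
    omega
  have : B % 4 = 0 ∨ B % 4 = 2 := by omega
  rcases this with h4 | h4
  · exact ⟨A, B, h, h4, hA⟩
  · have e : (3 * A + 4 * B) ^ 2 = p + 2 * (2 * A + 3 * B) ^ 2 := by nlinarith
    refine ⟨3 * A + 4 * B, 2 * A + 3 * B, e, ?_, norm_mod hpo e⟩
    have := Nat.odd_iff.1 hA
    omega

lemma not_xor_rep {p : ℕ} (hp : p.Prime) (h8 : p % 8 = 1) 
    (hx : ¬ Xor' (∃ x : ZMod p, x ^ 4 = 2) (p % 16 = 1)) : 
    ∃ A B : ℕ, A ^ 2 = p + 2 * B ^ 2 ∧ B % 4 = 0 ∧ A % 4 = 1 := by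
  have : Fact p.Prime := ⟨hp⟩
  obtain ⟨A, B, h, h4, hA⟩ := exists_norm_one hp h8
  refine ⟨A, B, h, h4, ?_⟩
  have jB := jac_B hp h8 h
  have jA := jac_A hp h8 h hA
  have nz : ∀ z : ℤ, legendreSym p z ≠ 0 → (z : ZMod p) ≠ 0 := fun z hz h0 => 
    hz ((legendreSym.eq_zero_iff p z).2 h0)
  rw [← jacobiSym.legendreSym.to_jacobiSym] at jA jB
  have hB0 : ((B : ℤ) : ZMod p) ≠ 0 := nz _ (by rw [jB]; norm_num)
  have hBs : IsSquare ((B : ℤ) : ZMod p) := (legendreSym.eq_one_iff p hB0).1 jB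
  have hA2 := Nat.odd_iff.1 hA
  rw [ZMod.χ₈'_nat_eq_if_mod_eight, if_neg (by omega)] at jA
  have hA0 : ((A : ℤ) : ZMod p) ≠ 0 := nz _ (by rw [jA]; split_ifs <;> norm_num)
  have hAs : IsSquare ((A : ℤ) : ZMod p) ↔ (A % 8 = 1 ∨ A % 8 = 3) := by
    rw [← legendreSym.eq_one_iff p hA0, jA]
    split_ifs with h <;> simp [h]
  push_cast at hB0 hBs hA0 hAs
  have hc : ((A : ZMod p) / B) ^ 2 = 2 := by
    have : ((A ^ 2 : ℕ) : ZMod p) = ((p + 2 * B ^ 2 : ℕ) : ZMod p) := by rw [h]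
    push_cast at this
    rw [ZMod.natCast_self, zero_add] at this
    rw [div_pow, this]; field_simp
  have e1 := fourth_iff (p := p) (by omega) hc
  have e2 : IsSquare ((A : ZMod p) / B) ↔ IsSquare (A : ZMod p) := by
    constructor
    · intro hh
      have := hh.mul hBs
      rwa [div_mul_cancel₀ _ hB0] at this
    · intro hh; exact hh.div hBs
  have e3 : p % 16 = 1 ↔ (A % 8 = 1 ∨ A % 8 = 7) := by
    rw [← sq_mod16 hA, h]
    obtain ⟨b, rfl⟩ : ∃ b, B = 4 * b := ⟨B / 4, by omega⟩
    have : 2 * (4 * b) ^ 2 = 16 * (2 * b ^ 2) := by ring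
    omega
  rw [e1, e2, hAs, e3] at hx
  unfold Xor' Xor at hx
  omega

lemma rep_seven {q : ℕ} (hq : q.Prime) (h8 : q % 8 = 7) : ∃ a b : ℕ, a ^ 2 = q + 2 * b ^ 2 ∧ Odd a ∧ Odd b := by
  have : Fact q.Prime := ⟨hq⟩
  have hpo : Odd q := Nat.odd_iff.2 (by omega)
  obtain ⟨s, hs⟩ := (ZMod.exists_sq_eq_two_iff (p := q) (by rintro rfl; omega)).2 (Or.inr h8)
  obtain ⟨A, B, h⟩ := thue2 hq s (by rw [hs]; ring)
  have hA := norm_mod hpo h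
  have hA8 := sq_mod hA
  refine ⟨A, B, h, hA, ?_⟩
  by_contra hB
  rw [Nat.not_odd_iff_even] at hB
  obtain ⟨b, rfl⟩ := hB
  have : 2 * (b + b) ^ 2 = 8 * b ^ 2 := by ring
  omega

lemma rep_seven_mul {q₁ q₂ : ℕ} (h1 : q₁.Prime) (h2 : q₂.Prime) (h18 : q₁ % 8 = 7) (h28 : q₂ % 8 = 7) :
    ∃ A B : ℤ, 0 < A ∧ A ^ 2 - 2 * B ^ 2 = (q₁ * q₂ : ℕ) ∧ 
      ((A % 4 = 1 ∧ B % 4 = 0) ∨ (A % 4 = 3 ∧ B % 4 = 2)) := by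
  obtain ⟨a, b, e, ha, hb⟩ := rep_seven h1 h18
  obtain ⟨a', b', e', ha', hb'⟩ := rep_seven h2 h28
  have ez : (a : ℤ) ^ 2 = q₁ + 2 * b ^ 2 := by exact_mod_cast e
  have ez' : (a' : ℤ) ^ 2 = q₂ + 2 * b' ^ 2 := by exact_mod_cast e'
  have en : ((q₁ * q₂ : ℕ) : ℤ) = (a ^ 2 - 2 * b ^ 2) * (a' ^ 2 - 2 * b' ^ 2) := by
    rw [ez, ez']; push_cast; ring
  have p1 : b < a := by
    rw [← Nat.pow_lt_pow_iff_left (n := 2) (by norm_num)]; nlinarith [h1.pos]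
  have p2 : b' < a' := by
    rw [← Nat.pow_lt_pow_iff_left (n := 2) (by norm_num)]; nlinarith [h2.pos]
  have key : 2 * (b * b') < a * a' := by
    rw [← Nat.pow_lt_pow_iff_left (n := 2) (by norm_num)]
    have : (a * a') ^ 2 = (q₁ + 2 * b ^ 2) * (q₂ + 2 * b' ^ 2) := by rw [mul_pow, e, e']
    rw [this]
    nlinarith [h1.pos, h2.pos, Nat.zero_le (b ^ 2), Nat.zero_le (b' ^ 2), mul_pos h1.pos h2.pos]
  have keyz : 2 * ((b : ℤ) * b') < a * a' := by exact_mod_cast key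
  have nn : 0 ≤ (b : ℤ) * b' := by positivity
  have main : ∀ B : ℤ, ∀ A : ℤ, A % 2 = 1 → B % 2 = 0 → (((A % 4 = 1 ∧ B % 4 = 0) ∨ (A % 4 = 3 ∧ B % 4 = 2)) 
    ∨ ((A % 4 = 1 ∧ B % 4 = 2) ∨ (A % 4 = 3 ∧ B % 4 = 0))) := by intro B A hA hB; omega
  obtain ⟨x, rfl⟩ := ha
  obtain ⟨y, rfl⟩ := hb
  obtain ⟨x', rfl⟩ := ha'
  obtain ⟨y', rfl⟩ := hb'
  push_cast at *
  generalize (x : ℤ) = X at *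
  generalize (y : ℤ) = Y at *
  generalize (x' : ℤ) = X' at *
  generalize (y' : ℤ) = Y' at *
  have hA2 : ((2 * X + 1) * (2 * X' + 1) + 2 * ((2 * Y + 1) * (2 * Y' + 1))) % 2 = 1 := by
    have : (2 * X + 1) * (2 * X' + 1) + 2 * ((2 * Y + 1) * (2 * Y' + 1)) = 
      2 * (2 * X * X' + X + X' + ((2 * Y + 1) * (2 * Y' + 1))) + 1 := by ring
    omega
  have hB2 : ((2 * X + 1) * (2 * Y' + 1) + (2 * X' + 1) * (2 * Y + 1)) % 2 = 0 := by
    have : (2 * X + 1) * (2 * Y' + 1) + (2 * X' + 1) * (2 * Y + 1) = 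
      2 * (2 * X * Y' + X + Y' + 2 * X' * Y + X' + Y + 1) := by ring
    omega
  rcases main _ _ hA2 hB2 with h | h
  · refine ⟨_, _, ?_, ?_, h⟩
    · linarith
    · rw [en]; ring
  · refine ⟨(2 * X + 1) * (2 * X' + 1) - 2 * ((2 * Y + 1) * (2 * Y' + 1)), 
      -((2 * X + 1) * (2 * Y' + 1)) + (2 * X' + 1) * (2 * Y + 1), by linarith, by rw [en]; ring, ?_⟩
    have t1 : (2 * X + 1) * (2 * X' + 1) - 2 * ((2 * Y + 1) * (2 * Y' + 1)) = 
      (2 * X + 1) * (2 * X' + 1) + 2 * ((2 * Y + 1) * (2 * Y' + 1)) - 4 * ((2 * Y + 1) * (2 * Y' + 1)) := by ring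
    have t2 : -((2 * X + 1) * (2 * Y' + 1)) + (2 * X' + 1) * (2 * Y + 1) = 
      (2 * X + 1) * (2 * Y' + 1) + (2 * X' + 1) * (2 * Y + 1) - 2 - 4 * (2 * X * Y' + X + Y') := by ring
    rw [t1, t2]
    omega

theorem even_dir (d : ℕ) (hd1 : 1 < d) (hodd : Odd d) (hsf : Squarefree d) (n : ℕ) (hn : 1 ≤ n) 
    (h : Odd (Nat.card (ClassGroup (𝓞 (LL n d))))) : 
      ((∃ q₁ q₂ : ℕ, q₁.Prime ∧ q₂.Prime ∧ q₁ % 4 = 3 ∧ q₂ % 4 = 3 ∧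
          (q₁ % 8 = 3 ∨ q₂ % 8 = 3) ∧ d = q₁ * q₂) ∨
       (d.Prime ∧ d % 4 = 3) ∨
       (d.Prime ∧ d % 8 = 5) ∨
       (d.Prime ∧ d % 8 = 1 ∧ Xor' (∃ x : ZMod d, x ^ 4 = 2) (d % 16 = 1))) := by
  have hd2 := Nat.odd_iff.1 hodd
  have hi : ∀ a b : ℕ, d = a * b → a % 4 = 1 → 1 < a → ¬ 1 < b := 
    fun a b e h1 h2 h3 => even_i n hsf hodd e h1 h2 h3 h
  by_cases hp : d.Prime
  · by_cases hd8 : d % 8 = 1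
    · by_cases hx : Xor' (∃ x : ZMod d, x ^ 4 = 2) (d % 16 = 1)
      · exact Or.inr (Or.inr (Or.inr ⟨hp, hd8, hx⟩))
      · exfalso
        obtain ⟨A, B, e, h1, h2⟩ := not_xor_rep hp hd8 hx
        have e' : (A : ℤ) ^ 2 = d + 2 * B ^ 2 := by exact_mod_cast e
        exact even_ii n hn hsf hodd hd1 A B (by omega) (by rw [e']; ring) (by omega) h
    · by_cases h4 : d % 4 = 3
      · exact Or.inr (Or.inl ⟨hp, h4⟩)
      · exact Or.inr (Or.inr (Or.inl ⟨hp, by omega⟩))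
  · left
    have hfac : ∀ e : ℕ, e ∣ d → e % 4 = 1 ∨ e % 4 = 3 := by
      rintro e ⟨f, rfl⟩
      have := (Nat.odd_mul.1 hodd).1
      have := Nat.odd_iff.1 this
      omega
    obtain ⟨p, hpp, e, he⟩ := Nat.exists_prime_and_dvd hd1.ne'
    have he1 : 1 < e := by
      rcases Nat.lt_or_ge 1 e with h | h
      · exact h
      · exfalso
        interval_cases e
        · omega
        · apply hp; rw [he, mul_one]; exact hpp
    have hp4 : p % 4 = 3 := (hfac p ⟨e, he⟩).resolve_left (fun h' => hi p e he h' hpp.one_lt he1)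
    have he4 : e % 4 = 3 := (hfac e ⟨p, by rw [he, mul_comm]⟩).resolve_left 
      (fun h' => hi e p (by rw [he, mul_comm]) h' he1 hpp.one_lt)
    have hep : e.Prime := by
      by_contra hne
      obtain ⟨r, hr, f, hf⟩ := Nat.exists_prime_and_dvd he1.ne'
      have hf1 : 1 < f := by
        rcases Nat.lt_or_ge 1 f with h | h
        · exact h
        · exfalso
          interval_cases f
          · omega
          · apply hne; rw [hf, mul_one]; exact hr
      have e1 : d = r * (p * f) := by rw [he, hf]; ring
      have e2 : d = (p * r) * f := by rw [he, hf]; ring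
      have hr4 : r % 4 = 3 := (hfac r ⟨_, e1⟩).resolve_left 
        (fun h' => hi r _ e1 h' hr.one_lt (by nlinarith [hpp.one_lt]))
      refine hi _ _ e2 ?_ (by nlinarith [hpp.one_lt, hr.one_lt]) hf1
      rw [Nat.mul_mod, hp4, hr4]
    refine ⟨p, e, hpp, hep, hp4, he4, ?_, he⟩
    by_contra h7
    obtain ⟨A, B, hA, hAB, h4⟩ := rep_seven_mul hpp hep (by omega) (by omega)
    rw [← he] at hAB
    exact even_ii n hn hsf hodd hd1 A B hA hAB h4 h

end Part9

section Part10
open NumberField IntermediateField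

/-- `z ∈ K` has norm `r`. -/
def HN (K : IntermediateField ℚ ℂ) (z : ℂ) (r : ℚ) : Prop := ∃ x : K, (x : ℂ) = z ∧ Algebra.norm ℚ x = r

lemma HN.step {F K : IntermediateField ℚ ℂ} {γ : ℂ} (h : QE F K γ) (hF : TR F) (hK : TR K) {z u v : ℂ} {r : ℚ}
    (hu : u ∈ F) (hv : v ∈ F) (e : z = u + v * γ) (hw : HN F (u ^ 2 - v ^ 2 * γ ^ 2) r) : HN K z r := by
  letI := h.alg
  have := hF.nf
  have := hK.nf
  have := h.tower
  have := h.finite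
  obtain ⟨σ, h1, h2, h3⟩ := h.exists_conj
  obtain ⟨-, -, -, hn⟩ := quad_all h.rank σ h1
  have hz : z ∈ K := by rw [e]; exact K.add_mem (h.le hu) (K.mul_mem (h.le hv) h.mem)
  refine ⟨⟨z, hz⟩, rfl, ?_⟩
  obtain ⟨w, hw, rfl⟩ := hw
  rw [← Algebra.norm_norm (S := F)]
  congr 1
  have h4 := congrArg (Subtype.val : K → ℂ) (hn ⟨z, hz⟩)
  apply Subtype.ext
  have h5 : ((Algebra.norm F (⟨z, hz⟩ : K) : F) : ℂ) = z * (σ ⟨z, hz⟩ : ℂ) := h4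
  rw [h5, h3 u v hu hv ⟨z, hz⟩ e, hw, e]; ring

lemma HN.bot (r : ℚ) : HN ⊥ (r : ℂ) r := by
  refine ⟨algebraMap ℚ _ r, rfl, ?_⟩
  rw [Algebra.norm_algebraMap, IntermediateField.finrank_bot, pow_one]

lemma HN.base {d : ℕ} (hd : ¬ IsSquare d) (ho : Odd d) (a b : ℚ) : 
    HN (LL 0 d) (a + b * rd d) (a ^ 2 - b ^ 2 * d) := by
  refine HN.step (qe_base hd) TR_bot (TR_L hd ho 0) (SubfieldClass.ratCast_mem _ a) (SubfieldClass.ratCast_mem _ b) rfl ?_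
  rw [rd_sq]
  have := HN.bot (a ^ 2 - b ^ 2 * d)
  push_cast at this
  exact this

lemma HN.cc {d : ℕ} (hd : ¬ IsSquare d) (ho : Odd d) (m : ℕ) : 
    HN (LL m d) (2 + cc m) 4 ∧ HN (LL m d) (2 - cc m) 4 ∧ HN (LL (m + 1) d) (cc (m + 1)) 4 := by
  have h2 := ns_two hd ho
  have a1 : HN (LL m d) (2 + _root_.cc m) 4 ∧ HN (LL m d) (2 - _root_.cc m) 4 := by
    induction m with
    | zero => 
      have := HN.base hd ho 2 0
      norm_num at this
      rw [cc_zero]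
      simpa using this
    | succ m ih => 
      have hq := qe_tower h2 m
      have hF := TR_L hd ho m
      have hK := TR_L hd ho (m + 1)
      constructor
      · refine HN.step hq hF hK (u := 2) (v := 1) (ofNat_mem _ 2) (one_mem _) (by ring) ?_
        rw [cc_sq]; convert ih.2 using 1; ring
      · refine HN.step hq hF hK (u := 2) (v := -1) (ofNat_mem _ 2) (neg_mem (one_mem _)) (by ring) ?_
        rw [cc_sq]; convert ih.2 using 1; ring
  refine ⟨a1.1, a1.2, ?_⟩
  have hq := qe_tower h2 m
  have hF := TR_L hd ho m
  have hK := TR_L hd ho (m + 1)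
  refine HN.step hq hF hK (u := 0) (v := 1) (zero_mem _) (one_mem _) (by ring) ?_
  rw [cc_sq]
  obtain ⟨x, hx, e⟩ := a1.1
  refine ⟨-x, ?_, ?_⟩
  · push_cast; rw [hx]; ring
  · have : -x = algebraMap ℚ _ (-1) * x := by simp
    rw [this, map_mul, e, Algebra.norm_algebraMap]
    have : Even (Module.finrank ℚ (LL m d)) := by
      have hq := qe_rd' m hd ho
      letI := hq.alg
      have := hq.tower
      have := hF.fin
      rw [← Module.finrank_mul_finrank ℚ (LL m 1) (LL m d), hq.rank]
      exact even_two.mul_left _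
    rw [this.neg_one_pow]; norm_num

section count
variable {K : IntermediateField ℚ ℂ} [NumberField K]

lemma HN.abs (hK : TR K) {z : ℂ} {N : ℤ} (h : HN K z N) (hz : z ∈ K) (hi : IsIntegral ℤ z) : 
    Ideal.absNorm (Ideal.span {mkO K z hz hi}) = N.natAbs := by
  have := hK.nf
  rw [Ideal.absNorm_span_singleton]
  congr 1
  obtain ⟨x, e, hx⟩ := h
  have : x = ((mkO K z hz hi : 𝓞 K) : K) := Subtype.ext e
  rw [this, ← Algebra.coe_norm_int] at hx
  exact_mod_cast hx

lemma absN_ne_one (hK : TR K) {P : Ideal (𝓞 K)} (hP : P.IsPrime) : Ideal.absNorm P ≠ 1 := by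
  have := hK.nf
  rw [Ne, Ideal.absNorm_eq_one_iff]
  exact hP.ne_top

lemma cnt1 (hK : TR K) {z : ℂ} {N : ℤ} (h : HN K z N) (hz : z ∈ K) (hi : IsIntegral ℤ z)
    {P : Ideal (𝓞 K)} (hP : InP P z) : (Ideal.absNorm P : ℤ) ∣ N := by
  have := hK.nf
  rw [Int.natCast_dvd, ← h.abs hK hz hi]
  apply Ideal.absNorm_dvd_absNorm_of_le
  rw [Ideal.span_singleton_le_iff_mem]
  exact (InP.mkO_mem hz hi).2 hP

lemma pair_le (hK : TR K) {P Q : Ideal (𝓞 K)} (hP : P.IsPrime) (hP0 : P ≠ ⊥) 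
    (hQ : Q.IsPrime) (hQ0 : Q ≠ ⊥) (h : P ≠ Q) : IsCoprime P Q := by
  have := hK.nf
  have m1 := hP.isMaximal hP0
  have m2 := hQ.isMaximal hQ0
  exact Ideal.isCoprime_iff_sup_eq.2 (m1.coprime_of_ne m2 h)

lemma cnt2 (hK : TR K) {z : ℂ} {N : ℤ} (h : HN K z N) (hz : z ∈ K) (hi : IsIntegral ℤ z)
    {P Q : Ideal (𝓞 K)} (hP : P.IsPrime) (hP0 : P ≠ ⊥) (hQ : Q.IsPrime) (hQ0 : Q ≠ ⊥) (hPQ : P ≠ Q)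
    (hPz : InP P z) (hQz : InP Q z) : ((Ideal.absNorm P * Ideal.absNorm Q : ℕ) : ℤ) ∣ N := by
  have := hK.nf
  rw [Int.natCast_dvd, ← h.abs hK hz hi, ← map_mul]
  apply Ideal.absNorm_dvd_absNorm_of_le
  rw [Ideal.span_singleton_le_iff_mem, ← Ideal.inf_eq_mul_of_isCoprime (pair_le hK hP hP0 hQ hQ0 hPQ)]
  exact ⟨(InP.mkO_mem hz hi).2 hPz, (InP.mkO_mem hz hi).2 hQz⟩

lemma cnt3 (hK : TR K) {z : ℂ} {N : ℤ} (h : HN K z N) (hz : z ∈ K) (hi : IsIntegral ℤ z)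
    {P Q R : Ideal (𝓞 K)} (hP : P.IsPrime) (hP0 : P ≠ ⊥) (hQ : Q.IsPrime) (hQ0 : Q ≠ ⊥) 
    (hR : R.IsPrime) (hR0 : R ≠ ⊥) (hPQ : P ≠ Q) (hPR : P ≠ R) (hQR : Q ≠ R)
    (hPz : InP P z) (hQz : InP Q z) (hRz : InP R z) : 
    ((Ideal.absNorm P * Ideal.absNorm Q * Ideal.absNorm R : ℕ) : ℤ) ∣ N := by
  have := hK.nf
  rw [Int.natCast_dvd, ← h.abs hK hz hi, ← map_mul, ← map_mul]
  apply Ideal.absNorm_dvd_absNorm_of_le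
  have c1 := pair_le hK hP hP0 hQ hQ0 hPQ
  have c2 : IsCoprime (P * Q) R := 
    IsCoprime.mul_left (pair_le hK hP hP0 hR hR0 hPR) (pair_le hK hQ hQ0 hR hR0 hQR)
  rw [Ideal.span_singleton_le_iff_mem, ← Ideal.inf_eq_mul_of_isCoprime c2, ← Ideal.inf_eq_mul_of_isCoprime c1]
  exact ⟨⟨(InP.mkO_mem hz hi).2 hPz, (InP.mkO_mem hz hi).2 hQz⟩, (InP.mkO_mem hz hi).2 hRz⟩

/-- If `|N z| = 4` and `P ≠ Q` both contain `z`, then both have norm two and `(z) = P ∩ Q`. -/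
lemma split4 (hK : TR K) {z : ℂ} (h : HN K z 4) (hz : z ∈ K) (hi : IsIntegral ℤ z)
    {P Q : Ideal (𝓞 K)} (hP : P.IsPrime) (hP0 : P ≠ ⊥) (hQ : Q.IsPrime) (hQ0 : Q ≠ ⊥) (hPQ : P ≠ Q)
    (hPz : InP P z) (hQz : InP Q z) : Ideal.absNorm P = 2 ∧ Ideal.absNorm Q = 2 ∧ 
    ∀ w, InP P w → InP Q w → ∃ y ∈ K, IsIntegral ℤ y ∧ w = z * y := by
  have := hK.nf
  have h' : HN K z (4 : ℤ) := by exact_mod_cast h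
  have h1 := cnt2 hK h' hz hi hP hP0 hQ hQ0 hPQ hPz hQz
  have p1 := absN_ne_one hK hP
  have q1 := absN_ne_one hK hQ
  have p0 : Ideal.absNorm P ≠ 0 := by rwa [Ne, Ideal.absNorm_eq_zero_iff]
  have q0 : Ideal.absNorm Q ≠ 0 := by rwa [Ne, Ideal.absNorm_eq_zero_iff]
  have hle : Ideal.absNorm P * Ideal.absNorm Q ≤ 4 := by
    have := Int.le_of_dvd (by norm_num) h1
    exact_mod_cast this
  have p2 : 2 ≤ Ideal.absNorm P := by omega
  have q2 : 2 ≤ Ideal.absNorm Q := by omega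
  have e1 : Ideal.absNorm P = 2 := by nlinarith
  have e2 : Ideal.absNorm Q = 2 := by nlinarith
  refine ⟨e1, e2, ?_⟩
  rintro w ⟨w1, rfl, hw1⟩ ⟨w2, e, hw2⟩
  have : w2 = w1 := O_ext e
  subst this
  have c1 := pair_le hK hP hP0 hQ hQ0 hPQ
  have hd : P * Q ∣ Ideal.span {mkO K z hz hi} := by
    rw [Ideal.dvd_iff_le, Ideal.span_singleton_le_iff_mem, ← Ideal.inf_eq_mul_of_isCoprime c1]
    exact ⟨(InP.mkO_mem hz hi).2 hPz, (InP.mkO_mem hz hi).2 hQz⟩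
  have heq : Ideal.span {mkO K z hz hi} = P * Q := by
    obtain ⟨J, hJ⟩ := hd
    have e3 := congrArg Ideal.absNorm hJ
    rw [h'.abs hK hz hi, map_mul, map_mul, e1, e2] at e3
    have : Ideal.absNorm J = 1 := by
      have e4 : (4:ℤ).natAbs = 4 := rfl
      rw [e4] at e3; omega
    rw [Ideal.absNorm_eq_one_iff] at this
    rw [hJ, this, Ideal.mul_top]
  have hw : w2 ∈ Ideal.span {mkO K z hz hi} := by
    rw [heq, ← Ideal.inf_eq_mul_of_isCoprime c1]; exact ⟨hw1, hw2⟩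
  obtain ⟨y, hy⟩ := Ideal.mem_span_singleton'.1 hw
  refine ⟨y, Subtype.property _, ?_, ?_⟩
  · exact (isIntegral_algebraMap_iff (R := ℤ) (A := K) (B := ℂ) Subtype.val_injective).2 y.2
  · rw [← hy, mul_comm]; rfl

end count

lemma two_cc {m d : ℕ} {P : Ideal (𝓞 (LL m d))} (hP : P.IsPrime) (h : InP P 2) : 
    ∀ j ≤ m, InP P (cc j) := by
  intro j
  induction j with
  | zero => intro _; rw [cc_zero]; simpa using h.int_mul 0
  | succ j ih => 
    intro hj
    refine InP.of_sq hP ?_ (LL_mono hj d (cc_mem _ _)) (isInt_cc _)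
    rw [cc_sq]
    exact h.add (ih (by omega))

lemma ram_two {m d : ℕ} (hd : ¬ IsSquare d) (ho : Odd d) {P : Ideal (𝓞 (LL (m + 1) d))} 
    (h : RamE (LL m d) (LL (m + 1) d) (cc (m + 1)) P) : InP P (cc (m + 1)) ∧ InP P 2 := by
  have hP := h.1
  have hq := qe_tower (ns_two hd ho) m
  have h1 : InP P (2 * (1 * cc (m + 1))) := RamE.inP hq h (x := cc (m + 1)) (u := 0) (isInt_cc _) 
    (by simpa using (isInt_nat 2).mul (isInt_cc _)) (zero_mem _) (one_mem _) (by ring)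
  rw [one_mul] at h1
  have hc : InP P (cc (m + 1)) := by
    rcases h1.or hP (ofNat_mem _ 2) (isInt_nat 2) (cc_mem _ _) (isInt_cc _) with h2 | h2
    · exact two_cc hP h2 _ le_rfl
    · exact h2
  refine ⟨hc, ?_⟩
  -- descending: 4 ∈ P
  have key : ∀ j ≤ m + 1, InP P (cc j) → InP P 2 := by
    intro j
    induction j with
    | zero => 
      intro _ _
      have : ∀ j ≤ m + 1, InP P (2 - cc j) → InP P 2 := by
        intro j
        induction j with
        | zero => intro _ h; rw [cc_zero] at h; simpa using h
        | succ j ih => 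
          intro hj h
          apply ih (by omega)
          have := h.mul (w := 2 + cc (j + 1)) (add_mem (ofNat_mem _ 2) (LL_mono hj d (cc_mem _ _))) 
            ((isInt_nat 2).add (isInt_cc _))
          convert this using 1
          linear_combination cc_sq j
      rcases Nat.eq_zero_or_pos m with rfl | hm
      · have h3 := hc.sq
        rw [cc_sq, cc_zero] at h3; simpa using h3
      · -- c_{m+1}^2 = 2 + c_m
        have h3 := hc.sq
        rw [cc_sq] at h3
        apply this m (by omega)
        obtain ⟨k, rfl⟩ : ∃ k, m = k + 1 := ⟨m - 1, by omega⟩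
        have h4 := h3.mul (w := 2 - cc (k + 1)) (sub_mem (ofNat_mem _ 2) (LL_mono (by omega) d (cc_mem _ _))) 
            ((isInt_nat 2).sub (isInt_cc _))
        have h5 : InP P (2 - cc k) := by
          convert h4 using 1
          linear_combination cc_sq k
        have h6 := this k (by omega) h5
        have h7 := two_cc hP h6 (k + 1) (by omega)
        exact h6.sub h7
    | succ j ih => 
      intro hj h
      have h3 := h.sq
      rw [cc_sq] at h3
      have : ∀ j ≤ m + 1, InP P (2 - cc j) → InP P 2 := by
        intro j
        induction j with
        | zero => intro _ h; rw [cc_zero] at h; simpa using h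
        | succ j ih => 
          intro hj h
          apply ih (by omega)
          have := h.mul (w := 2 + cc (j + 1)) (add_mem (ofNat_mem _ 2) (LL_mono hj d (cc_mem _ _))) 
            ((isInt_nat 2).add (isInt_cc _))
          convert this using 1
          linear_combination cc_sq j
      rcases Nat.eq_zero_or_pos j with rfl | hj0
      · rw [cc_zero] at h3; simpa using h3
      · obtain ⟨k, rfl⟩ : ∃ k, j = k + 1 := ⟨j - 1, by omega⟩
        have h4 := h3.mul (w := 2 - cc (k + 1)) (sub_mem (ofNat_mem _ 2) (LL_mono (by omega) d (cc_mem _ _))) 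
            ((isInt_nat 2).sub (isInt_cc _))
        exact this k (by omega) (by convert h4 using 1; linear_combination cc_sq k)
  exact key (m + 1) le_rfl hc

end Part10

section Part11
open NumberField IntermediateField
open scoped NumberTheorySymbols

lemma absN_two {K : IntermediateField ℚ ℂ} [NumberField K] {P : Ideal (𝓞 K)} (h : Ideal.absNorm P = 2) {z : ℂ}
    (hz : z ∈ K) (hi : IsIntegral ℤ z) : InP P z ∨ InP P (z - 1) := by
  rw [Ideal.absNorm_apply, Submodule.cardQuot_apply] at h
  obtain ⟨y, hy, hu⟩ := (Nat.card_eq_two_iff' (0 : 𝓞 K ⧸ P)).1 h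
  have h10 : (1 : 𝓞 K ⧸ P) ≠ 0 := by
    intro h1
    apply hy
    have : y * 1 = 0 := by rw [h1, mul_zero]
    simpa using this
  by_cases hx : Ideal.Quotient.mk P (mkO K z hz hi) = 0
  · left
    exact ⟨_, rfl, Ideal.Quotient.eq_zero_iff_mem.1 hx⟩
  · right
    have e1 : Ideal.Quotient.mk P (mkO K z hz hi) = 1 := (hu _ hx).trans (hu _ h10).symm
    refine ⟨mkO K z hz hi - 1, rfl, ?_⟩
    rw [← Ideal.Quotient.eq_zero_iff_mem, map_sub, e1, map_one, sub_self]

/-- at most one prime of `LL m d` above `2` -/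
def OneP (m d : ℕ) : Prop := ∀ P Q : Ideal (𝓞 (LL (m + 1) d)), P.IsPrime → P ≠ ⊥ → Q.IsPrime → Q ≠ ⊥ →
  InP P (cc (m + 1)) → InP Q (cc (m + 1)) → InP P 2 → InP Q 2 → P = Q

lemma odd_of_oneP {d : ℕ} (hd : ¬ IsSquare d) (ho : Odd d) (h0 : Odd (Nat.card (ClassGroup (𝓞 (LL 0 d)))))
    (h : ∀ m, OneP m d) (n : ℕ) : Odd (Nat.card (ClassGroup (𝓞 (LL n d)))) := by
  induction n with
  | zero => exact h0
  | succ m ih => 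
    refine qe_odd1 (qe_tower (ns_two hd ho) m) (TR_L hd ho m) (TR_L hd ho (m + 1)) ih ?_
    intro P Q hP hQ
    have p2 := ram_two hd ho hP
    have q2 := ram_two hd ho hQ
    exact h m P Q hP.1 hP.2.1 hQ.1 hQ.2.1 p2.1 q2.1 p2.2 q2.2

lemma oneP_five {d : ℕ} (hd : ¬ IsSquare d) (h5 : d % 8 = 5) (m : ℕ) : OneP m d := by
  have ho : Odd d := Nat.odd_iff.2 (by omega)
  intro P Q hP hP0 hQ hQ0 hPc hQc hP2 hQ2
  by_contra hne
  have hK := TR_L hd ho (m + 1)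
  have := hK.nf
  have h2 := (split4 hK (HN.cc hd ho m).2.2 (cc_mem _ _) (isInt_cc _) hP hP0 hQ hQ0 hne hPc hQc).1
  obtain ⟨k, hk⟩ : ∃ k : ℕ, d = 4 * (2 * k + 1) + 1 := ⟨d / 8, by omega⟩
  have hω : ((1 + rd d) / 2) ^ 2 = 1 * ((1 + rd d) / 2) + ((2 * k + 1 : ℤ) : ℂ) := by
    have := rd_sq d
    rw [hk] at this
    push_cast at this
    rw [hk]; push_cast
    linear_combination this / 4
  have hi : IsIntegral ℤ ((1 + rd d) / 2) := isInt_quad isIntegral_one (isInt_int _) hω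
  have hm : (1 + rd d) / 2 ∈ LL (m + 1) d := div_mem (add_mem (one_mem _) (rd_mem _ _)) (ofNat_mem _ 2)
  have hk' : InP P ((2 * k + 1 : ℤ) : ℂ) := by
    rw [show ((2 * k + 1 : ℤ) : ℂ) = ((1 + rd d) / 2) * ((1 + rd d) / 2 - 1) by linear_combination -hω]
    rcases absN_two h2 hm hi with h | h
    · rw [mul_comm]; exact h.mul (sub_mem hm (one_mem _)) (hi.sub isIntegral_one)
    · exact h.mul hm hi
  refine InP.cop hP (a := 2 * k + 1) (b := 2) ⟨1, -k, by ring⟩ hk' ?_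
  exact_mod_cast hP2

lemma cc_ne (m : ℕ) : cc (m + 1) ≠ 0 := by
  intro h
  apply (qe_tower ns_two_one m).nmem
  rw [h]; exact zero_mem _

lemma ss_exists (d m : ℕ) : ∃ s p : ℂ, s ∈ LL m d ∧ p ∈ LL m d ∧ IsIntegral ℤ s ∧ IsIntegral ℤ p ∧ 
    s ^ 2 = 4 - cc m ^ 2 ∧ 2 = s * p := by
  induction m with
  | zero => 
    exact ⟨2, 1, ofNat_mem _ 2, one_mem _, isInt_nat 2, isIntegral_one, by rw [cc_zero]; norm_num, by norm_num⟩
  | succ m ih => 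
    obtain ⟨s, p, hs, hp, hsi, hpi, e1, e2⟩ := ih
    have hc := cc_ne m
    have e3 : (s / cc (m + 1)) ^ 2 = 4 - cc (m + 1) ^ 2 := by
      rw [div_pow, e1, cc_sq]
      have : 2 + cc m ≠ 0 := by rw [← cc_sq]; exact pow_ne_zero _ hc
      field_simp
      ring
    refine ⟨s / cc (m + 1), p * cc (m + 1), div_mem (LL_succ _ _ hs) (cc_mem _ _), 
      mul_mem (LL_succ _ _ hp) (cc_mem _ _), ?_, hpi.mul (isInt_cc _), e3, ?_⟩
    · refine IsIntegral.of_pow (n := 2) (by norm_num) ?_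
      rw [e3]
      exact (isInt_nat 4).sub ((isInt_cc _).pow 2)
    · rw [e2]; field_simp

lemma oneP_three {d : ℕ} (hd : ¬ IsSquare d) (h3 : d % 4 = 3) (m : ℕ) : OneP m d := by
  have ho : Odd d := Nat.odd_iff.2 (by omega)
  intro P Q hP hP0 hQ hQ0 hPc hQc hP2 hQ2
  by_contra hne
  have hK := TR_L hd ho (m + 1)
  have := hK.nf
  have hsp := (split4 hK (HN.cc hd ho m).2.2 (cc_mem _ _) (isInt_cc _) hP hP0 hQ hQ0 hne hPc hQc).2.2
  obtain ⟨k, hk⟩ : ∃ k : ℤ, (d : ℤ) = 4 * k - 1 := ⟨(d + 1) / 4, by omega⟩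
  have hk' : rd d ^ 2 = 4 * k - 1 := by rw [rd_sq]; exact_mod_cast hk
  obtain ⟨s, p, hs, hp, hsi, hpi, e1, e2⟩ := ss_exists d m
  have hc := cc_ne m
  set c := cc (m + 1) with hcdef
  have hcm : c ∈ LL (m + 1) d := cc_mem _ _
  have hci : IsIntegral ℤ c := isInt_cc _
  obtain ⟨s', hs'⟩ : ∃ s', s' = s / c := ⟨_, rfl⟩
  have e3 : s' ^ 2 = 4 - c ^ 2 := by
    rw [hs', div_pow, e1, cc_sq]
    have : 2 + cc m ≠ 0 := by rw [← cc_sq]; exact pow_ne_zero _ hc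
    field_simp
    ring
  have hs'i : IsIntegral ℤ s' := by
    refine IsIntegral.of_pow (n := 2) (by norm_num) ?_
    rw [e3]
    exact (isInt_nat 4).sub ((isInt_cc _).pow 2)
  have hs'm : s' ∈ LL (m + 1) d := by rw [hs']; exact div_mem (LL_succ _ _ hs) (cc_mem _ _)
  have e4 : 2 = c * (s' * p) := by rw [hs', e2]; field_simp
  have h2i : IsIntegral ℤ (2 : ℂ) := isInt_nat 2
  have h2m : (2 : ℂ) ∈ LL (m + 1) d := ofNat_mem _ 2
  have hs'P : ∀ R : Ideal (𝓞 (LL (m + 1) d)), R.IsPrime → InP R c → InP R 2 → InP R s' := by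
    intro R hR h1 h2
    refine InP.of_sq hR ?_ hs'm hs'i
    rw [e3, show (4 - c ^ 2 : ℂ) = 2 * 2 - c ^ 2 by ring]
    exact (h2.mul h2m h2i).sub h1.sq
  obtain ⟨z, hz⟩ : ∃ z, z = (s' + (2 + c) * rd d) / 2 := ⟨_, rfl⟩
  have hki : IsIntegral ℤ (k : ℂ) := isInt_int k
  have hkm : (k : ℂ) ∈ LL (m + 1) d := intCast_mem _ _
  have hzz : z ^ 2 = s' * z + (2 + c) * (k * (2 + c) - 1) := by
    rw [hz]
    linear_combination (2 + c) ^ 2 * hk' / 4 - e3 / 4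
  have hfi : IsIntegral ℤ (k * (2 + c) - 1) := (hki.mul (h2i.add hci)).sub isIntegral_one
  have hfm : k * (2 + c) - 1 ∈ LL (m + 1) d := sub_mem (mul_mem hkm (add_mem h2m hcm)) (one_mem _)
  have hzi : IsIntegral ℤ z := isInt_quad hs'i ((h2i.add hci).mul hfi) hzz
  have hzm : z ∈ LL (m + 1) d := by
    rw [hz]
    exact div_mem (add_mem hs'm (mul_mem (add_mem h2m hcm) (rd_mem _ _))) h2m
  have hzP : ∀ R : Ideal (𝓞 (LL (m + 1) d)), R.IsPrime → InP R c → InP R 2 → InP R z := by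
    intro R hR h1 h2
    refine InP.of_sq hR ?_ hzm hzi
    rw [hzz]
    have a1 := (hs'P R hR h1 h2).mul hzm hzi
    have a2 := (h2.add h1).mul hfm hfi
    convert a1.add a2 using 1; ring
  obtain ⟨y, hym, hyi, hy⟩ := hsp z (hzP P hP hPc hP2) (hzP Q hQ hQc hQ2)
  have e5 : c * y ^ 2 - s' * y - (s' * p + 1) * (k * (2 + c) - 1) = 0 := by
    have : c * (c * y ^ 2 - s' * y - (s' * p + 1) * (k * (2 + c) - 1)) = 0 := by
      rw [hy] at hzz
      linear_combination hzz + (k * (2 + c) - 1) * e4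
    rcases mul_eq_zero.1 this with h | h
    · exact absurd h hc
    · exact h
  apply InP.one hP
  have b1 := hPc.mul (pow_mem hym 2) (hyi.pow 2)
  have b2 := (hs'P P hP hPc hP2).mul hym hyi
  have b3 := (hP2.add hPc).mul hkm hki
  have b4 := (hs'P P hP hPc hP2).mul (mul_mem (LL_succ _ _ hp) hfm) (hpi.mul hfi)
  convert ((b3.add b4).add b2).sub b1 using 1
  linear_combination e5

/-- primes containing `√d` when `d = p` is prime -/
lemma rd_HN {d : ℕ} (hd : ¬ IsSquare d) (ho : Odd d) : HN (LL 0 d) (rd d) (-(d : ℤ) : ℤ) := by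
  have := HN.base hd ho 0 1
  convert this using 1
  · push_cast; ring
  · push_cast; ring

lemma absN_ge {K : IntermediateField ℚ ℂ} [NumberField K] (hK : TR K) {P : Ideal (𝓞 K)} (hP : P.IsPrime) (h0 : P ≠ ⊥) : 
    2 ≤ Ideal.absNorm P := by
  have p1 := absN_ne_one hK hP
  have p0 : Ideal.absNorm P ≠ 0 := by rwa [Ne, Ideal.absNorm_eq_zero_iff]
  omega

lemma rd_uniq {p : ℕ} (hp : p.Prime) (ho : Odd p) {P Q : Ideal (𝓞 (LL 0 p))} (hP : P.IsPrime) (hP0 : P ≠ ⊥) 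
    (hQ : Q.IsPrime) (hQ0 : Q ≠ ⊥) (h1 : InP P (rd p)) (h2 : InP Q (rd p)) : P = Q := by
  have hd : ¬ IsSquare p := nsq_sf hp.squarefree hp.one_lt
  have hK := TR_L hd ho 0
  have := hK.nf
  by_contra hne
  have h := cnt2 hK (rd_HN hd ho) (rd_mem _ _) (isInt_rd _) hP hP0 hQ hQ0 hne h1 h2
  rw [dvd_neg, Int.natCast_dvd_natCast] at h
  have a1 := absN_ge hK hP hP0
  have a2 := absN_ge hK hQ hQ0
  rcases (Nat.dvd_prime hp).1 h with h | h
  · nlinarith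
  · rw [← h] at hp
    exact Nat.not_prime_mul (by omega) (by omega) hp

lemma rd_uniq3 {d q₁ q₂ : ℕ} (hd : ¬ IsSquare d) (hp₁ : q₁.Prime) (hp₂ : q₂.Prime) (e : d = q₁ * q₂) (ho : Odd d) 
    {P Q R : Ideal (𝓞 (LL 0 d))} (hP : P.IsPrime) (hP0 : P ≠ ⊥) 
    (hQ : Q.IsPrime) (hQ0 : Q ≠ ⊥) (hR : R.IsPrime) (hR0 : R ≠ ⊥) 
    (h1 : InP P (rd d)) (h2 : InP Q (rd d)) (h3 : InP R (rd d)) : P = Q ∨ P = R ∨ Q = R := by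
  have hK := TR_L hd ho 0
  have := hK.nf
  by_contra! hne
  have h := cnt3 hK (rd_HN hd ho) (rd_mem _ _) (isInt_rd _) hP hP0 hQ hQ0 hR hR0 hne.1 hne.2.1 hne.2.2 h1 h2 h3
  rw [dvd_neg, Int.natCast_dvd_natCast] at h
  have a1 := absN_ge hK hP hP0
  have a2 := absN_ge hK hQ hQ0
  have a3 := absN_ge hK hR hR0
  have b1 : 3 ≤ (Ideal.absNorm P * Ideal.absNorm Q * Ideal.absNorm R).primeFactorsList.length := by
    have hl : ∀ {a b : ℕ}, a ≠ 0 → b ≠ 0 → (a * b).primeFactorsList.length = a.primeFactorsList.length + b.primeFactorsList.length := by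
      intro a b ha hb
      rw [(Nat.perm_primeFactorsList_mul ha hb).length_eq, List.length_append]
    have hg : ∀ {a : ℕ}, 2 ≤ a → 1 ≤ a.primeFactorsList.length := by
      intro a ha
      rw [Nat.one_le_iff_ne_zero, Ne, List.length_eq_zero_iff, Nat.primeFactorsList_eq_nil]
      omega
    rw [hl (by positivity) (by omega), hl (by omega) (by omega)]
    have := hg a1
    have := hg a2
    have := hg a3
    omega
  have b2 := (Nat.primeFactorsList_sublist_of_dvd h (by have := hp₁.pos; have := hp₂.pos; rw [e]; positivity)).length_le
  have b3 : d.primeFactorsList.length = 2 := by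
    rw [e, (Nat.perm_primeFactorsList_mul hp₁.ne_zero hp₂.ne_zero).length_eq, List.length_append,
      Nat.primeFactorsList_prime hp₁, Nat.primeFactorsList_prime hp₂]
    rfl
  omega

lemma ram_base1 {d : ℕ} (hd : ¬ IsSquare d) (h1 : d % 4 = 1) {P : Ideal (𝓞 (LL 0 d))} 
    (h : RamE ⊥ (LL 0 d) (rd d) P) : InP P (rd d) := by
  obtain ⟨k, hk⟩ : ∃ k : ℕ, d = 4 * k + 1 := ⟨d / 4, by omega⟩
  have hω : ((1 + rd d) / 2) ^ 2 = 1 * ((1 + rd d) / 2) + ((k : ℤ) : ℂ) := by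
    have := rd_sq d
    rw [hk] at this
    push_cast at this
    rw [hk]; push_cast
    linear_combination this / 4
  have hi : IsIntegral ℤ ((1 + rd d) / 2) := isInt_quad isIntegral_one (isInt_int _) hω
  have := RamE.inP (qe_base hd) h (u := 1 / 2) (v := 1 / 2) hi (by 
    convert isInt_rd d using 1; ring) (div_mem (one_mem _) (ofNat_mem _ 2)) (div_mem (one_mem _) (ofNat_mem _ 2)) (by ring)
  convert this using 1; ring

lemma base_prime1 {p : ℕ} (hp : p.Prime) (h1 : p % 4 = 1) : Odd (Nat.card (ClassGroup (𝓞 (LL 0 p)))) := by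
  have hd : ¬ IsSquare p := nsq_sf hp.squarefree hp.one_lt
  have ho : Odd p := Nat.odd_iff.2 (by omega)
  refine qe_odd1 (qe_base hd) TR_bot (TR_L hd ho 0) odd_bot ?_
  intro P Q hP hQ
  exact rd_uniq hp ho hP.1 hP.2.1 hQ.1 hQ.2.1 (ram_base1 hd h1 hP) (ram_base1 hd h1 hQ)

/-- `-1` is not a norm when a prime `q ≡ 3 mod 4` divides `d` exactly. -/
lemma neg_one_nn {d q : ℕ} (hq : q.Prime) (hq3 : q % 4 = 3) (hsf : Squarefree d) (hqd : q ∣ d) : 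
    ∀ u ∈ (⊥ : IntermediateField ℚ ℂ), ∀ v ∈ (⊥ : IntermediateField ℚ ℂ), u ^ 2 - rd d ^ 2 * v ^ 2 ≠ -1 := by
  have := Fact.mk hq
  intro u hu v hv e
  obtain ⟨u, rfl⟩ := mem_bot.1 hu
  obtain ⟨v, rfl⟩ := mem_bot.1 hv
  rw [rd_sq] at e
  have e' : u ^ 2 - d * v ^ 2 = -1 := by
    have : ((u ^ 2 - d * v ^ 2 : ℚ) : ℂ) = ((-1 : ℚ) : ℂ) := by push_cast; simpa using e
    exact_mod_cast this
  -- common denominators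
  have e2 : (u.num * v.den) ^ 2 + ((u.den * v.den : ℕ) : ℤ) ^ 2 = d * (v.num * u.den) ^ 2 := by
    have h1 := Rat.num_div_den u
    have h2 := Rat.num_div_den v
    have h3 : (u.den : ℚ) ≠ 0 := by exact_mod_cast u.den_nz
    have h4 : (v.den : ℚ) ≠ 0 := by exact_mod_cast v.den_nz
    rw [← h1, ← h2] at e'
    field_simp at e'
    have : ((u.num * v.den) ^ 2 + ((u.den * v.den : ℕ) : ℚ) ^ 2 : ℚ) = d * (v.num * u.den) ^ 2 := by
      push_cast; linear_combination e'
    exact_mod_cast this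
  have e3 : d * (v.num * u.den).natAbs ^ 2 = (u.num * v.den).natAbs ^ 2 + (u.den * v.den) ^ 2 := by
    zify; rw [sq_abs, sq_abs]; push_cast at e2 ⊢; linarith
  have h0 : (u.den * v.den) ≠ 0 := mul_ne_zero u.den_nz v.den_nz
  have hx0 : (v.num * u.den).natAbs ≠ 0 := by
    intro h
    rw [h] at e3
    have : 0 < (u.den * v.den) ^ 2 := by positivity
    simp at e3
    omega
  have hd0 : d ≠ 0 := hsf.ne_zero
  have := (Nat.eq_sq_add_sq_iff).1 ⟨_, _, e3⟩ (q := q) (by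
    rw [Nat.mem_primeFactors]
    exact ⟨hq, hqd.mul_right _, mul_ne_zero hd0 (pow_ne_zero _ hx0)⟩) hq3
  rw [padicValNat.mul hd0 (pow_ne_zero _ hx0), padicValNat.pow] at this
  have hv1 : padicValNat q d = 1 := by
    rw [← Nat.factorization_def _ hq]
    exact Nat.factorization_eq_one_of_squarefree hsf hq hqd
  rw [hv1] at this
  rcases this with ⟨r, hr⟩
  omega

lemma base_two {d q₁ q₂ : ℕ} (hsf : Squarefree d) (hp₁ : q₁.Prime) (hp₂ : q₂.Prime) (e : d = q₁ * q₂) (h1 : q₁ % 4 = 3) (h2 : q₂ % 4 = 3) : 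
    Odd (Nat.card (ClassGroup (𝓞 (LL 0 d)))) := by
  have hd1 : 1 < d := by rw [e]; nlinarith [hp₁.one_lt, hp₂.one_lt]
  have hd : ¬ IsSquare d := nsq_sf hsf hd1
  have hd4 : d % 4 = 1 := by rw [e, Nat.mul_mod, h1, h2]
  have ho : Odd d := Nat.odd_iff.2 (by omega)
  refine qe_odd2 (qe_base hd) TR_bot (TR_L hd ho 0) odd_bot ?_ (-1) (-1) (neg_mem (one_mem _)) (neg_mem (one_mem _)) 
    isIntegral_one.neg isIntegral_one.neg (by norm_num) (neg_one_nn hp₁ h1 hsf ⟨_, e⟩)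
  intro P Q R hP hQ hR
  exact rd_uniq3 hd hp₁ hp₂ e ho hP.1 hP.2.1 hQ.1 hQ.2.1 hR.1 hR.2.1 (ram_base1 hd hd4 hP) (ram_base1 hd hd4 hQ) (ram_base1 hd hd4 hR)

lemma base_three {q : ℕ} (hq : q.Prime) (h3 : q % 4 = 3) : Odd (Nat.card (ClassGroup (𝓞 (LL 0 q)))) := by
  have hd : ¬ IsSquare q := nsq_sf hq.squarefree hq.one_lt
  have ho : Odd q := Nat.odd_iff.2 (by omega)
  have hK := TR_L hd ho 0
  have := hK.nf
  refine qe_odd2 (qe_base hd) TR_bot hK odd_bot ?_ (-1) (-1) (neg_mem (one_mem _)) (neg_mem (one_mem _)) 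
    isIntegral_one.neg isIntegral_one.neg (by norm_num) (neg_one_nn hq h3 hq.squarefree dvd_rfl)
  have cases : ∀ P : Ideal (𝓞 (LL 0 q)), RamE ⊥ (LL 0 q) (rd q) P → InP P 2 ∨ InP P (rd q) := by
    intro P hP
    have := RamE.inP (qe_base hd) hP (x := rd q) (u := 0) (v := 1) (isInt_rd _) 
      (by simpa using (isInt_nat 2).mul (isInt_rd _)) (zero_mem _) (one_mem _) (by ring)
    rw [one_mul] at this
    exact this.or hP.1 (ofNat_mem _ 2) (isInt_nat 2) (rd_mem _ _) (isInt_rd _)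
  have two : ∀ P Q : Ideal (𝓞 (LL 0 q)), RamE ⊥ (LL 0 q) (rd q) P → RamE ⊥ (LL 0 q) (rd q) Q → 
      InP P 2 → InP Q 2 → P = Q := by
    have hn : HN (LL 0 q) (1 + rd q) (1 - q : ℤ) := by
      convert HN.base hd ho 1 1 using 1
      · push_cast; ring
      · push_cast; ring
    have h2n : HN (LL 0 q) 2 (4 : ℤ) := by
      convert HN.base hd ho 2 0 using 1
      · push_cast; ring
      · push_cast; ring
    have h1m : 1 + rd q ∈ LL 0 q := add_mem (one_mem _) (rd_mem _ _)
    have h1i : IsIntegral ℤ (1 + rd q) := isIntegral_one.add (isInt_rd _)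
    have hin : ∀ P : Ideal (𝓞 (LL 0 q)), P.IsPrime → InP P 2 → InP P (1 + rd q) := by
      intro P hP h
      refine InP.of_sq hP ?_ h1m h1i
      obtain ⟨k, hk⟩ : ∃ k : ℕ, q = 2 * k + 1 := ho
      have a1 := h.mul (w := ((k + 1 : ℕ) : ℂ) + rd q) (add_mem (_root_.natCast_mem _ _) (rd_mem _ _)) ((isInt_nat _).add (isInt_rd _))
      convert a1 using 1
      have := rd_sq q
      have hk' : (q : ℂ) = 2 * k + 1 := by exact_mod_cast hk
      push_cast
      linear_combination this + hk'
    have hev : ∀ P : Ideal (𝓞 (LL 0 q)), RamE ⊥ (LL 0 q) (rd q) P → InP P 2 → 2 ∣ Ideal.absNorm P := by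
      intro P hP h
      have := cnt1 hK h2n (ofNat_mem _ 2) (isInt_nat 2) h
      have h4 : Ideal.absNorm P ∣ 2 ^ 2 := by exact_mod_cast this
      obtain ⟨k, hk, e⟩ := (Nat.dvd_prime_pow Nat.prime_two).1 h4
      have := absN_ne_one hK hP.1
      rw [e]
      rcases Nat.eq_zero_or_pos k with rfl | hk0
      · rw [e] at this; simp at this
      · exact dvd_pow_self 2 (by omega)
    intro P Q hP hQ h1 h2
    by_contra hne
    have := cnt2 hK hn h1m h1i hP.1 hP.2.1 hQ.1 hQ.2.1 hne (hin P hP.1 h1) (hin Q hQ.1 h2)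
    have h4 : 2 * 2 ∣ Ideal.absNorm P * Ideal.absNorm Q := mul_dvd_mul (hev P hP h1) (hev Q hQ h2)
    have h4' : ((2 * 2 : ℕ) : ℤ) ∣ 1 - q := (Int.natCast_dvd_natCast.2 h4).trans this
    omega
  intro P Q R hP hQ hR
  have u := fun {P Q} (hP : RamE ⊥ (LL 0 q) (rd q) P) (hQ : RamE ⊥ (LL 0 q) (rd q) Q) a b => 
    rd_uniq hq ho hP.1 hP.2.1 hQ.1 hQ.2.1 a b
  rcases cases P hP with a | a <;> rcases cases Q hQ with b | b <;> rcases cases R hR with c | c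
  · exact Or.inl (two P Q hP hQ a b)
  · exact Or.inl (two P Q hP hQ a b)
  · exact Or.inr (Or.inl (two P R hP hR a c))
  · exact Or.inr (Or.inr (u hQ hR b c))
  · exact Or.inr (Or.inr (two Q R hQ hR b c))
  · exact Or.inr (Or.inl (u hP hR a c))
  · exact Or.inl (u hP hQ a b)
  · exact Or.inl (u hP hQ a b)

end Part11

section Part12
open NumberField IntermediateField
open scoped NumberTheorySymbols

lemma desc_norm {d : ℕ} (hd : ¬ IsSquare d) (ho : Odd d) {ε : ℂ} (hε : ε ∈ LL 0 d) (m : ℕ) : 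
    ((∃ x ∈ LL m d, ∃ y ∈ LL m d, 2 + cc m = x ^ 2 - ε * y ^ 2) ∨ 
      (∃ x ∈ LL m d, ∃ y ∈ LL m d, 2 - cc m = x ^ 2 - ε * y ^ 2)) → 
    ∃ x ∈ LL 0 d, ∃ y ∈ LL 0 d, 2 = x ^ 2 - ε * y ^ 2 := by
  induction m with
  | zero => 
    rw [cc_zero, add_zero, sub_zero, or_self]; exact id
  | succ m ih => 
    intro h
    apply ih
    right
    have hq := qe_tower (ns_two hd ho) m
    obtain ⟨σ, s1, s2, s3, s4, s5, s6, s7⟩ := hq.conj_fun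
    have hεm : ε ∈ LL m d := LL_mono (Nat.zero_le m) d hε
    have key : ∀ x ∈ LL (m + 1) d, ∀ y ∈ LL (m + 1) d, ∀ t ∈ LL m d, (2 + t * cc (m + 1) = x ^ 2 - ε * y ^ 2) → t ^ 2 = 1 → 
        ∃ x ∈ LL m d, ∃ y ∈ LL m d, 2 - cc m = x ^ 2 - ε * y ^ 2 := by
      intro x hx y hy t ht e ht2
      have hεm' := hq.le hεm
      have ht' := hq.le ht
      have hc := cc_mem (m + 1) d
      have e' : x ^ 2 = 2 + t * cc (m + 1) + ε * (y * y) := by linear_combination -e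
      have e2 := congrArg σ e'
      rw [pow_two, s3 x hx x hx, s2 _ (add_mem (ofNat_mem _ 2) (mul_mem ht' hc)) _ (mul_mem hεm' (mul_mem hy hy)),
        s2 _ (ofNat_mem _ 2) _ (mul_mem ht' hc), s3 _ ht' _ hc, s3 _ hεm' _ (mul_mem hy hy), s3 _ hy _ hy,
        s4 _ (ofNat_mem _ 2), s4 _ ht, s4 _ hεm, s5] at e2
      refine ⟨x * σ x + ε * (y * σ y), add_mem (s6 x hx) (mul_mem hεm (s6 y hy)), x * σ y + y * σ x, ?_, ?_⟩
      · have : x * σ y + y * σ x = (x + y) * σ (x + y) - x * σ x - y * σ y := by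
          rw [s2 x hx y hy]; ring
        rw [this]
        exact sub_mem (sub_mem (s6 _ (add_mem hx hy)) (s6 _ hx)) (s6 _ hy)
      · have e3 : (2 - cc m : ℂ) = (2 + t * cc (m + 1)) * (2 - t * cc (m + 1)) := by
          linear_combination cc_sq m + cc (m + 1) ^ 2 * ht2
        have e4 : (2 - t * cc (m + 1)) = σ x * σ x - ε * (σ y * σ y) := by linear_combination -e2
        rw [e3, e4, e]; ring
    rcases h with ⟨x, hx, y, hy, e⟩ | ⟨x, hx, y, hy, e⟩
    · exact key x hx y hy 1 (one_mem _) (by rw [← e]; ring) (by norm_num)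
    · exact key x hx y hy (-1) (neg_mem (one_mem _)) (by rw [← e]; ring) (by norm_num)

lemma hnn_of {d : ℕ} (hd : ¬ IsSquare d) (ho : Odd d) {ε : ℂ} (hε : ε ∈ LL 0 d) (hε0 : ε ≠ 0) 
    (h : ∀ x ∈ LL 0 d, ∀ y ∈ LL 0 d, 2 ≠ x ^ 2 - ε * y ^ 2) (m : ℕ) : 
    ∀ u ∈ LL m d, ∀ v ∈ LL m d, u ^ 2 - cc (m + 1) ^ 2 * v ^ 2 ≠ ε := by
  intro u hu v hv e
  obtain ⟨x, hx, y, hy, e'⟩ := desc_norm hd ho hε m (by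
    left
    rw [cc_sq] at e
    by_cases hv0 : v = 0
    · rw [hv0] at e
      have hu0 : u ≠ 0 := by
        rintro rfl
        apply hε0
        rw [← e]; ring
      have hcm := cc_mem m d
      refine ⟨(2 + cc m + 1) / 2, div_mem (add_mem (add_mem (ofNat_mem _ 2) hcm) (one_mem _)) (ofNat_mem _ 2), 
        (2 + cc m - 1) / (2 * u), div_mem (sub_mem (add_mem (ofNat_mem _ 2) hcm) (one_mem _)) (mul_mem (ofNat_mem _ 2) hu), ?_⟩
      rw [← e]
      field_simp
      ring
    · refine ⟨u / v, div_mem hu hv, 1 / v, div_mem (one_mem _) hv, ?_⟩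
      rw [← e]
      field_simp
      ring)
  exact h x hx y hy e'

lemma sqrt2adic {d : ℕ} (h : d % 8 = 1) : ∃ s : ℤ_[2], s ^ 2 = d := by
  have := hensels_lemma (p := 2) (R := ℤ_[2]) (F := Polynomial.X ^ 2 - Polynomial.C (d : ℤ_[2])) (a := 1) ?_
  · obtain ⟨z, hz, -⟩ := this
    refine ⟨z, ?_⟩
    simp at hz
    linear_combination hz
  · have e1 : (Polynomial.aeval (1 : ℤ_[2])) (Polynomial.X ^ 2 - Polynomial.C (d : ℤ_[2])) = ((1 - d : ℤ) : ℤ_[2]) := by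
      simp
    have e2 : (Polynomial.aeval (1 : ℤ_[2])) (Polynomial.derivative (Polynomial.X ^ 2 - Polynomial.C (d : ℤ_[2]))) = ((2 : ℕ) : ℤ_[2]) := by
      simp; norm_num
    rw [e1, e2, PadicInt.norm_p]
    have : ‖((1 - d : ℤ) : ℤ_[2])‖ ≤ (2 : ℝ) ^ (-(3 : ℕ) : ℤ) := by
      have := (PadicInt.norm_int_le_pow_iff_dvd (p := 2) (k := (1 - d : ℤ)) (n := 3)).2 (by norm_num; omega)
      exact_mod_cast this
    refine lt_of_le_of_lt this ?_
    norm_num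

lemma zm16a : ∀ x : ZMod 16, x ^ 2 ∈ ([0, 1, 4, 9] : List (ZMod 16)) := by decide
lemma zm16b : ∀ x : ZMod 16, x ^ 2 ∈ ([0, 4] : List (ZMod 16)) → 8 * x = 0 := by decide
set_option maxRecDepth 4000 in
lemma zm16c : ∀ u ∈ ([3, 5, 11, 13] : List (ZMod 16)), ∀ X ∈ ([0, 1, 4, 9] : List (ZMod 16)), 
    ∀ Y ∈ ([0, 1, 4, 9] : List (ZMod 16)), ∀ E ∈ ([0, 1, 4, 9] : List (ZMod 16)), X - u * Y = 2 * E → 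
    X ∈ ([0, 4] : List (ZMod 16)) ∧ Y ∈ ([0, 4] : List (ZMod 16)) ∧ E ∈ ([0, 4] : List (ZMod 16)) := by decide

lemma half2 {x : ℤ_[2]} (h : 8 * PadicInt.toZModPow (p := 2) 4 x = 0) : ∃ y, x = 2 * y := by
  have h1 : PadicInt.toZModPow (p := 2) 4 (8 * x) = 0 := by 
    rw [map_mul, map_ofNat]; exact h
  rw [← RingHom.mem_ker, PadicInt.ker_toZModPow, Ideal.mem_span_singleton] at h1
  obtain ⟨y, hy⟩ := h1
  refine ⟨y, ?_⟩
  have h8 : (8 : ℤ_[2]) ≠ 0 := by norm_num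
  apply mul_left_cancel₀ h8
  rw [hy]; push_cast; ring

lemma no_rep {u : ℤ_[2]} (hu : PadicInt.toZModPow (p := 2) 4 u ∈ ([3, 5, 11, 13] : List (ZMod 16))) (D : ℕ) : 
    0 < D → ∀ X Y : ℤ_[2], X ^ 2 - u * Y ^ 2 ≠ 2 * D ^ 2 := by
  induction D using Nat.strong_induction_on with
  | _ D ih => 
    intro hD X Y e
    have e1 := congrArg (PadicInt.toZModPow (p := 2) 4) e
    rw [map_sub, map_mul, map_mul, map_pow, map_pow, map_pow, map_ofNat, map_natCast] at e1
    obtain ⟨hX, hY, hE⟩ := zm16c _ hu _ (zm16a _) _ (zm16a _) _ (zm16a _) e1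
    obtain ⟨x, rfl⟩ := half2 (zm16b _ hX)
    obtain ⟨y, rfl⟩ := half2 (zm16b _ hY)
    have hd := zm16b _ hE
    have hd2 : ((8 * D : ℕ) : ZMod 16) = 0 := by push_cast; exact hd
    rw [ZMod.natCast_eq_zero_iff] at hd2
    obtain ⟨c, rfl⟩ : 2 ∣ D := by omega
    refine ih c (by omega) (by omega) x y ?_
    have h4 : (4 : ℤ_[2]) ≠ 0 := by norm_num
    apply mul_left_cancel₀ h4
    push_cast at e
    linear_combination e

lemma no_two {d : ℕ} (hd : ¬ IsSquare d) (h8 : d % 8 = 1) {T U : ℤ} 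
    (hTU : ∀ s : ZMod 16, s ^ 2 = d → (T + U * s : ZMod 16) ∈ ([3, 5, 11, 13] : List (ZMod 16))) : 
    ∀ x ∈ LL 0 d, ∀ y ∈ LL 0 d, 2 ≠ x ^ 2 - (T + U * rd d) * y ^ 2 := by
  intro x hx y hy e
  have hq := qe_base hd
  obtain ⟨a, ha, b, hb, rfl⟩ := hq.span x hx
  obtain ⟨a', ha', b', hb', rfl⟩ := hq.span y hy
  obtain ⟨a, rfl⟩ := mem_bot.1 ha
  obtain ⟨b, rfl⟩ := mem_bot.1 hb
  obtain ⟨a', rfl⟩ := mem_bot.1 ha'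
  obtain ⟨b', rfl⟩ := mem_bot.1 hb'
  simp only [eq_ratCast] at e
  have hr := rd_sq d
  have h3 := hq.uniq (u := ((2 : ℚ) : ℂ)) (v := ((0 : ℚ) : ℂ)) 
    (u' := ((a ^ 2 + d * b ^ 2 - (T * (a' ^ 2 + d * b' ^ 2) + 2 * U * d * a' * b') : ℚ) : ℂ))
    (v' := ((2 * a * b - (U * (a' ^ 2 + d * b' ^ 2) + 2 * T * a' * b') : ℚ) : ℂ))
    (SubfieldClass.ratCast_mem _ _) (SubfieldClass.ratCast_mem _ _) (SubfieldClass.ratCast_mem _ _) (SubfieldClass.ratCast_mem _ _) 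
    (by push_cast; linear_combination e + (b ^ 2 - T * b' ^ 2 - 2 * U * a' * b' - U * b' ^ 2 * rd d) * hr)
  obtain ⟨h3, h4⟩ := h3
  have h3 : 2 = a ^ 2 + d * b ^ 2 - (T * (a' ^ 2 + d * b' ^ 2) + 2 * U * d * a' * b') := by exact_mod_cast h3
  have h4 : 0 = 2 * a * b - (U * (a' ^ 2 + d * b' ^ 2) + 2 * T * a' * b') := by exact_mod_cast h4
  obtain ⟨s, hs⟩ := sqrt2adic h8
  have hs' : (s : ℚ_[2]) ^ 2 = d := by exact_mod_cast congrArg (Subtype.val : ℤ_[2] → ℚ_[2]) hs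
  have h3' : (2 : ℚ_[2]) = a ^ 2 + d * b ^ 2 - (T * (a' ^ 2 + d * b' ^ 2) + 2 * U * d * a' * b') := by exact_mod_cast congrArg (fun q : ℚ => (q : ℚ_[2])) h3
  have h4' : (0 : ℚ_[2]) = 2 * a * b - (U * (a' ^ 2 + d * b' ^ 2) + 2 * T * a' * b') := by exact_mod_cast congrArg (fun q : ℚ => (q : ℚ_[2])) h4
  have e5 : ((a : ℚ_[2]) + b * s) ^ 2 - (T + U * s) * (a' + b' * s) ^ 2 = 2 := by
    linear_combination -h3' - s * h4' + (b ^ 2 - T * b' ^ 2 - 2 * U * a' * b' - U * b' ^ 2 * s) * hs'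
  have hu : PadicInt.toZModPow (p := 2) 4 (T + U * s) ∈ ([3, 5, 11, 13] : List (ZMod 16)) := by
    rw [map_add, map_mul, map_intCast, map_intCast]
    apply hTU
    have := congrArg (PadicInt.toZModPow (p := 2) 4) hs
    rw [map_pow, map_natCast] at this
    exact this
  have hden : ∀ q : ℚ, (q : ℚ_[2]) * q.den = q.num := by
    intro q
    exact_mod_cast congrArg (fun q : ℚ => (q : ℚ_[2])) (Rat.mul_den_eq_num q)
  refine no_rep hu (a.den * b.den * a'.den * b'.den) (by have := a.pos; have := b.pos; have := a'.pos; have := b'.pos; positivity)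
    (a.num * b.den * a'.den * b'.den + b.num * a.den * a'.den * b'.den * s) 
    (a'.num * b.den * a.den * b'.den + b'.num * a.den * a'.den * b.den * s) ?_
  apply Subtype.ext
  push_cast
  have h22 : ((2 : ℤ_[2]) : ℚ_[2]) = 2 := rfl
  rw [h22, ← hden a, ← hden b, ← hden a', ← hden b']
  linear_combination (a.den * b.den * a'.den * b'.den : ℚ_[2]) ^ 2 * e5

theorem odd_of_unit {d : ℕ} (hd : ¬ IsSquare d) (h8 : d % 8 = 1) (h0 : Odd (Nat.card (ClassGroup (𝓞 (LL 0 d))))) {T U κ : ℤ} 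
    (hn : T ^ 2 - d * U ^ 2 = κ) (hκ : κ ^ 2 = 1)
    (hTU : ∀ s : ZMod 16, s ^ 2 = d → (T + U * s : ZMod 16) ∈ ([3, 5, 11, 13] : List (ZMod 16))) (n : ℕ) : 
    Odd (Nat.card (ClassGroup (𝓞 (LL n d)))) := by
  have ho : Odd d := Nat.odd_iff.2 (by omega)
  have hn' : (T : ℂ) ^ 2 - d * U ^ 2 = κ := by exact_mod_cast congrArg (fun q : ℤ => (q : ℂ)) hn
  have hκ' : (κ : ℂ) ^ 2 = 1 := by exact_mod_cast congrArg (fun q : ℤ => (q : ℂ)) hκ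
  have hm : ∀ k, (T + U * rd d) ∈ LL k d := fun k => add_mem (intCast_mem _ _) (mul_mem (intCast_mem _ _) (rd_mem _ _))
  have hm' : ∀ k, κ * (T - U * rd d) ∈ LL k d := 
    fun k => mul_mem (intCast_mem _ _) (sub_mem (intCast_mem _ _) (mul_mem (intCast_mem _ _) (rd_mem _ _)))
  have hee : (T + U * rd d) * (κ * (T - U * rd d)) = 1 := by
    linear_combination hκ' + κ * hn' - κ * U ^ 2 * rd_sq d
  have hne : (T + U * rd d) ≠ 0 := by
    intro h; rw [h, zero_mul] at hee; exact zero_ne_one hee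
  induction n with
  | zero => exact h0
  | succ m ih => 
    have hK := TR_L hd ho (m + 1)
    have := hK.nf
    refine qe_odd2 (qe_tower (ns_two hd ho) m) (TR_L hd ho m) hK ih ?_ (T + U * rd d) (κ * (T - U * rd d)) (hm m) (hm' m)
      ((isInt_int _).add ((isInt_int _).mul (isInt_rd _))) ((isInt_int _).mul ((isInt_int _).sub ((isInt_int _).mul (isInt_rd _)))) hee 
      (hnn_of hd ho (hm 0) hne (no_two hd h8 hTU) m)
    intro P Q R hP hQ hR
    by_contra! hne
    have h4 : HN (LL (m + 1) d) (cc (m + 1)) (4 : ℤ) := by exact_mod_cast (HN.cc hd ho m).2.2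
    have h := cnt3 hK h4 (cc_mem _ _) (isInt_cc _) hP.1 hP.2.1 hQ.1 hQ.2.1 hR.1 hR.2.1 hne.1 hne.2.1 hne.2.2 
      (ram_two hd ho hP).1 (ram_two hd ho hQ).1 (ram_two hd ho hR).1
    have a1 := absN_ge hK hP.1 hP.2.1
    have a2 := absN_ge hK hQ.1 hQ.2.1
    have a3 := absN_ge hK hR.1 hR.2.1
    have := Int.le_of_dvd (by norm_num) h
    have : Ideal.absNorm P * Ideal.absNorm Q * Ideal.absNorm R ≤ 4 := by exact_mod_cast this
    have b1 := Nat.mul_le_mul (Nat.mul_le_mul a1 a2) a3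
    omega

end Part12

section Part13
open NumberField IntermediateField
open scoped NumberTheorySymbols

lemma sq_of_cop {a b c : ℕ} (h : Nat.Coprime a b) (e : a * b = c ^ 2) : ∃ r, a = r ^ 2 := by
  have hu : IsUnit (GCDMonoid.gcd a b) := by rw [Nat.isUnit_iff]; exact h
  exact exists_eq_pow_of_mul_eq_pow hu e

lemma lin_mod (a x c m : ℕ) : (a * x ^ 2 + c) % m = ((a % m) * (x % m) ^ 2 + c) % m := by
  have h1 : a % m ≡ a [MOD m] := Nat.mod_modEq _ _
  have h2 : x % m ≡ x [MOD m] := Nat.mod_modEq _ _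
  exact (((h1.mul (h2.pow 2)).add_right c).symm)

lemma pell_split {d : ℕ} (hsf : Squarefree d) (h1 : 1 < d) (h4 : d % 4 = 1) : 
    ∃ α β r t : ℕ, α * β = d ∧ β * t ^ 2 = α * r ^ 2 + 1 ∧ β ≠ 1 := by
  classical
  have hns := nsq_sf hsf h1
  have hns' : ¬ IsSquare (d : ℤ) := by rwa [Int.isSquare_natCast_iff]
  have hex : ∃ X : ℕ, ∃ Y : ℕ, X ^ 2 = d * Y ^ 2 + 1 ∧ Y ≠ 0 := by
    obtain ⟨x, y, h, hy⟩ := Pell.exists_of_not_isSquare (d := (d : ℤ)) (by omega) hns'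
    refine ⟨x.natAbs, y.natAbs, ?_, by simpa using hy⟩
    zify
    rw [sq_abs, sq_abs]; linarith
  obtain ⟨Y, hXY, hY⟩ := Nat.find_spec hex
  have hmin := fun m => Nat.find_min' hex (m := m)
  set X := Nat.find hex with hX
  clear_value X
  have hX1 : 1 < X := by
    have : 0 < d * Y ^ 2 := by positivity
    nlinarith
  have par : X % 2 = 1 ∧ Y % 2 = 0 := by
    have h5 : (1 * X ^ 2 + 0) % 4 = (d * Y ^ 2 + 1) % 4 := by rw [← hXY]; simp
    rw [lin_mod 1, lin_mod d, h4] at h5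
    have a : X % 4 = 0 ∨ X % 4 = 1 ∨ X % 4 = 2 ∨ X % 4 = 3 := by omega
    have b : Y % 4 = 0 ∨ Y % 4 = 1 ∨ Y % 4 = 2 ∨ Y % 4 = 3 := by omega
    rcases a with a | a | a | a <;> rcases b with b | b | b | b <;> simp [a, b] at h5 <;> omega
  obtain ⟨A, rfl⟩ : ∃ A, X = 2 * A + 1 := ⟨X / 2, by omega⟩
  obtain ⟨y, rfl⟩ : ∃ y, Y = 2 * y := ⟨Y / 2, by omega⟩
  have hAB : A * (A + 1) = d * y ^ 2 := by nlinarith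
  have hcop : Nat.Coprime A (A + 1) := by simp
  have hd0 : 0 < d := by omega
  have hg0 : 0 < Nat.gcd A d := Nat.gcd_pos_of_pos_right _ hd0
  obtain ⟨A', hA'⟩ := Nat.gcd_dvd_left A d
  obtain ⟨β, hβ⟩ := Nat.gcd_dvd_right A d
  have hcAβ : Nat.Coprime (Nat.gcd A d) β := Nat.coprime_of_squarefree_mul (hβ ▸ hsf)
  have hcAβ' : Nat.Coprime A β := by
    have h6 : Nat.gcd A β ∣ Nat.gcd A d := Nat.dvd_gcd (Nat.gcd_dvd_left _ _) 
      ((Nat.gcd_dvd_right _ _).trans ⟨_, by rw [mul_comm]; exact hβ⟩)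
    have h7 := Nat.dvd_gcd h6 (Nat.gcd_dvd_right A β)
    rw [hcAβ] at h7
    exact Nat.dvd_one.1 h7
  have hβB : β ∣ A + 1 := by
    refine hcAβ'.symm.dvd_of_dvd_mul_left (m := A) ?_
    rw [hAB]
    exact Dvd.dvd.mul_right ⟨_, by rw [mul_comm]; exact hβ⟩ _
  obtain ⟨B', hB'⟩ := hβB
  set α := Nat.gcd A d with hα
  clear_value α
  have hprod : A' * B' = y ^ 2 := by
    have : d * (A' * B') = d * y ^ 2 := by
      rw [← hAB, hB']
      calc d * (A' * B') = (α * A') * (β * B') := by rw [hβ]; ring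
        _ = A * (β * B') := by rw [← hA']
    exact Nat.eq_of_mul_eq_mul_left hd0 this
  have hc' : Nat.Coprime A' B' := by
    have := hcop
    rw [hB'] at this
    exact (this.coprime_dvd_left ⟨α, by rw [mul_comm]; exact hA'⟩).coprime_dvd_right ⟨β, by rw [mul_comm]⟩
  obtain ⟨r, hr⟩ := sq_of_cop hc' hprod
  obtain ⟨t, ht⟩ := sq_of_cop hc'.symm (by rw [mul_comm]; exact hprod)
  refine ⟨α, β, r, t, hβ.symm, ?_, ?_⟩
  · rw [← ht, ← hB', ← hr, ← hA']
  · intro hb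
    rw [hb, one_mul] at hB'
    rw [hb, mul_one] at hβ
    have h8 := hmin t ⟨r, by rw [← ht, ← hB', ← hr, hβ, ← hA'], by
      rintro rfl
      rw [hr] at hA'
      simp at hA'
      omega⟩
    have ht' : t ^ 2 = A + 1 := by rw [← ht, ← hB']
    nlinarith

lemma hTU_A (d : ℕ) (T U : ℤ) (h8 : d % 8 = 1) (hT : T % 8 = 4) (h : T ^ 2 - d * U ^ 2 = -1) : 
    ∀ s : ZMod 16, s ^ 2 = d → (T + U * s : ZMod 16) ∈ ([3, 5, 11, 13] : List (ZMod 16)) := by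
  intro s hs
  have hT' : (T : ZMod 16) = 4 ∨ (T : ZMod 16) = 12 := by
    have : T % 16 = 4 ∨ T % 16 = 12 := by omega
    rcases this with h | h
    · left
      have := (ZMod.intCast_eq_intCast_iff' T 4 16).2 (by omega)
      simpa using this
    · right
      have := (ZMod.intCast_eq_intCast_iff' T 12 16).2 (by omega)
      simpa using this
  have h2 := congrArg (fun q : ℤ => (q : ZMod 16)) h
  push_cast at h2
  rw [← hs, ← mul_pow, mul_comm s] at h2
  generalize (U : ZMod 16) * s = w at *
  generalize (T : ZMod 16) = T' at *
  rcases hT' with rfl | rfl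
  · revert h2; revert w; decide
  · revert h2; revert w; decide

lemma hTU_B (d : ℕ) (T U : ℤ) (h8 : d % 8 = 1) (hT : T % 16 = 7) (hU : U % 8 = 4) : 
    ∀ s : ZMod 16, s ^ 2 = d → (T + U * s : ZMod 16) ∈ ([3, 5, 11, 13] : List (ZMod 16)) := by
  intro s hs
  have hT' : (T : ZMod 16) = 7 := by
    have := (ZMod.intCast_eq_intCast_iff' T 7 16).2 (by omega)
    simpa using this
  have hU' : (U : ZMod 16) = 4 ∨ (U : ZMod 16) = 12 := by
    have : U % 16 = 4 ∨ U % 16 = 12 := by omega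
    rcases this with h | h
    · left
      have := (ZMod.intCast_eq_intCast_iff' U 4 16).2 (by omega)
      simpa using this
    · right
      have := (ZMod.intCast_eq_intCast_iff' U 12 16).2 (by omega)
      simpa using this
  have hd' : (d : ZMod 16) = 1 ∨ (d : ZMod 16) = 9 := by
    have : d % 16 = 1 ∨ d % 16 = 9 := by omega
    rcases this with h | h
    · left
      have := (ZMod.natCast_eq_natCast_iff' d 1 16).2 (by omega)
      simpa using this
    · right
      have := (ZMod.natCast_eq_natCast_iff' d 9 16).2 (by omega)
      simpa using this
  rw [hT']
  rcases hd' with h | h <;> rcases hU' with h' | h' <;> rw [h] at hs <;> rw [h'] <;> revert hs <;> revert s <;> decide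

theorem odd_four {p : ℕ} (hp : p.Prime) (h8 : p % 8 = 1) (hx : Xor' (∃ x : ZMod p, x ^ 4 = 2) (p % 16 = 1)) (n : ℕ) : 
    Odd (Nat.card (ClassGroup (𝓞 (LL n p)))) := by
  have := Fact.mk hp
  have hns := nsq_sf hp.squarefree hp.one_lt
  obtain ⟨α, β, r, t, e, h, hb⟩ := pell_split hp.squarefree hp.one_lt (by omega)
  have hα : α = 1 := by
    rcases (Nat.dvd_prime hp).1 ⟨β, e.symm⟩ with h | h
    · exact h
    · exfalso
      apply hb
      rw [h] at e
      have := hp.pos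
      nlinarith
  subst hα
  rw [one_mul] at e
  subst e
  rename' β => p
  rw [one_mul] at h
  have ho := sq_mod (a := r)
  have ho' := sq_mod (a := t)
  have hr4 : r % 4 = 0 ∧ t % 2 = 1 := by
    have h5 : (p * t ^ 2 + 0) % 8 = (1 * r ^ 2 + 1) % 8 := by rw [h]; simp
    rw [lin_mod p, lin_mod 1, h8] at h5
    have a : r % 8 = 0 ∨ r % 8 = 1 ∨ r % 8 = 2 ∨ r % 8 = 3 ∨ r % 8 = 4 ∨ r % 8 = 5 ∨ r % 8 = 6 ∨ r % 8 = 7 := by omega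
    have b : t % 8 = 0 ∨ t % 8 = 1 ∨ t % 8 = 2 ∨ t % 8 = 3 ∨ t % 8 = 4 ∨ t % 8 = 5 ∨ t % 8 = 6 ∨ t % 8 = 7 := by omega
    rcases a with a | a | a | a | a | a | a | a <;> rcases b with b | b | b | b | b | b | b | b <;> simp [a, b] at h5 <;> omega
  have hr8 : r % 8 = 4 := by
    by_contra hne
    have hr0 : r % 8 = 0 := by omega
    have hodd : Odd (r + 1) := Nat.odd_iff.2 (by omega)
    have j1 : J(((r + 1 : ℕ) : ℤ) | p) = 1 := by
      rw [← jacobiSym.quadratic_reciprocity_one_mod_four (a := p) (by omega) hodd]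
      have j2 : J((p : ℤ) * (t : ℤ) ^ 2 | r + 1) = J(2 | r + 1) := by
        apply jacobiSym.mod_left'
        have : (p : ℤ) * t ^ 2 = 2 + (r + 1 : ℕ) * (r - 1) := by
          have : ((p * t ^ 2 : ℕ) : ℤ) = ((r ^ 2 + 1 : ℕ) : ℤ) := by rw [h]
          push_cast at this ⊢
          linarith
        rw [this, Int.add_mul_emod_self_left]
      have hc : Nat.Coprime t (r + 1) := by
        have h2 : Nat.gcd t (r + 1) ∣ 2 := by
          have a1 : Nat.gcd t (r + 1) ∣ r ^ 2 + 1 := by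
            rw [← h]
            exact ((Nat.gcd_dvd_left _ _).trans (dvd_pow_self t (by norm_num))).mul_left _
          have a2 : Nat.gcd t (r + 1) ∣ (r + 1) * (r + 1) := (Nat.gcd_dvd_right _ _).mul_left _
          have a3 : Nat.gcd t (r + 1) ∣ 2 * (r + 1) := (Nat.gcd_dvd_right _ _).mul_left _
          have a4 : 2 * (r + 1) + (r ^ 2 + 1) = (r + 1) * (r + 1) + 2 := by ring
          have a5 := a3.add a1
          rw [a4] at a5
          exact (Nat.dvd_add_right a2).1 a5
        rcases (Nat.dvd_prime Nat.prime_two).1 h2 with h3 | h3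
        · exact h3
        · exfalso
          have : 2 ∣ r + 1 := h3 ▸ Nat.gcd_dvd_right _ _
          omega
      rw [jacobiSym.mul_left, jacobiSym.sq_one' (by rw [Int.gcd_natCast_natCast]; exact hc), mul_one, jacobiSym.at_two hodd, 
        ZMod.χ₈_nat_eq_if_mod_eight, if_neg (by omega), if_pos (by omega)] at j2
      exact j2
    rw [← jacobiSym.legendreSym.to_jacobiSym] at j1
    have nz : (((r + 1 : ℕ) : ℤ) : ZMod p) ≠ 0 := by
      intro h0
      rw [(legendreSym.eq_zero_iff p _).2 h0] at j1
      exact zero_ne_one j1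
    have hsq := (legendreSym.eq_one_iff p nz).1 j1
    push_cast at hsq nz
    have hT : (r : ZMod p) ^ 2 = -1 := by
      have := congrArg (fun q : ℕ => (q : ZMod p)) h
      push_cast at this
      rw [ZMod.natCast_self, zero_mul] at this
      linear_combination -this
    have hp2 : p ≠ 2 := by rintro rfl; omega
    obtain ⟨c, hc⟩ := (ZMod.exists_sq_eq_two_iff (p := p) hp2).2 (Or.inl h8)
    have hc : c ^ 2 = 2 := by rw [hc]; ring
    have h20 : (2 : ZMod p) ≠ 0 := by
      intro h0
      have : ((2 : ℕ) : ZMod p) = 0 := by exact_mod_cast h0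
      rw [ZMod.natCast_eq_zero_iff] at this
      exact hp2 ((Nat.prime_dvd_prime_iff_eq hp Nat.prime_two).1 this)
    have hc0 : c ≠ 0 := by rintro rfl; apply h20; rw [← hc]; ring
    have hr0' : (r : ZMod p) ≠ 0 := by
      intro h0; rw [h0] at hT
      have : (1 : ZMod p) = 0 := by linear_combination hT
      exact one_ne_zero this
    obtain ⟨k, hk⟩ : ∃ k, p = 8 * k + 1 := ⟨p / 8, by omega⟩
    have hp2' : p / 2 = 4 * k := by omega
    obtain ⟨w, hw⟩ : IsSquare (r : ZMod p) := by
      rw [ZMod.euler_criterion p hr0', hp2', show 4 * k = 2 * (2 * k) by ring, pow_mul, hT, pow_mul]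
      simp
    have hw4 : w ^ 4 = -1 := by rw [← hT, hw]; ring
    have hw0 : w ≠ 0 := by rintro rfl; apply hr0'; rw [hw]; ring
    have hne1 : (-1 : ZMod p) ≠ 1 := by
      intro h1; apply h20; linear_combination -h1
    have hws : IsSquare w ↔ p % 16 = 1 := by
      rw [ZMod.euler_criterion p hw0, hp2', pow_mul, hw4]
      rcases Nat.even_or_odd k with hev | hod
      · rw [hev.neg_one_pow]
        have := Nat.even_iff.1 hev
        simp only [true_iff]; omega
      · rw [hod.neg_one_pow]
        have := Nat.odd_iff.1 hod
        constructor
        · intro h; exact absurd h hne1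
        · intro h; omega
    have hneg : IsSquare (-1 : ZMod p) := ⟨r, by rw [← hT]; ring⟩
    have hcw : IsSquare (c * w) := by
      have : ((r : ZMod p) + 1) ^ 2 = (c * w) ^ 2 := by
        rw [mul_pow, hc, pow_two w, ← hw]
        linear_combination hT
      rcases sq_eq_sq_iff_eq_or_eq_neg.1 this with h | h
      · rwa [← h]
      · have h' : c * w = -1 * ((r : ZMod p) + 1) := by rw [h]; ring
        rw [h']
        exact hneg.mul hsq
    have hcs := fourth_iff (p := p) (by omega) hc
    unfold Xor' Xor at hx
    rw [hcs, ← hws] at hx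
    rcases hx with ⟨a, b⟩ | ⟨a, b⟩
    · apply b
      have := hcw.div a
      rwa [mul_div_cancel_left₀ _ hc0] at this
    · apply b
      have := hcw.div a
      rwa [mul_div_cancel_right₀ _ hw0] at this
  have hn : (r : ℤ) ^ 2 - p * (t : ℤ) ^ 2 = -1 := by
    have : ((p * t ^ 2 : ℕ) : ℤ) = ((r ^ 2 + 1 : ℕ) : ℤ) := by rw [h]
    push_cast at this
    linarith
  exact odd_of_unit hns h8 (base_prime1 hp (by omega)) hn (by norm_num) (hTU_A p r t h8 (by omega) hn) n

theorem odd_case_one {d q₁ q₂ : ℕ} (hsf : Squarefree d) (hp₁ : q₁.Prime) (hp₂ : q₂.Prime) (e : d = q₁ * q₂) 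
    (h1 : q₁ % 8 = 3) (h2 : q₂ % 8 = 3) (n : ℕ) : 
    Odd (Nat.card (ClassGroup (𝓞 (LL n d)))) := by
  have := Fact.mk hp₁
  have hd1 : 1 < d := by rw [e]; nlinarith [hp₁.one_lt, hp₂.one_lt]
  have hns := nsq_sf hsf hd1
  have hd8 : d % 8 = 1 := by rw [e, Nat.mul_mod, h1, h2]
  obtain ⟨α, β, r, t, e2, h, hb⟩ := pell_split hsf hd1 (by omega)
  have hα1 : α ≠ 1 := by
    rintro rfl
    rw [one_mul] at e2
    rw [e2, one_mul] at h
    have h5 := congrArg (fun q : ℕ => (q : ZMod q₁)) h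
    rw [e] at h5
    push_cast at h5
    rw [ZMod.natCast_self, zero_mul, zero_mul] at h5
    have := ZMod.mod_four_ne_three_of_sq_eq_neg_one (p := q₁) (y := r) (by linear_combination -h5)
    omega
  have hαβ : α % 8 = 3 ∧ β % 8 = 3 := by
    have h6 : α ∣ q₁ * q₂ := ⟨β, by rw [← e, e2]⟩
    have hp0 := hp₁.pos
    have hp0' := hp₂.pos
    rw [e] at e2
    by_cases hq : q₁ ∣ α
    · obtain ⟨a, rfl⟩ := hq
      have e3 : a * β = q₂ := by
        apply Nat.eq_of_mul_eq_mul_left hp0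
        rw [← e2]; ring
      rcases (Nat.dvd_prime hp₂).1 ⟨β, e3.symm⟩ with h | h
      · subst h
        rw [one_mul] at e3
        rw [mul_one, e3]; exact ⟨h1, h2⟩
      · exfalso
        apply hb
        rw [h] at e3
        apply Nat.eq_of_mul_eq_mul_left hp0'
        rw [e3, mul_one]
    · have h7 : α ∣ q₂ := ((Nat.Prime.coprime_iff_not_dvd hp₁).2 hq).symm.dvd_of_dvd_mul_left h6
      rcases (Nat.dvd_prime hp₂).1 h7 with h | h
      · exact absurd h hα1
      · subst h
        refine ⟨h2, ?_⟩
        have : β = q₁ := by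
          apply Nat.eq_of_mul_eq_mul_left hp0'
          rw [e2, mul_comm]
        rw [this]; exact h1
  have hrt : r % 2 = 1 ∧ t % 4 = 2 := by
    have h5 : (β * t ^ 2 + 0) % 8 = (α * r ^ 2 + 1) % 8 := by rw [h]
    rw [lin_mod β, lin_mod α, hαβ.1, hαβ.2] at h5
    have a : r % 8 = 0 ∨ r % 8 = 1 ∨ r % 8 = 2 ∨ r % 8 = 3 ∨ r % 8 = 4 ∨ r % 8 = 5 ∨ r % 8 = 6 ∨ r % 8 = 7 := by omega
    have b : t % 8 = 0 ∨ t % 8 = 1 ∨ t % 8 = 2 ∨ t % 8 = 3 ∨ t % 8 = 4 ∨ t % 8 = 5 ∨ t % 8 = 6 ∨ t % 8 = 7 := by omega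
    rcases a with a | a | a | a | a | a | a | a <;> rcases b with b | b | b | b | b | b | b | b <;> simp [a, b] at h5 <;> omega
  have hT : (2 * (α * r ^ 2) + 1) % 16 = 7 := by
    have a1 := sq_mod (a := r) (Nat.odd_iff.2 hrt.1)
    have : (α * r ^ 2) % 8 = 3 := by rw [Nat.mul_mod, a1, hαβ.1]
    omega
  have hU : (2 * (r * t)) % 8 = 4 := by
    have : (r * t) % 4 = 2 := by
      rw [Nat.mul_mod, hrt.2]
      have : r % 4 = 1 ∨ r % 4 = 3 := by omega
      rcases this with h | h <;> rw [h]
    omega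
  have hn : ((2 * (α * r ^ 2) + 1 : ℕ) : ℤ) ^ 2 - d * ((2 * (r * t) : ℕ) : ℤ) ^ 2 = 1 := by
    have h' : ((β * t ^ 2 : ℕ) : ℤ) = ((α * r ^ 2 + 1 : ℕ) : ℤ) := by rw [h]
    rw [← e2]
    push_cast at h' ⊢
    linear_combination (-4 * α * r ^ 2 : ℤ) * h'
  exact odd_of_unit hns hd8 (base_two hsf hp₁ hp₂ e (by omega) (by omega)) hn (by norm_num) 
    (hTU_B d _ _ hd8 (by exact_mod_cast hT) (by exact_mod_cast hU)) n

theorem odd_dir (d : ℕ) (hd1 : 1 < d) (hodd : Odd d) (hsf : Squarefree d) (n : ℕ)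
    (h : (∃ q₁ q₂ : ℕ, q₁.Prime ∧ q₂.Prime ∧ q₁ % 4 = 3 ∧ q₂ % 4 = 3 ∧
          (q₁ % 8 = 3 ∨ q₂ % 8 = 3) ∧ d = q₁ * q₂) ∨
       (d.Prime ∧ d % 4 = 3) ∨
       (d.Prime ∧ d % 8 = 5) ∨
       (d.Prime ∧ d % 8 = 1 ∧ Xor' (∃ x : ZMod d, x ^ 4 = 2) (d % 16 = 1))) : 
    Odd (Nat.card (ClassGroup (𝓞 (LL n d)))) := by
  have hns := nsq_sf hsf hd1
  rcases h with ⟨q₁, q₂, p1, p2, a1, a2, a3, e⟩ | ⟨hp, h⟩ | ⟨hp, h⟩ | ⟨hp, h8, hx⟩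
  · by_cases hb : q₁ % 8 = 3 ∧ q₂ % 8 = 3
    · exact odd_case_one hsf p1 p2 e hb.1 hb.2 n
    · have h5 : d % 8 = 5 := by
        have b1 : q₁ % 8 = 3 ∨ q₁ % 8 = 7 := by omega
        have b2 : q₂ % 8 = 3 ∨ q₂ % 8 = 7 := by omega
        rw [e, Nat.mul_mod]
        rcases b1 with b1 | b1 <;> rcases b2 with b2 | b2
        · exact absurd ⟨b1, b2⟩ hb
        · rw [b1, b2]
        · rw [b1, b2]
        · omega
      exact odd_of_oneP hns hodd (base_two hsf p1 p2 e a1 a2) (oneP_five hns h5) n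
  · exact odd_of_oneP hns hodd (base_three hp h) (oneP_three hns h) n
  · exact odd_of_oneP hns hodd (base_prime1 hp (by omega)) (oneP_five hns h) n
  · exact odd_four hp h8 hx n

end Part13

/-- for odd squarefree `d > 1` and `n ≥ 1`, the class number of
`L_{n,d}⁺` is odd iff `d` has one of the four listed forms. -/
theorem classNumber_Lplus_odd_iff
    (d : ℕ) (hd1 : 1 < d) (hodd : Odd d) (hsf : Squarefree d)
    (n : ℕ) (hn : 1 ≤ n) :
    Odd (Nat.card (ClassGroup (𝓞 (LplusField n (d : ℤ))))) ↔
      ((∃ q₁ q₂ : ℕ, q₁.Prime ∧ q₂.Prime ∧ q₁ % 4 = 3 ∧ q₂ % 4 = 3 ∧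
          (q₁ % 8 = 3 ∨ q₂ % 8 = 3) ∧ d = q₁ * q₂) ∨
       (d.Prime ∧ d % 4 = 3) ∨
       (d.Prime ∧ d % 8 = 5) ∨
       (d.Prime ∧ d % 8 = 1 ∧ Xor' (∃ x : ZMod d, x ^ 4 = 2) (d % 16 = 1))) := by
  exact ⟨even_dir d hd1 hodd hsf n hn, odd_dir d hd1 hodd hsf n⟩
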